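/- Let Q_M be a quasianalytic Denjoy–Carleman class, U ⊆ ℝ^n open, X a closed Q_M-subset of U, and a ∈ X. Then there exist an open neighborhood V of a in U and a finite filtration X∩V = X_0 ⊇ X_1 ⊇ ⋯ ⊇ X_{t+1} = ∅ such that for each k = 0,…,t, X_k is a closed Q_M-subset of V and every point of X_k∖X_{k+1} is a Q_M-smooth point of X_k. -/

import Mathlib

namespace QDC

/-- `M` is a sequence defining a quasianalytic Denjoy–Carleman class: positive,
logarithmically convex, with `sup_k (M_{k+1}/M_k)^{1/k} < ∞` and
`Σ_k M_k/((k+1) M_{k+1}) = ∞`. -/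
def IsDCSeq (M : ℕ → ℝ) : Prop :=
  (∀ k, 0 < M k) ∧
  (∀ k, M (k + 1) / M k ≤ M (k + 2) / M (k + 1)) ∧
  (∃ C : ℝ, ∀ k : ℕ, 1 ≤ k → (M (k + 1) / M k) ^ ((1 : ℝ) / k) ≤ C) ∧
  ¬ Summable (fun k => M k / ((k + 1) * M (k + 1)))

variable {σ : Type*} [Fintype σ] [DecidableEq σ]

/-- First-order partial derivative in the `i`-th coordinate direction. -/
noncomputable def pd (i : σ) (f : (σ → ℝ) → ℝ) : (σ → ℝ) → ℝ :=
  fun x => fderiv ℝ f x (Pi.single i 1)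

/-- Iterated partial derivative `∂^{|α|} f / ∂x^α` for a multi-index `α`. -/
noncomputable def mpd (α : σ → ℕ) (f : (σ → ℝ) → ℝ) : (σ → ℝ) → ℝ :=
  (Finset.univ : Finset σ).toList.foldr (fun i g => (pd i)^[α i] g) f

/-- `α! = α_1! ⋯ α_n!`. -/
def mfact (α : σ → ℕ) : ℕ := ∏ i, (α i).factorial

/-- `|α| = α_1 + ⋯ + α_n`. -/
def mdeg (α : σ → ℕ) : ℕ := ∑ i, α i

/-- `f` belongs to the Denjoy–Carleman class `Q_M(V)`. -/
def MemDC (M : ℕ → ℝ) (V : Set (σ → ℝ)) (f : (σ → ℝ) → ℝ) : Prop :=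
  ContDiffOn ℝ (⊤ : ℕ∞) f V ∧
  ∀ K ⊆ V, IsCompact K → ∃ A B : ℝ, 0 < A ∧ 0 < B ∧
    ∀ x ∈ K, ∀ α : σ → ℕ,
      |mpd α f x| ≤ A * B ^ mdeg α * (mfact α : ℝ) * M (mdeg α)

/-- `X` is a closed `Q_M`-subset of the open set `U`: it is closed in `U` and locally
the common zero set of finitely many functions of class `Q_M`. -/
def IsQMClosed (M : ℕ → ℝ) {n : ℕ} (U X : Set (Fin n → ℝ)) : Prop :=
  X ⊆ U ∧ closure X ∩ U ⊆ X ∧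
  ∀ b ∈ X, ∃ V : Set (Fin n → ℝ), IsOpen V ∧ b ∈ V ∧ V ⊆ U ∧
    ∃ (k : ℕ) (g : Fin k → ((Fin n → ℝ) → ℝ)),
      (∀ i, MemDC M V (g i)) ∧ X ∩ V = {x ∈ V | ∀ i, g i x = 0}

/-- `f : X∖Z → ℝ` belongs to `Q_M(X,Z)`: it is a quotient `g/h` of restrictions to `X` of
functions of class `Q_M` on a neighbourhood of `X`, where `h` vanishes nowhere on `X∖Z`. -/
def MemQXZ (M : ℕ → ℝ) {n : ℕ} (X Z : Set (Fin n → ℝ)) (f : (Fin n → ℝ) → ℝ) : Prop :=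
  ∃ (V : Set (Fin n → ℝ)) (g h : (Fin n → ℝ) → ℝ), IsOpen V ∧ X ⊆ V ∧
    MemDC M V g ∧ MemDC M V h ∧ (∀ x ∈ X \ Z, h x ≠ 0) ∧
    ∀ x ∈ X \ Z, f x = g x / h x

/-- `b` is a `Q_M`-smooth point of `X ⊆ ℝ^n`: near `b`, `X` is the graph of a
`Q_M`-map over some subset `I` of the coordinates. -/
def QMSmoothPt (M : ℕ → ℝ) {n : ℕ} (X : Set (Fin n → ℝ)) (b : Fin n → ℝ) : Prop :=
  ∃ W : Set (Fin n → ℝ), IsOpen W ∧ b ∈ W ∧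
    ∃ (I : Finset (Fin n)) (Ω : Set ({ i : Fin n // i ∈ I } → ℝ))
      (ψ : ({ i : Fin n // i ∈ I } → ℝ) → ({ i : Fin n // i ∉ I } → ℝ)),
      IsOpen Ω ∧ (∀ j : { i : Fin n // i ∉ I }, MemDC M Ω (fun u => ψ u j)) ∧
      X ∩ W = {y ∈ W | (fun i : { i : Fin n // i ∈ I } => y i) ∈ Ω ∧
        ∀ j : { i : Fin n // i ∉ I }, y j = ψ (fun i : { i : Fin n // i ∈ I } => y i) j}

/-- The formal Taylor expansion `T_a f` of `f` at `a`, as a multivariate formal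
power series. -/
noncomputable def taylorAt {n : ℕ} (f : (Fin n → ℝ) → ℝ) (a : Fin n → ℝ) :
    MvPowerSeries (Fin n) ℝ :=
  fun α : Fin n →₀ ℕ => mpd (fun i => α i) f a / (mfact fun i => α i : ℕ)

/-- `f` is flat at `x`: all iterated partial derivatives (including order `0`) vanish. -/
def FlatAt {n : ℕ} (f : (Fin n → ℝ) → ℝ) (x : Fin n → ℝ) : Prop :=
  ∀ α : Fin n → ℕ, mpd α f x = 0

end QDC

namespace QDC
open Filter Topology Set
open scoped ContDiff Nat

section Calc
variable {E F G H : Type} [NormedAddCommGroup E] [NormedSpace ℝ E] [NormedAddCommGroup F]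
  [NormedSpace ℝ F] [NormedAddCommGroup G] [NormedSpace ℝ G] [NormedAddCommGroup H]
  [NormedSpace ℝ H]

lemma bil_le (B : F →L[ℝ] G →L[ℝ] H) (hB : ‖B‖ ≤ 1) {f : E → F} {g : E → G} {x : E} (n : ℕ)
    (hf : ContDiffAt ℝ n f x) (hg : ContDiffAt ℝ n g x) :
    ‖iteratedFDeriv ℝ n (fun y => B (f y) (g y)) x‖ ≤ ∑ i ∈ Finset.range (n + 1),
      (n.choose i : ℝ) * ‖iteratedFDeriv ℝ i f x‖ * ‖iteratedFDeriv ℝ (n - i) g x‖ := by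
  obtain ⟨u, hu, hfu⟩ := hf.contDiffOn le_rfl (by simp)
  obtain ⟨v, hv, hgv⟩ := hg.contDiffOn le_rfl (by simp)
  obtain ⟨w, hw, hwo, hxw⟩ := mem_nhds_iff.1 (inter_mem hu hv)
  have h1 := hfu.mono (fun y hy => (hw hy).1)
  have h2 := hgv.mono (fun y hy => (hw hy).2)
  have := B.norm_iteratedFDerivWithin_le_of_bilinear_of_le_one h1 h2 hwo.uniqueDiffOn hxw le_rfl hB
  rw [iteratedFDerivWithin_of_isOpen _ hwo hxw] at this
  refine this.trans (le_of_eq ?_)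
  refine Finset.sum_congr rfl fun i _ => ?_
  rw [iteratedFDerivWithin_of_isOpen _ hwo hxw, iteratedFDerivWithin_of_isOpen _ hwo hxw]

/-- truncated weighted norm of the jet -/
noncomputable def S (N : ℕ) (r : ℝ) (f : E → F) (x : E) : ℝ :=
  ∑ k ∈ Finset.range (N + 1), ‖iteratedFDeriv ℝ k f x‖ * (r ^ k / k !)

lemma S_nonneg {N : ℕ} {r : ℝ} (hr : 0 ≤ r) (f : E → F) (x : E) : 0 ≤ S N r f x :=
  Finset.sum_nonneg fun _ _ => by positivity

lemma S_mono_N {N : ℕ} {r : ℝ} (hr : 0 ≤ r) (f : E → F) (x : E) : S N r f x ≤ S (N+1) r f x := by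
  unfold S
  rw [Finset.sum_range_succ _ (N+1)]
  have : 0 ≤ ‖iteratedFDeriv ℝ (N+1) f x‖ * (r ^ (N+1) / (N+1) !) := by positivity
  linarith

lemma S_mono {N : ℕ} {r r' : ℝ} (hr : 0 ≤ r) (h : r ≤ r') (f : E → F) (x : E) :
    S N r f x ≤ S N r' f x := by
  unfold S; gcongr

lemma S_congr {N : ℕ} {r : ℝ} {f g : E → F} {x : E} (h : f =ᶠ[𝓝 x] g) : S N r f x = S N r g x := by
  unfold S
  refine Finset.sum_congr rfl fun k _ => ?_
  rw [(h.iteratedFDeriv ℝ k).eq_of_nhds]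

lemma S_bil (B : F →L[ℝ] G →L[ℝ] H) (hB : ‖B‖ ≤ 1) {f : E → F} {g : E → G} {x : E} (N : ℕ)
    {r : ℝ} (hr : 0 ≤ r)
    (hf : ContDiffAt ℝ N f x) (hg : ContDiffAt ℝ N g x) :
    S N r (fun y => B (f y) (g y)) x ≤ S N r f x * S N r g x := by
  set a : ℕ → ℝ := fun k => ‖iteratedFDeriv ℝ k f x‖ * (r ^ k / k !) with ha
  set b : ℕ → ℝ := fun k => ‖iteratedFDeriv ℝ k g x‖ * (r ^ k / k !) with hb
  have ha0 : ∀ k, 0 ≤ a k := fun k => by positivity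
  have hb0 : ∀ k, 0 ≤ b k := fun k => by positivity
  have h1 : S N r (fun y => B (f y) (g y)) x ≤
      ∑ k ∈ Finset.range (N+1), ∑ i ∈ Finset.range (k+1), a i * b (k - i) := by
    refine Finset.sum_le_sum fun k hk => ?_
    have hk' : k ≤ N := by simpa [Nat.lt_succ_iff] using hk
    have := bil_le B hB k (hf.of_le (by exact_mod_cast hk')) (hg.of_le (by exact_mod_cast hk'))
    refine (mul_le_mul_of_nonneg_right this (by positivity)).trans (le_of_eq ?_)
    rw [Finset.sum_mul]
    refine Finset.sum_congr rfl fun i hi => ?_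
    have hi' : i ≤ k := by simpa [Nat.lt_succ_iff] using hi
    simp only [ha, hb]
    rw [Nat.cast_choose ℝ hi']
    have e : r ^ k = r ^ i * r ^ (k - i) := by rw [← pow_add]; congr 1; omega
    rw [e]
    have : (k ! : ℝ) ≠ 0 := by positivity
    have : (i ! : ℝ) ≠ 0 := by positivity
    have : ((k - i) ! : ℝ) ≠ 0 := by positivity
    field_simp
  refine h1.trans ?_
  change _ ≤ (∑ k ∈ Finset.range (N+1), a k) * (∑ k ∈ Finset.range (N+1), b k)
  rw [Finset.sum_range_diag_flip (N+1) (fun i j => a i * b j), Finset.sum_mul_sum]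
  refine Finset.sum_le_sum fun i _ => Finset.sum_le_sum_of_subset_of_nonneg ?_ ?_
  · intro j hj; simp at hj ⊢; omega
  · intro j _ _; exact mul_nonneg (ha0 _) (hb0 _)

lemma S_zero (r : ℝ) (f : E → F) (x : E) : S 0 r f x = ‖f x‖ := by simp [S]

lemma S_at_zero (N : ℕ) (f : E → F) (x : E) : S N 0 f x = ‖f x‖ := by
  unfold S
  rw [Finset.sum_range_succ']
  simp

lemma S_hasDerivAt (N : ℕ) (f : E → F) (x : E) (r : ℝ) :
    HasDerivAt (fun r => S (N+1) r f x) (S N r (fderiv ℝ f) x) r := by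
  unfold S
  have h : ∀ k ∈ Finset.range (N+1+1), HasDerivAt
      (fun r : ℝ => ‖iteratedFDeriv ℝ k f x‖ * (r ^ k / k !))
      (‖iteratedFDeriv ℝ k f x‖ * (k * r ^ (k-1) / k !)) r := fun k _ =>
    ((hasDerivAt_pow k r).div_const _).const_mul _
  have := HasDerivAt.fun_sum h
  refine this.congr_deriv (Eq.symm ?_)
  rw [Finset.sum_range_succ' _ (N+1)]
  simp only [CharP.cast_eq_zero, zero_mul, zero_div, mul_zero, add_zero]
  refine Finset.sum_congr rfl fun k _ => ?_
  rw [norm_iteratedFDeriv_fderiv, Nat.factorial_succ, Nat.add_sub_cancel]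
  have : (k ! : ℝ) ≠ 0 := by positivity
  have : (k + 1 : ℝ) ≠ 0 := by positivity
  push_cast
  field_simp

lemma le_of_deriv_le {a b a' b' : ℝ → ℝ} {r : ℝ} (hr : 0 ≤ r)
    (ha : ∀ s, HasDerivAt a (a' s) s) (hb : ∀ s, HasDerivAt b (b' s) s)
    (h0 : a 0 ≤ b 0) (h : ∀ s, 0 ≤ s → s ≤ r → a' s ≤ b' s) : a r ≤ b r := by
  have : MonotoneOn (fun s => b s - a s) (Icc 0 r) := by
    refine monotoneOn_of_deriv_nonneg (convex_Icc 0 r) ?_ ?_ ?_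
    · exact fun s _ => ((hb s).sub (ha s)).continuousAt.continuousWithinAt
    · exact fun s _ => ((hb s).sub (ha s)).differentiableAt.differentiableWithinAt
    · intro s hs
      rw [interior_Icc] at hs
      rw [((hb s).fun_sub (ha s)).deriv]
      linarith [h s hs.1.le hs.2.le]
  have := this (left_mem_Icc.2 hr) (right_mem_Icc.2 hr) hr
  simp only at this
  linarith

lemma fderiv_comp_ev {f : F → G} {g : E → F} {x : E} (hf : ContDiffAt ℝ ∞ f (g x))
    (hg : ContDiffAt ℝ ∞ g x) : fderiv ℝ (fun y => f (g y)) =ᶠ[𝓝 x]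
      fun y => (ContinuousLinearMap.compL ℝ E F G) (fderiv ℝ f (g y)) (fderiv ℝ g y) := by
  have h1 : ∀ᶠ y in 𝓝 x, DifferentiableAt ℝ g y :=
    ((hg.of_le (by simp : (1 : ℕ∞ω) ≤ ∞)).eventually (by simp)).mono fun y hy =>
      hy.differentiableAt (by simp)
  have h2 : ∀ᶠ z in 𝓝 (g x), DifferentiableAt ℝ f z :=
    ((hf.of_le (by simp : (1 : ℕ∞ω) ≤ ∞)).eventually (by simp)).mono fun y hy =>
      hy.differentiableAt (by simp)
  filter_upwards [h1, hg.continuousAt.eventually h2] with y h1 h2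
  exact fderiv_comp y h2 h1

set_option maxSynthPendingDepth 3 in
lemma compL_le : ‖ContinuousLinearMap.compL ℝ E F G‖ ≤ 1 := ContinuousLinearMap.norm_compL_le ℝ E F G

lemma contDiffAt_fderiv {f : E → F} {x : E} (hf : ContDiffAt ℝ ∞ f x) :
    ContDiffAt ℝ ∞ (fderiv ℝ f) x := hf.fderiv_right (by simp)

end Calc

lemma S_comp (N : ℕ) {E F G : Type} [NormedAddCommGroup E] [NormedSpace ℝ E] [NormedAddCommGroup F]
    [NormedSpace ℝ F] [NormedAddCommGroup G] [NormedSpace ℝ G] {f : F → G} {g : E → F} {x : E}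
    (hf : ContDiffAt ℝ ∞ f (g x)) (hg : ContDiffAt ℝ ∞ g x) {r : ℝ} (hr : 0 ≤ r) :
    S N r (fun y => f (g y)) x ≤ S N (S N r g x - ‖g x‖) f (g x) := by
  induction N generalizing G r with
  | zero => simp [S_zero]
  | succ N ih =>
    have key := le_of_deriv_le (a := fun s => S (N+1) s (fun y => f (g y)) x)
      (b := fun s => S (N+1) (S (N+1) s g x - ‖g x‖) f (g x)) hr
      (fun s => S_hasDerivAt N _ x s)
      (fun s => HasDerivAt.comp (h₂ := fun r => S (N+1) r f (g x)) s
        (S_hasDerivAt N f (g x) (S (N+1) s g x - ‖g x‖))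
        ((S_hasDerivAt N g x s).sub_const ‖g x‖)) (by simp [S_at_zero]) ?_
    · exact key
    · intro s hs _
      rw [S_congr (fderiv_comp_ev hf hg)]
      have hle : (N : ℕ∞ω) ≤ ∞ := by exact_mod_cast le_top
      have hfd := contDiffAt_fderiv hf
      refine (S_bil _ compL_le N hs ((hfd.comp x hg).of_le hle)
        ((contDiffAt_fderiv hg).of_le hle)).trans ?_
      refine mul_le_mul_of_nonneg_right ?_ (S_nonneg hs _ _)
      refine (ih hfd hs).trans (S_mono ?_ ?_ _ _)
      · have := S_mono (N := N) le_rfl hs g x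
        rw [S_at_zero] at this; linarith
      · linarith [S_mono_N (N := N) hs g x]

end QDC

namespace QDC
open Filter Topology Set
open scoped ContDiff Nat

section Seq
variable {M : ℕ → ℝ}

def Good (M : ℕ → ℝ) (N : ℕ) (R : ℝ) : Prop :=
  M 2 / M 1 ≤ R ∧ (∀ k, k + 1 ≤ N → M (k+1) ≤ M 1 * R ^ k) ∧ ∀ k, k + 1 = N → M N = M 1 * R ^ k

lemma ratio_mono (hM : IsDCSeq M) : Monotone (fun k => M (k+1) / M k) :=
  monotone_nat_of_le_succ hM.2.1

lemma M_pow_le (hM : IsDCSeq M) (j : ℕ) : M (j+1) / M 1 ≤ (M (j+2) / M (j+1)) ^ j := by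
  have h0 := hM.1
  induction j with
  | zero => simp [(h0 1).ne']
  | succ j ih =>
    have e : M (j+1+1) / M 1 = (M (j+1)/M 1) * (M (j+2) / M (j+1)) := by
      have := (h0 1).ne'; have := (h0 (j+1)).ne'; field_simp
    have hq : M (j+2)/M (j+1) ≤ M (j+1+2) / M (j+1+1) := hM.2.1 (j+1)
    have p1 : 0 < M (j+2)/M (j+1) := div_pos (h0 _) (h0 _)
    rw [e, pow_succ]
    have := (ih.trans (pow_le_pow_left₀ p1.le hq j))
    exact mul_le_mul this hq p1.le (le_trans (div_pos (h0 _) (h0 _)).le this)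

lemma M_pow_comp (hM : IsDCSeq M) (j l : ℕ) :
    (M (j+1) / M 1) ^ (j + l) ≤ (M (j+l+1) / M 1) ^ j := by
  have h0 := hM.1
  have key : ∀ l, M (j+1) / M 1 * (M (j+2) / M (j+1)) ^ l ≤ M (j+l+1) / M 1 := by
    intro l
    induction l with
    | zero => simp
    | succ l ih =>
      have e : M (j+(l+1)+1) / M 1 = M (j+l+1) / M 1 * (M (j+l+1+1) / M (j+l+1)) := by
        have := (h0 1).ne'; have := (h0 (j+l+1)).ne'; field_simp
        rfl
      rw [e, pow_succ, ← mul_assoc]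
      have hq : M (j+2)/M (j+1) ≤ M (j+l+1+1) / M (j+l+1) :=
        ratio_mono hM (by omega : j+1 ≤ j+l+1)
      exact mul_le_mul ih hq (div_pos (h0 _) (h0 _)).le (div_pos (h0 _) (h0 _)).le
  have p : 0 < M (j+1)/M 1 := div_pos (h0 _) (h0 _)
  have p2 : 0 < M (j+2)/M (j+1) := div_pos (h0 _) (h0 _)
  calc (M (j+1) / M 1) ^ (j + l) = (M (j+1) / M 1) ^ j * (M (j+1) / M 1) ^ l := pow_add _ _ _
    _ ≤ (M (j+1) / M 1) ^ j * ((M (j+2) / M (j+1)) ^ j) ^ l := by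
        gcongr; exact M_pow_le hM j
    _ = (M (j+1) / M 1 * (M (j+2) / M (j+1)) ^ l) ^ j := by
        rw [mul_pow, ← pow_mul, ← pow_mul, mul_comm j l]
    _ ≤ _ := pow_le_pow_left₀ (by positivity) (key l) j

lemma exists_good (hM : IsDCSeq M) (N : ℕ) : ∃ R, Good M (N+1) R := by
  have h0 := hM.1
  rcases Nat.eq_zero_or_pos N with rfl | hN
  · refine ⟨M 2 / M 1, le_rfl, fun k hk => ?_, fun k hk => ?_⟩ <;>
    · obtain rfl : k = 0 := by omega
      simp
  · set P := M (N+1) / M 1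
    have hP : 0 < P := div_pos (h0 _) (h0 _)
    have hR : (P ^ ((1:ℝ)/N)) ^ N = P := by
      rw [← Real.rpow_natCast, ← Real.rpow_mul hP.le]
      have : (N:ℝ) ≠ 0 := by positivity
      rw [one_div_mul_cancel this, Real.rpow_one]
    have hle : ∀ k, k ≤ N → M (k+1) / M 1 ≤ (P ^ ((1:ℝ)/N))^k := by
      intro k hk
      obtain ⟨l, rfl⟩ := Nat.exists_eq_add_of_le hk
      refine le_of_pow_le_pow_left₀ (n := k + l) (by omega) (by positivity) ?_
      rw [← pow_mul, mul_comm k, pow_mul, hR]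
      exact M_pow_comp hM k l
    refine ⟨P ^ ((1:ℝ)/N), ?_, ?_, ?_⟩
    · simpa using hle 1 hN
    · intro k hk
      have := hle k (by omega)
      rwa [div_le_iff₀' (h0 1)] at this
    · intro k hk
      obtain rfl : k = N := by omega
      rw [hR]; simp only [P]; have := (h0 1).ne'; field_simp

lemma M_mul_le (hM : IsDCSeq M) (i j : ℕ) : M i * M j ≤ M 0 * M (i + j) := by
  have h0 := hM.1
  induction i with
  | zero => simp
  | succ i ih =>
    have h := ratio_mono hM (by omega : i ≤ i + j)
    simp only [] at h
    rw [div_le_div_iff₀ (h0 _) (h0 _)] at h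
    have e : i + 1 + j = i + j + 1 := by omega
    rw [e]
    have h1 := h0 i; have h2 := h0 (i+j); have h3 := h0 (i+j+1); have h4 := h0 (i+1)
    have h5 := h0 j
    have : M i * M (i+j) * (M (i+1) * M j) ≤ M i * M (i+j) * (M 0 * M (i+j+1)) := by
      calc _ = (M (i+1) * M (i+j)) * (M i * M j) := by ring
        _ ≤ (M (i+j+1) * M i) * (M 0 * M (i+j)) := by gcongr
        _ = _ := by ring
    exact le_of_mul_le_mul_left this (by positivity)

lemma exists_step (hM : IsDCSeq M) : ∃ C : ℝ, 0 < C ∧ ∀ k, M (k+1) ≤ C ^ (k+1) * M k := by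
  obtain ⟨C, hC⟩ := hM.2.2.1
  have h0 := hM.1
  refine ⟨max 1 (max C (M 1 / M 0)), by positivity, fun k => ?_⟩
  set D := max 1 (max C (M 1 / M 0))
  have hD1 : 1 ≤ D := le_max_left _ _
  have hD2 : C ≤ D := (le_max_left _ _).trans (le_max_right _ _)
  have hD3 : M 1 / M 0 ≤ D := (le_max_right _ _).trans (le_max_right _ _)
  rw [← div_le_iff₀ (h0 k)]
  rcases Nat.eq_zero_or_pos k with rfl | hk
  · simpa using hD3
  · have h := (hC k hk).trans hD2
    have p : 0 < M (k+1)/M k := div_pos (h0 _) (h0 _)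
    have h' := pow_le_pow_left₀ (by positivity) h k
    rw [← Real.rpow_natCast, ← Real.rpow_mul p.le] at h'
    have : (k:ℝ) ≠ 0 := by positivity
    rw [one_div_mul_cancel this, Real.rpow_one] at h'
    exact h'.trans (pow_le_pow_right₀ hD1 (by omega))

end Seq

section DC
variable {E F G H : Type} [NormedAddCommGroup E] [NormedSpace ℝ E] [NormedAddCommGroup F]
  [NormedSpace ℝ F] [NormedAddCommGroup G] [NormedSpace ℝ G] [NormedAddCommGroup H]
  [NormedSpace ℝ H] {M : ℕ → ℝ}

def DCAt (M : ℕ → ℝ) (f : E → F) (x : E) : Prop :=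
  ∃ A B : ℝ, 0 < A ∧ 0 < B ∧ ∀ᶠ y in 𝓝 x, ContDiffAt ℝ ∞ f y ∧
    ∀ k : ℕ, ‖iteratedFDeriv ℝ k f y‖ ≤ A * B ^ k * k ! * M k

lemma DCAt.congr {f g : E → F} {x : E} (hf : DCAt M f x) (h : f =ᶠ[𝓝 x] g) : DCAt M g x := by
  obtain ⟨A, B, hA, hB, hh⟩ := hf
  refine ⟨A, B, hA, hB, ?_⟩
  filter_upwards [hh, h.eventuallyEq_nhds] with y hy hyg
  refine ⟨hy.1.congr_of_eventuallyEq hyg.symm, fun k => ?_⟩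
  rw [← (hyg.iteratedFDeriv ℝ k).eq_of_nhds]; exact hy.2 k

lemma DCAt.eventually {f : E → F} {x : E} (hf : DCAt M f x) : ∀ᶠ y in 𝓝 x, DCAt M f y := by
  obtain ⟨A, B, hA, hB, hh⟩ := hf
  filter_upwards [hh.eventually_nhds] with y hy
  exact ⟨A, B, hA, hB, hy⟩

lemma DCAt.contDiffAt {f : E → F} {x : E} (hf : DCAt M f x) : ContDiffAt ℝ ∞ f x := by
  obtain ⟨A, B, hA, hB, hh⟩ := hf
  exact hh.self_of_nhds.1

lemma DCAt.continuousAt {f : E → F} {x : E} (hf : DCAt M f x) : ContinuousAt f x :=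
  hf.contDiffAt.continuousAt

lemma DCAt.differentiableAt {f : E → F} {x : E} (hf : DCAt M f x) : DifferentiableAt ℝ f x :=
  hf.contDiffAt.differentiableAt (by simp)

lemma DCAt.T_bound (hM : IsDCSeq M) {f : E → F} {x : E} (hf : DCAt M f x) :
    ∃ C r : ℝ, 0 < C ∧ 0 < r ∧ ∀ᶠ y in 𝓝 x, ContDiffAt ℝ ∞ f y ∧
      ∀ N R, Good M (N+1) R → S N (r / R) (fderiv ℝ f) y ≤ C := by
  obtain ⟨A, B, hA, hB, hh⟩ := hf
  have h1 := hM.1 1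
  refine ⟨A * B * M 1 * 2, 1 / (4 * B), by positivity, by positivity, ?_⟩
  filter_upwards [hh] with y hy
  refine ⟨hy.1, fun N R hR => ?_⟩
  have hR0 : 0 < R := lt_of_lt_of_le (div_pos (hM.1 2) (hM.1 1)) hR.1
  have : ∀ k ∈ Finset.range (N+1), ‖iteratedFDeriv ℝ k (fderiv ℝ f) y‖ *
      ((1 / (4 * B) / R) ^ k / k !) ≤ A * B * M 1 * (1/2 : ℝ)^k := by
    intro k hk
    have hk' : k + 1 ≤ N + 1 := by simpa using hk
    rw [norm_iteratedFDeriv_fderiv]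
    have h2 : ‖iteratedFDeriv ℝ (k+1) f y‖ ≤ A * B ^ (k+1) * (k+1)! * (M 1 * R ^ k) := by
      refine (hy.2 (k+1)).trans ?_
      gcongr; exact hR.2.1 k hk'
    refine (mul_le_mul_of_nonneg_right h2 (by positivity)).trans ?_
    have e : A * B ^ (k+1) * (k+1)! * (M 1 * R ^ k) * ((1 / (4 * B) / R) ^ k / k !) =
        A * B * M 1 * ((k+1) * (1/4)^k) := by
      rw [Nat.factorial_succ, div_pow, div_pow, mul_pow]
      have : (k ! : ℝ) ≠ 0 := by positivity
      have h4 : (4:ℝ)^k*(1/4)^k=1 := by rw [← mul_pow]; norm_num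
      push_cast
      field_simp
      rw [one_pow, pow_succ]
      linear_combination (-(B^k*B)) * h4
    rw [e]
    gcongr
    have : (k + 1 : ℝ) ≤ 2 ^ k := by exact_mod_cast (Nat.lt_two_pow_self (n := k))
    calc (k+1 : ℝ) * (1/4)^k ≤ 2^k * (1/4)^k := by gcongr
      _ = (1/2)^k := by rw [← mul_pow]; norm_num
  refine (Finset.sum_le_sum this).trans ?_
  rw [← Finset.mul_sum]
  gcongr
  have := sum_geometric_two_le (N+1)
  simpa using this

lemma DCAt.of_T (hM : IsDCSeq M) {f : E → F} {x : E} {C r : ℝ} (hC : 0 < C) (hr : 0 < r)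
    (h : ∀ᶠ y in 𝓝 x, ContDiffAt ℝ ∞ f y ∧
      ∀ N R, Good M (N+1) R → S N (r / R) (fderiv ℝ f) y ≤ C) : DCAt M f x := by
  have h0 := hM.1
  have hc : ContinuousAt f x := h.self_of_nhds.1.continuousAt
  have hbd : ∀ᶠ y in 𝓝 x, ‖f y‖ ≤ ‖f x‖ + 1 :=
    (hc.norm.eventually (gt_mem_nhds (by linarith : ‖f x‖ < ‖f x‖ + 1))).mono fun y hy => le_of_lt hy
  have m0 := h0 0; have m1 := h0 1
  refine ⟨max ((‖f x‖+1)/M 0) (C * r / M 1), 1 / r, by positivity, by positivity, ?_⟩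
  filter_upwards [h, hbd] with y hy hb
  refine ⟨hy.1, fun k => ?_⟩
  rcases k with _ | k
  · rw [norm_iteratedFDeriv_zero]
    have : (‖f x‖+1)/M 0 ≤ max ((‖f x‖+1)/M 0) (C * r / M 1) := le_max_left _ _
    rw [div_le_iff₀ m0] at this
    simpa using hb.trans this
  · obtain ⟨R, hR⟩ := exists_good hM k
    have hR0 : 0 < R := lt_of_lt_of_le (div_pos (hM.1 2) (hM.1 1)) hR.1
    have h1 := hy.2 k R hR
    have h2 : ‖iteratedFDeriv ℝ k (fderiv ℝ f) y‖ * ((r/R)^k / k !) ≤ C := by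
      refine le_trans ?_ h1
      unfold S
      exact Finset.single_le_sum (f := fun k => ‖iteratedFDeriv ℝ k (fderiv ℝ f) y‖ * ((r/R)^k / k !))
        (fun i _ => by positivity) (by simp)
    rw [norm_iteratedFDeriv_fderiv] at h2
    have hp : 0 < (r/R)^k / (k ! : ℝ) := by positivity
    rw [← le_div_iff₀ hp] at h2
    have h3 : C / ((r/R)^k / k !) = (C * r / M 1) * (1/r)^(k+1) * k ! * M (k+1) := by
      rw [hR.2.2 k rfl, div_pow, div_pow]
      have : (k ! : ℝ) ≠ 0 := by positivity
      rw [pow_succ r k]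
      field_simp
      simp
    rw [h3] at h2
    have m2 := h0 (k+1)
    refine h2.trans ?_
    gcongr
    · exact le_max_right _ _
    · omega

end DC
end QDC

namespace QDC
open Filter Topology Set
open scoped ContDiff Nat

section DC
variable {E F G H : Type} [NormedAddCommGroup E] [NormedSpace ℝ E] [NormedAddCommGroup F]
  [NormedSpace ℝ F] [NormedAddCommGroup G] [NormedSpace ℝ G] [NormedAddCommGroup H]
  [NormedSpace ℝ H] {M : ℕ → ℝ}

lemma S_const (N : ℕ) (r : ℝ) (c : F) (x : E) : S N r (fun _ => c) x = ‖c‖ := by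
  unfold S
  rw [Finset.sum_range_succ', Finset.sum_eq_zero]
  · simp
  · intro k _
    rw [iteratedFDeriv_const_of_ne (by omega)]; simp

lemma DCAt.const (hM : IsDCSeq M) (c : F) (x : E) : DCAt M (fun _ : E => c) x := by
  refine DCAt.of_T hM (C := 1) (r := 1) one_pos one_pos (Eventually.of_forall fun y => ?_)
  refine ⟨contDiffAt_const, fun N R _ => ?_⟩
  have : fderiv ℝ (fun _ : E => c) = fun _ => 0 := by ext1 y; simp
  rw [this, S_const]; simp

lemma DCAt.clm (hM : IsDCSeq M) (L : E →L[ℝ] F) (x : E) : DCAt M L x := by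
  refine DCAt.of_T hM (C := ‖L‖ + 1) (r := 1) (by positivity) one_pos
    (Eventually.of_forall fun y => ?_)
  refine ⟨L.contDiff.contDiffAt, fun N R _ => ?_⟩
  have : fderiv ℝ L = fun _ => L := by ext1 y; simp
  rw [this, S_const]; simp

lemma DCAt.id (hM : IsDCSeq M) (x : E) : DCAt M (fun y : E => y) x :=
  DCAt.clm hM (ContinuousLinearMap.id ℝ E) x

lemma Good.pos (hM : IsDCSeq M) {N R} (h : Good M N R) : 0 < R :=
  lt_of_lt_of_le (div_pos (hM.1 2) (hM.1 1)) h.1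

lemma S_sub_le (N : ℕ) {s : ℝ} (hs : 0 ≤ s) (g : E → F) (y : E) :
    S N s g y - ‖g y‖ ≤ s * S N s (fderiv ℝ g) y := by
  unfold S
  rw [Finset.sum_range_succ', Finset.sum_range_succ]
  simp only [norm_iteratedFDeriv_fderiv, norm_iteratedFDeriv_zero, pow_zero, Nat.factorial_zero,
    Nat.cast_one, div_one, mul_one, add_sub_cancel_right]
  rw [mul_add, Finset.mul_sum]
  have : ∀ k ∈ Finset.range N, ‖iteratedFDeriv ℝ (k+1) g y‖ * (s^(k+1) / (k+1)!) ≤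
      s * (‖iteratedFDeriv ℝ (k+1) g y‖ * (s^k / k !)) := by
    intro k _
    calc _ ≤ ‖iteratedFDeriv ℝ (k+1) g y‖ * (s^(k+1) / k !) := by
            gcongr; omega
      _ = _ := by ring
  refine (Finset.sum_le_sum this).trans ?_
  have : 0 ≤ s * (‖iteratedFDeriv ℝ (N+1) g y‖ * (s^N / N !)) := by positivity
  linarith

lemma DCAt.comp (hM : IsDCSeq M) {f : F → G} {g : E → F} {x : E} (hf : DCAt M f (g x))
    (hg : DCAt M g x) : DCAt M (fun y => f (g y)) x := by
  obtain ⟨Cf, rf, hCf, hrf, hf'⟩ := hf.T_bound hM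
  obtain ⟨Cg, rg, hCg, hrg, hg'⟩ := hg.T_bound hM
  refine DCAt.of_T hM (C := Cf * Cg) (r := min rg (rf / Cg)) (by positivity) (by positivity) ?_
  filter_upwards [hg', hg.continuousAt.eventually hf'] with y hy hfy
  refine ⟨hfy.1.comp y hy.1, fun N R hR => ?_⟩
  have hR0 := hR.pos hM
  set ρ := min rg (rf / Cg) with hρ
  have hρ0 : 0 < ρ := by positivity
  have hs0 : 0 ≤ ρ / R := by positivity
  have h1 : S N (ρ / R) (fderiv ℝ g) y ≤ Cg :=
    (S_mono hs0 (by gcongr; exact min_le_left _ _) _ _).trans (hy.2 N R hR)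
  rw [S_congr (fderiv_comp_ev hfy.1 hy.1)]
  have c1 := contDiffAt_fderiv hfy.1
  have c2 := contDiffAt_fderiv hy.1
  have c3 : ContDiffAt ℝ ∞ (fun y => fderiv ℝ f (g y)) y := c1.comp y hy.1
  refine (S_bil _ compL_le N hs0 (c3.of_le (by exact_mod_cast le_top)) (c2.of_le (by exact_mod_cast le_top))).trans ?_
  refine mul_le_mul ?_ h1 (S_nonneg hs0 _ _) hCf.le
  refine (S_comp N c1 hy.1 hs0).trans ?_
  refine (S_mono ?_ ?_ _ _).trans (hfy.2 N R hR)
  · unfold S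
    rw [Finset.sum_range_succ']
    simp
    exact Finset.sum_nonneg fun _ _ => by positivity
  · refine (S_sub_le N hs0 g y).trans ?_
    calc ρ / R * S N (ρ / R) (fderiv ℝ g) y ≤ (rf / Cg) / R * Cg := by
          gcongr
          · exact S_nonneg hs0 _ _
          · exact min_le_right _ _
      _ = rf / R := by field_simp

lemma DCAt.clm_comp (hM : IsDCSeq M) (L : F →L[ℝ] G) {f : E → F} {x : E} (hf : DCAt M f x) :
    DCAt M (fun y => L (f y)) x := DCAt.comp hM (DCAt.clm hM L _) hf

lemma DCAt.add (hM : IsDCSeq M) {f g : E → F} {x : E} (hf : DCAt M f x) (hg : DCAt M g x) :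
    DCAt M (fun y => f y + g y) x := by
  obtain ⟨A, B, hA, hB, h⟩ := hf
  obtain ⟨A', B', hA', hB', h'⟩ := hg
  refine ⟨A + A', max B B', by positivity, by positivity, ?_⟩
  filter_upwards [h, h'] with y hy hy'
  refine ⟨hy.1.add hy'.1, fun k => ?_⟩
  have c1 : ContDiffAt ℝ k f y := hy.1.of_le (by exact_mod_cast le_top)
  have c2 : ContDiffAt ℝ k g y := hy'.1.of_le (by exact_mod_cast le_top)
  have e : iteratedFDeriv ℝ k (fun y => f y + g y) y =
      iteratedFDeriv ℝ k f y + iteratedFDeriv ℝ k g y := iteratedFDeriv_add_apply c1 c2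
  rw [e]
  have m := hM.1 k
  calc _ ≤ _ := norm_add_le _ _
    _ ≤ A * B ^ k * k ! * M k + A' * B' ^ k * k ! * M k := add_le_add (hy.2 k) (hy'.2 k)
    _ ≤ A * (max B B') ^ k * k ! * M k + A' * (max B B') ^ k * k ! * M k := by
        gcongr
        · exact le_max_left _ _
        · exact le_max_right _ _
    _ = _ := by ring

lemma DCAt.bil (hM : IsDCSeq M) (L : F →L[ℝ] G →L[ℝ] H) (hL : ‖L‖ ≤ 1) {f : E → F} {g : E → G}
    {x : E} (hf : DCAt M f x) (hg : DCAt M g x) : DCAt M (fun y => L (f y) (g y)) x := by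
  obtain ⟨A, B, hA, hB, h⟩ := hf
  obtain ⟨A', B', hA', hB', h'⟩ := hg
  have m0 := hM.1 0
  refine ⟨A * A' * M 0, 2 * max B B', by positivity, by positivity, ?_⟩
  filter_upwards [h, h'] with y hy hy'
  refine ⟨?_, fun k => ?_⟩
  · exact (L.contDiff.contDiffAt.comp y hy.1).clm_apply hy'.1
  have c1 : ContDiffAt ℝ k f y := hy.1.of_le (by exact_mod_cast le_top)
  have c2 : ContDiffAt ℝ k g y := hy'.1.of_le (by exact_mod_cast le_top)
  refine (bil_le L hL k c1 c2).trans ?_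
  have m := hM.1 k
  have : ∀ i ∈ Finset.range (k+1), (k.choose i : ℝ) * ‖iteratedFDeriv ℝ i f y‖ *
      ‖iteratedFDeriv ℝ (k-i) g y‖ ≤ A * A' * M 0 * (max B B')^k * k ! * M k := by
    intro i hi
    have hi : i ≤ k := by simp at hi; omega
    have mi := hM.1 i
    have mi' := hM.1 (k - i)
    have e1 := hy.2 i
    have e2 := hy'.2 (k-i)
    have hch : (k.choose i : ℝ) * i ! * (k-i)! = k ! := by
      exact_mod_cast Nat.choose_mul_factorial_mul_factorial hi
    have hmm := M_mul_le hM i (k-i)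
    rw [Nat.add_sub_cancel' hi] at hmm
    calc _ ≤ (k.choose i : ℝ) * (A * B ^ i * i ! * M i) * (A' * B' ^ (k-i) * (k-i)! * M (k-i)) := by
            gcongr
      _ ≤ (k.choose i : ℝ) * (A * (max B B') ^ i * i ! * M i) *
            (A' * (max B B') ^ (k-i) * (k-i)! * M (k-i)) := by
            gcongr
            · exact le_max_left _ _
            · exact le_max_right _ _
      _ = A * A' * ((max B B') ^ i * (max B B') ^ (k-i)) * ((k.choose i : ℝ) * i ! * (k-i)!) *
            (M i * M (k-i)) := by ring
      _ ≤ A * A' * ((max B B') ^ i * (max B B') ^ (k-i)) * ((k.choose i : ℝ) * i ! * (k-i)!) *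
            (M 0 * M k) := by gcongr
      _ = _ := by rw [hch, ← pow_add, Nat.add_sub_cancel' hi]; ring
  refine (Finset.sum_le_sum this).trans ?_
  rw [Finset.sum_const, Finset.card_range, nsmul_eq_mul]
  have h2 : ((k+1 : ℕ) : ℝ) ≤ 2 ^ k := by exact_mod_cast (Nat.lt_two_pow_self (n := k))
  calc _ ≤ 2 ^ k * (A * A' * M 0 * (max B B')^k * k ! * M k) := by gcongr
    _ = _ := by rw [mul_pow]; ring

lemma DCAt.mul (hM : IsDCSeq M) {f g : E → ℝ} {x : E} (hf : DCAt M f x) (hg : DCAt M g x) :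
    DCAt M (fun y => f y * g y) x :=
  DCAt.bil hM (ContinuousLinearMap.mul ℝ ℝ) (ContinuousLinearMap.opNorm_mul_le ℝ ℝ) hf hg

lemma DCAt.neg (hM : IsDCSeq M) {f : E → F} {x : E} (hf : DCAt M f x) :
    DCAt M (fun y => - f y) x := by
  have := DCAt.clm_comp hM (-ContinuousLinearMap.id ℝ F) hf
  simpa using this

lemma DCAt.sub (hM : IsDCSeq M) {f g : E → F} {x : E} (hf : DCAt M f x) (hg : DCAt M g x) :
    DCAt M (fun y => f y - g y) x := by
  simpa [sub_eq_add_neg] using hf.add hM (hg.neg hM)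

lemma DCAt.sum (hM : IsDCSeq M) {ι : Type*} (s : Finset ι) {f : ι → E → F} {x : E}
    (h : ∀ i ∈ s, DCAt M (f i) x) : DCAt M (fun y => ∑ i ∈ s, f i y) x := by
  classical
  induction s using Finset.induction_on with
  | empty => simpa using DCAt.const hM (0:F) x
  | insert a s ha ih =>
    simp only [Finset.sum_insert ha]
    exact (h a (by simp)).add hM (ih fun i hi => h i (by simp [hi]))

lemma DCAt.prod (hM : IsDCSeq M) {ι : Type*} (s : Finset ι) {f : ι → E → ℝ} {x : E}
    (h : ∀ i ∈ s, DCAt M (f i) x) : DCAt M (fun y => ∏ i ∈ s, f i y) x := by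
  classical
  induction s using Finset.induction_on with
  | empty => simpa using DCAt.const hM (1:ℝ) x
  | insert a s ha ih =>
    simp only [Finset.prod_insert ha]
    exact (h a (by simp)).mul hM (ih fun i hi => h i (by simp [hi]))

lemma DCAt.pow (hM : IsDCSeq M) {f : E → ℝ} {x : E} (hf : DCAt M f x) (k : ℕ) :
    DCAt M (fun y => f y ^ k) x := by
  have := DCAt.prod hM (Finset.range k) (f := fun _ => f) (x := x) (fun _ _ => hf)
  simpa using this

lemma DCAt.prodMk (hM : IsDCSeq M) {f : E → F} {g : E → G} {x : E} (hf : DCAt M f x)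
    (hg : DCAt M g x) : DCAt M (fun y => (f y, g y)) x := by
  have := (hf.clm_comp hM (ContinuousLinearMap.inl ℝ F G)).add hM
    (hg.clm_comp hM (ContinuousLinearMap.inr ℝ F G))
  simpa using this

lemma DCAt.pi (hM : IsDCSeq M) {ι : Type} [Fintype ι] {f : E → ι → ℝ} {x : E}
    (h : ∀ i, DCAt M (fun y => f y i) x) : DCAt M f x := by
  classical
  have := DCAt.sum hM (Finset.univ) (x := x) (f := fun i y =>
    ContinuousLinearMap.single ℝ (fun _ : ι => ℝ) i (f y i)) (fun i _ => (h i).clm_comp hM _)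
  refine this.congr (Eventually.of_forall fun y => ?_)
  ext j
  simp [Finset.sum_apply, Pi.single_apply]

lemma DCAt.apply (hM : IsDCSeq M) {ι : Type} [Fintype ι] {f : E → ι → ℝ} {x : E}
    (h : DCAt M f x) (i : ι) : DCAt M (fun y => f y i) x :=
  h.clm_comp hM (ContinuousLinearMap.proj i : (ι → ℝ) →L[ℝ] ℝ)

lemma DCAt.fderiv (hM : IsDCSeq M) {f : E → F} {x : E} (hf : DCAt M f x) :
    DCAt M (_root_.fderiv ℝ f) x := by
  obtain ⟨A, B, hA, hB, h⟩ := hf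
  obtain ⟨C, hC, hCk⟩ := exists_step hM
  refine ⟨A * B * C, 2 * B * C, by positivity, by positivity, ?_⟩
  filter_upwards [h] with y hy
  refine ⟨contDiffAt_fderiv hy.1, fun k => ?_⟩
  rw [norm_iteratedFDeriv_fderiv]
  have m := hM.1 k
  have h2 : ((k+1 : ℕ) : ℝ) ≤ 2 ^ k := by exact_mod_cast (Nat.lt_two_pow_self (n := k))
  calc _ ≤ _ := hy.2 (k+1)
    _ ≤ A * B^(k+1) * (2 ^ k * k !) * (C ^ (k+1) * M k) := by
        rw [Nat.factorial_succ]
        push_cast at h2 ⊢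
        gcongr
        · exact (hM.1 _).le
        · exact hCk k
    _ = _ := by rw [mul_pow, mul_pow]; ring

lemma DCAt.fderiv_apply (hM : IsDCSeq M) {f : E → F} {x : E} (hf : DCAt M f x) (v : E) :
    DCAt M (fun y => _root_.fderiv ℝ f y v) x :=
  (hf.fderiv hM).clm_comp hM (ContinuousLinearMap.apply ℝ F v)

lemma DCAt.fst (hM : IsDCSeq M) (x : E × F) : DCAt M (fun y : E × F => y.1) x :=
  DCAt.clm hM (ContinuousLinearMap.fst ℝ E F) x
lemma DCAt.snd (hM : IsDCSeq M) (x : E × F) : DCAt M (fun y : E × F => y.2) x :=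
  DCAt.clm hM (ContinuousLinearMap.snd ℝ E F) x

end DC
end QDC

namespace QDC
open Filter Topology Set
open scoped ContDiff Nat

section DC
variable {E F G H : Type} [NormedAddCommGroup E] [NormedSpace ℝ E] [NormedAddCommGroup F]
  [NormedSpace ℝ F] [NormedAddCommGroup G] [NormedSpace ℝ G] [NormedAddCommGroup H]
  [NormedSpace ℝ H] {M : ℕ → ℝ}

set_option maxSynthPendingDepth 3 in
lemma DCAt.ringInverse (hM : IsDCSeq M) {A : Type} [NormedRing A] [NormedAlgebra ℝ A]
    [CompleteSpace A] {a : A} (ha : IsUnit a) : DCAt M (Ring.inverse : A → A) a := by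
  obtain ⟨u, rfl⟩ := ha
  have hev : ∀ᶠ y : A in 𝓝 (u : A), IsUnit y := Units.isOpen.mem_nhds u.isUnit
  have hcd : ContDiffAt ℝ ∞ (Ring.inverse : A → A) (u : A) := contDiffAt_ringInverse ℝ u
  set b := ‖Ring.inverse (u : A)‖ + 1 with hb
  have hb0 : 0 < b := by positivity
  have hbd : ∀ᶠ y in 𝓝 (u : A), ‖Ring.inverse y‖ ≤ b :=
    (hcd.continuousAt.norm.eventually (gt_mem_nhds (by linarith : ‖Ring.inverse (u:A)‖ < b))).mono
      fun y hy => le_of_lt hy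
  have hR0 : 0 < M 2 / M 1 := div_pos (hM.1 2) (hM.1 1)
  refine DCAt.of_T hM (C := 4 * b ^ 2) (r := (M 2 / M 1) / (4 * b)) (by positivity) (by positivity) ?_
  filter_upwards [hev.eventually_nhds, hbd] with y hy hby
  have hcy : ContDiffAt ℝ ∞ (Ring.inverse : A → A) y := by
    obtain ⟨w, rfl⟩ := hy.self_of_nhds
    exact contDiffAt_ringInverse ℝ w
  refine ⟨hcy, fun N R hR => ?_⟩
  have hD : _root_.fderiv ℝ (Ring.inverse : A → A) =ᶠ[𝓝 y] fun z =>
      (-ContinuousLinearMap.mulLeftRight ℝ A) (Ring.inverse z) (Ring.inverse z) := by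
    filter_upwards [hy] with z hz
    obtain ⟨w, rfl⟩ := hz
    rw [(hasFDerivAt_ringInverse (𝕜 := ℝ) w).fderiv]
    simp
  have hB : ‖-ContinuousLinearMap.mulLeftRight ℝ A‖ ≤ 1 := by
    rw [norm_neg]; exact ContinuousLinearMap.opNorm_mulLeftRight_le ℝ A
  have hstep : ∀ N s, 0 ≤ s → S N s (_root_.fderiv ℝ (Ring.inverse : A → A)) y ≤
      S N s Ring.inverse y ^ 2 := by
    intro N s hs
    rw [S_congr hD, sq]
    exact S_bil _ hB N hs (hcy.of_le (by exact_mod_cast le_top))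
      (hcy.of_le (by exact_mod_cast le_top))
  have hφ : ∀ N s, 0 ≤ s → s ≤ 1 / (4 * b) → S N s (Ring.inverse : A → A) y ≤ 2 * b := by
    intro N
    induction N with
    | zero => intro s _ _; rw [S_zero]; linarith
    | succ N ih =>
      intro s hs hs'
      have := le_of_deriv_le (a := fun s => S (N+1) s (Ring.inverse : A → A) y)
        (b := fun s => b + 4 * b^2 * s) (b' := fun s => 4 * b ^ 2) hs
        (fun s => S_hasDerivAt N _ y s)
        (fun s => by simpa using ((hasDerivAt_id s).const_mul (4*b^2)).const_add b)
        (by simp [S_at_zero, hby]) (fun t ht ht' => by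
          refine (hstep N t ht).trans ?_
          have h1 := ih t ht (ht'.trans hs')
          have h2 := S_nonneg (N := N) ht (Ring.inverse : A → A) y
          nlinarith)
      refine this.trans ?_
      have : 4 * b^2 * s ≤ 4 * b ^2 * (1 / (4*b)) := by gcongr
      have e : 4 * b ^2 * (1 / (4*b)) = b := by field_simp
      linarith
  have hR' := hR.pos hM
  have hs0 : 0 ≤ M 2 / M 1 / (4 * b) / R := by positivity
  refine (hstep N _ hs0).trans ?_
  have := hφ N _ hs0 (by
    rw [div_div, div_le_div_iff₀ (by positivity) (by positivity)]
    have := hR.1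
    nlinarith)
  have h2 := S_nonneg (N := N) hs0 (Ring.inverse : A → A) y
  nlinarith

lemma S_mono_N' {N N' : ℕ} (h : N ≤ N') {r : ℝ} (hr : 0 ≤ r) (f : E → F) (x : E) :
    S N r f x ≤ S N' r f x :=
  monotone_nat_of_le_succ (f := fun N => S N r f x) (fun _ => S_mono_N hr f x) h

lemma S_sub_le' (N : ℕ) {s : ℝ} (hs : 0 ≤ s) (g : E → F) (y : E) :
    S (N+1) s g y - ‖g y‖ ≤ s * S N s (fderiv ℝ g) y := by
  unfold S
  rw [Finset.sum_range_succ']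
  simp only [norm_iteratedFDeriv_fderiv, norm_iteratedFDeriv_zero, pow_zero, Nat.factorial_zero,
    Nat.cast_one, div_one, mul_one, add_sub_cancel_right]
  rw [Finset.mul_sum]
  refine Finset.sum_le_sum fun k _ => ?_
  calc _ ≤ ‖iteratedFDeriv ℝ (k+1) g y‖ * (s^(k+1) / k !) := by
          gcongr; omega
    _ = _ := by ring

lemma S_sub_nonneg (N : ℕ) {s : ℝ} (hs : 0 ≤ s) (g : E → F) (y : E) :
    0 ≤ S N s g y - ‖g y‖ := by
  unfold S
  rw [Finset.sum_range_succ']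
  simp
  exact Finset.sum_nonneg fun _ _ => by positivity

lemma DCAt.S_bound (hM : IsDCSeq M) {f : E → F} {x : E} (hf : DCAt M f x) :
    ∃ C r : ℝ, 0 < C ∧ 0 < r ∧ ∀ᶠ y in 𝓝 x, ContDiffAt ℝ ∞ f y ∧
      ∀ N R, Good M (N+1) R → S N (r / R) f y ≤ C := by
  obtain ⟨C, r, hC, hr, h⟩ := hf.T_bound hM
  have hR0 : 0 < M 2 / M 1 := div_pos (hM.1 2) (hM.1 1)
  have hbd : ∀ᶠ y in 𝓝 x, ‖f y‖ ≤ ‖f x‖ + 1 :=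
    (hf.continuousAt.norm.eventually (gt_mem_nhds (by linarith : ‖f x‖ < ‖f x‖ + 1))).mono
      fun y hy => le_of_lt hy
  refine ⟨‖f x‖ + 1 + r / (M 2 / M 1) * C, r, by positivity, hr, ?_⟩
  filter_upwards [h, hbd] with y hy hby
  refine ⟨hy.1, fun N R hR => ?_⟩
  have hR' := hR.pos hM
  have hs : 0 ≤ r / R := by positivity
  have := S_sub_le N hs f y
  have h2 : r / R * S N (r/R) (_root_.fderiv ℝ f) y ≤ r / (M 2 / M 1) * C := by
    gcongr
    · exact S_nonneg hs _ _
    · exact hR.1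
    · exact hy.2 N R hR
  linarith

lemma DCAt.inverse_fun (hM : IsDCSeq M) [CompleteSpace E] {P : E → E} {x : E}
    (hP : DCAt M P x) (hu : IsUnit (_root_.fderiv ℝ P x)) :
    ∃ Q : E → E, Q (P x) = x ∧ DCAt M Q (P x) ∧ (∀ᶠ y in 𝓝 (P x), P (Q y) = y) ∧
      ∀ᶠ z in 𝓝 x, Q (P z) = z := by
  have hcd := hP.contDiffAt
  obtain ⟨u, hu'⟩ := hu
  let e : E ≃L[ℝ] E := ContinuousLinearEquiv.ofUnit u
  have he : (e : E →L[ℝ] E) = _root_.fderiv ℝ P x := by rw [← hu']; rfl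
  have hd : HasFDerivAt P (e : E →L[ℝ] E) x := by
    rw [he]; exact hP.differentiableAt.hasFDerivAt
  have hsd : HasStrictFDerivAt P (e : E →L[ℝ] E) x := hcd.hasStrictFDerivAt' hd (by simp)
  set Q := hsd.localInverse P e x with hQ
  have hQx : Q (P x) = x := hsd.localInverse_apply_image
  have hQc : ContDiffAt ℝ ∞ Q (P x) := hcd.to_localInverse hd (by simp)
  refine ⟨Q, hQx, ?_, hsd.eventually_right_inverse, hsd.eventually_left_inverse⟩
  have hri := hsd.eventually_right_inverse
  have hQcont := hQc.continuousAt
  have hQt : Tendsto Q (𝓝 (P x)) (𝓝 x) := by simpa [ContinuousAt, hQx] using hQcont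
  have hunit : ∀ᶠ z in 𝓝 x, IsUnit (_root_.fderiv ℝ P z) := by
    have : ContinuousAt (_root_.fderiv ℝ P) x := (hP.fderiv hM).continuousAt
    refine this.eventually (Units.isOpen.mem_nhds ?_)
    exact hu' ▸ u.isUnit
  have hG : DCAt M (fun z => Ring.inverse (_root_.fderiv ℝ P z)) x :=
    DCAt.comp hM (DCAt.ringInverse hM (hu' ▸ u.isUnit)) (hP.fderiv hM)
  obtain ⟨C, r, hC, hr, hG'⟩ := hG.S_bound hM
  have hQc' : ∀ᶠ y in 𝓝 (P x), ContDiffAt ℝ ∞ Q y := by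
    have hloc := hsd.localInverse_apply_image
    have hPe := hP.eventually
    have := hQt.eventually (hPe.and hunit)
    have hopen : ∀ᶠ y in 𝓝 (P x), y ∈ (hsd.toOpenPartialHomeomorph P).target :=
      (hsd.toOpenPartialHomeomorph P).open_target.mem_nhds hsd.image_mem_toOpenPartialHomeomorph_target
    filter_upwards [this, hopen] with y hy hyt
    obtain ⟨w, hw⟩ := hy.2
    have := (hsd.toOpenPartialHomeomorph P).contDiffAt_symm (n := ∞)
      (f₀' := ContinuousLinearEquiv.ofUnit w) hyt (by
        have h1 := hy.1.differentiableAt.hasFDerivAt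
        rw [← hw] at h1
        exact h1) hy.1.contDiffAt
    exact this
  have hDQ : ∀ᶠ y in 𝓝 (P x), _root_.fderiv ℝ Q y = Ring.inverse (_root_.fderiv ℝ P (Q y)) := by
    filter_upwards [hri.eventually_nhds, hQc', hQt.eventually (hP.eventually.and hunit)] with y h1 h2 h3
    have hPd := h3.1.differentiableAt
    have hQd : DifferentiableAt ℝ Q y := h2.differentiableAt (by simp)
    have h4 : HasFDerivAt (fun y => P (Q y)) ((_root_.fderiv ℝ P (Q y)).comp (_root_.fderiv ℝ Q y)) y :=
      hPd.hasFDerivAt.comp y hQd.hasFDerivAt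
    have h5 : HasFDerivAt (fun y => P (Q y)) (ContinuousLinearMap.id ℝ E) y :=
      (hasFDerivAt_id y).congr_of_eventuallyEq h1
    have h6 := h4.unique h5
    have h7 : _root_.fderiv ℝ P (Q y) * _root_.fderiv ℝ Q y = 1 := h6
    calc _ = Ring.inverse (_root_.fderiv ℝ P (Q y)) * (_root_.fderiv ℝ P (Q y) * _root_.fderiv ℝ Q y) := by
          rw [← mul_assoc, Ring.inverse_mul_cancel _ h3.2, one_mul]
      _ = _ := by rw [h7, mul_one]
  refine DCAt.of_T hM (C := C) (r := min r (r / C)) hC (by positivity) ?_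
  filter_upwards [hQc', hDQ.eventually_nhds, hQt.eventually hG'] with y h1 h2 h3
  refine ⟨h1, fun N R hR => ?_⟩
  have hR' := hR.pos hM
  set s := min r (r / C) / R with hs
  have hs0 : 0 ≤ s := by positivity
  have hGN := h3.2 N R hR
  have : ∀ j ≤ N, S j s (_root_.fderiv ℝ Q) y ≤ C := by
    intro j
    induction j with
    | zero =>
      intro _
      rw [S_congr h2, S_zero, ← S_zero (r / R) (fun z => Ring.inverse (_root_.fderiv ℝ P z))]
      exact (S_mono_N' (Nat.zero_le N) (by positivity) _ _).trans hGN
    | succ j ih =>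
      intro hj
      have ihj := ih (by omega)
      rw [S_congr h2]
      refine (S_comp (j+1) (f := fun z => Ring.inverse (_root_.fderiv ℝ P z)) h3.1 h1 hs0).trans ?_
      refine (S_mono_N' hj (S_sub_nonneg _ hs0 _ _) _ _).trans ?_
      refine (S_mono (S_sub_nonneg _ hs0 _ _) ?_ _ _).trans hGN
      refine (S_sub_le' j hs0 Q y).trans ?_
      calc s * S j s (_root_.fderiv ℝ Q) y ≤ (r / C) / R * C := by
            gcongr
            · exact S_nonneg hs0 _ _
            · rw [hs]; gcongr; exact min_le_right _ _
        _ = r / R := by field_simp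
  exact this N le_rfl

lemma DCAt.inv (hM : IsDCSeq M) {f : E → ℝ} {x : E} (hf : DCAt M f x) (h : f x ≠ 0) :
    DCAt M (fun y => (f y)⁻¹) x := by
  have := DCAt.comp hM (DCAt.ringInverse hM (isUnit_iff_ne_zero.2 h)) hf
  simpa using this

end DC
end QDC

namespace QDC
open Filter Topology Set MeasureTheory
open scoped ContDiff Nat

section DC
variable {E F : Type} [NormedAddCommGroup E] [NormedSpace ℝ E] [NormedAddCommGroup F]
  [NormedSpace ℝ F] {M : ℕ → ℝ}

/-- smoothness on the strip -/
def Strip (U : Set E) (H : ℝ × E → F) : Prop :=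
  ∀ s ∈ Icc (0:ℝ) 1, ∀ z ∈ U, ContDiffAt ℝ ∞ H (s, z)

noncomputable def dH (H : ℝ × E → F) : ℝ × E → (E →L[ℝ] F) :=
  fun p => (fderiv ℝ H p).comp (ContinuousLinearMap.inr ℝ ℝ E)

lemma Strip.dH {U : Set E} {H : ℝ × E → F} (h : Strip U H) : Strip U (dH H) := by
  intro s hs z hz
  have := contDiffAt_fderiv (h s hs z hz)
  exact this.clm_comp contDiffAt_const

lemma Strip.hasFDerivAt {U : Set E} {H : ℝ × E → F} (h : Strip U H) {s : ℝ} (hs : s ∈ Icc (0:ℝ) 1)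
    {z : E} (hz : z ∈ U) : HasFDerivAt (fun z => H (s, z)) (QDC.dH H (s, z)) z := by
  have h1 : HasFDerivAt H (fderiv ℝ H (s,z)) (s,z) :=
    ((h s hs z hz).differentiableAt (by simp)).hasFDerivAt
  have h2 : HasFDerivAt (fun z : E => (s, z)) (ContinuousLinearMap.inr ℝ ℝ E) z :=
    hasFDerivAt_prodMk_right s z
  exact h1.comp z h2

lemma Strip.continuousOn {U : Set E} {H : ℝ × E → F} (h : Strip U H) {z : E} (hz : z ∈ U) :
    ContinuousOn (fun s => H (s, z)) (Icc 0 1) := by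
  intro s hs
  have : ContinuousAt (fun s : ℝ => (s, z)) s := by fun_prop
  exact ((h s hs z hz).continuousAt.comp_of_eq this rfl).continuousWithinAt

lemma Strip.bound {U : Set E} (hU : IsOpen U) {H : ℝ × E → F} (h : Strip U H) {z : E} (hz : z ∈ U) :
    ∃ C, ∃ V ∈ 𝓝 z, V ⊆ U ∧ ∀ s ∈ Icc (0:ℝ) 1, ∀ w ∈ V, ‖H (s,w)‖ ≤ C := by
  have hK : IsCompact (Icc (0:ℝ) 1) := isCompact_Icc
  obtain ⟨C, hC⟩ := hK.exists_bound_of_continuousOn (h.continuousOn hz)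
  have : ∀ s ∈ Icc (0:ℝ) 1, ∀ᶠ p : ℝ × E in 𝓝 s ×ˢ 𝓝 z, ‖H p‖ ≤ C + 1 := by
    intro s hs
    rw [← nhds_prod_eq]
    have := (h s hs z hz).continuousAt.norm.eventually (gt_mem_nhds (by linarith [hC s hs] : ‖H (s,z)‖ < C + 1))
    exact this.mono fun p hp => le_of_lt hp
  have h3 : ∀ᶠ p : E × ℝ in 𝓝 z ×ˢ 𝓝ˢ (Icc (0:ℝ) 1), ‖H (p.2, p.1)‖ ≤ C + 1 := by
    refine hK.mem_prod_nhdsSet_of_forall ?_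
    intro s hs
    have := this s hs
    rw [Filter.prod_comm] at this
    exact this
  obtain ⟨V, hV, W, hW, hVW⟩ := Filter.mem_prod_iff.1 h3
  refine ⟨C + 1, V ∩ U, inter_mem hV (hU.mem_nhds hz), inter_subset_right, fun s hs w hw => ?_⟩
  exact hVW (⟨hw.1, subset_of_mem_nhdsSet hW hs⟩ : (w, s) ∈ V ×ˢ W)

lemma Strip.hasFDerivAt_int [CompleteSpace F] {U : Set E} (hU : IsOpen U) {H : ℝ × E → F} (h : Strip U H) {z : E}
    (hz : z ∈ U) : HasFDerivAt (fun z => ∫ s in (0:ℝ)..1, H (s, z)) (∫ s in (0:ℝ)..1, QDC.dH H (s, z)) z := by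
  obtain ⟨C, V, hV, hVU, hC⟩ := h.dH.bound hU hz
  have hI : uIoc (0:ℝ) 1 = Ioc 0 1 := by simp
  refine intervalIntegral.hasFDerivAt_integral_of_dominated_of_fderiv_le (bound := fun _ => C)
    (F := fun z s => H (s,z)) (F' := fun z s => QDC.dH H (s,z)) hV ?_ ?_ ?_ ?_ ?_ ?_
  · filter_upwards [hU.mem_nhds hz] with w hw
    rw [hI]
    exact ((h.continuousOn hw).mono Ioc_subset_Icc_self).aestronglyMeasurable measurableSet_Ioc
  · apply ContinuousOn.intervalIntegrable
    rw [uIcc_of_le zero_le_one]; exact h.continuousOn hz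
  · rw [hI]
    exact ((h.dH.continuousOn hz).mono Ioc_subset_Icc_self).aestronglyMeasurable measurableSet_Ioc
  · refine Eventually.of_forall fun t ht w hw => hC t ?_ w hw
    rw [hI] at ht; exact Ioc_subset_Icc_self ht
  · simp
  · refine Eventually.of_forall fun t ht w hw => h.hasFDerivAt ?_ (hVU hw)
    rw [hI] at ht; exact Ioc_subset_Icc_self ht

lemma Strip.int (k : ℕ) : ∀ {F : Type} [NormedAddCommGroup F] [NormedSpace ℝ F] [CompleteSpace F]
    {U : Set E} (_ : IsOpen U) {H : ℝ × E → F} (_ : Strip U H), ∀ z ∈ U,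
    ContDiffAt ℝ k (fun z => ∫ s in (0:ℝ)..1, H (s, z)) z ∧
    ∀ C, (∀ s ∈ Icc (0:ℝ) 1, ‖iteratedFDeriv ℝ k (fun z => H (s,z)) z‖ ≤ C) →
      ‖iteratedFDeriv ℝ k (fun z => ∫ s in (0:ℝ)..1, H (s, z)) z‖ ≤ C := by
  induction k with
  | zero =>
    intro F _ _ _ U hU H h z hz
    constructor
    · rw [Nat.cast_zero, contDiffAt_zero]
      exact ⟨U, hU.mem_nhds hz, fun w hw => (h.hasFDerivAt_int hU hw).continuousAt.continuousWithinAt⟩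
    · intro C hC
      simp only [norm_iteratedFDeriv_zero] at hC ⊢
      have := intervalIntegral.norm_integral_le_of_norm_le_const (a := (0:ℝ)) (b := 1) (C := C)
        (f := fun s => H (s,z)) (fun s hs => hC s (by
          rw [uIoc_of_le zero_le_one] at hs; exact Ioc_subset_Icc_self hs))
      simpa using this
  | succ k ih =>
    intro F _ _ _ U hU H h z hz
    have hd : fderiv ℝ (fun z => ∫ s in (0:ℝ)..1, H (s, z)) =ᶠ[𝓝 z]
        fun z => ∫ s in (0:ℝ)..1, QDC.dH H (s, z) := by
      filter_upwards [hU.mem_nhds hz] with w hw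
      exact (h.hasFDerivAt_int hU hw).fderiv
    obtain ⟨i1, i2⟩ := ih hU h.dH z hz
    constructor
    · rw [Nat.cast_succ, contDiffAt_succ_iff_hasFDerivAt]
      refine ⟨_, ⟨U, hU.mem_nhds hz, fun w hw => h.hasFDerivAt_int hU hw⟩, i1⟩
    · intro C hC
      rw [← norm_iteratedFDeriv_fderiv, (hd.iteratedFDeriv ℝ k).eq_of_nhds]
      refine i2 C fun s hs => ?_
      have := hC s hs
      rw [← norm_iteratedFDeriv_fderiv] at this
      have hd2 : fderiv ℝ (fun z => H (s, z)) =ᶠ[𝓝 z] fun z => QDC.dH H (s,z) := by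
        filter_upwards [hU.mem_nhds hz] with w hw
        exact (h.hasFDerivAt hs hw).fderiv
      rwa [(hd2.iteratedFDeriv ℝ k).eq_of_nhds] at this

lemma norm_iter_comp_clm {G : Type} [NormedAddCommGroup G] [NormedSpace ℝ G] {f : E → F} {U : Set E} (hU : IsOpen U)
    (hf : ∀ y ∈ U, ContDiffAt ℝ ∞ f y) (L : G →L[ℝ] E) {x : G} (hx : L x ∈ U) (k : ℕ) :
    ‖iteratedFDeriv ℝ k (fun y => f (L y)) x‖ ≤ ‖iteratedFDeriv ℝ k f (L x)‖ * ‖L‖ ^ k := by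
  have hU' : IsOpen (L ⁻¹' U) := hU.preimage L.continuous
  have := L.iteratedFDerivWithin_comp_right (f := f) (n := ∞)
    (fun y hy => (hf y hy).contDiffWithinAt) hU.uniqueDiffOn hU'.uniqueDiffOn hx (i := k)
    (by exact_mod_cast le_top)
  rw [iteratedFDerivWithin_of_isOpen k hU hx, iteratedFDerivWithin_of_isOpen k hU' (by exact hx)] at this
  have e : (fun y => f (L y)) = f ∘ L := rfl
  rw [e, this]
  refine (ContinuousMultilinearMap.norm_compContinuousLinearMap_le _ _).trans ?_
  simp

lemma DCAt.divide (hM : IsDCSeq M) {f : E → ℝ} {x : E} (hf : DCAt M f x) (l : E →L[ℝ] ℝ) (e : E)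
    (hx : l x = 0) : ∃ g : E → ℝ, DCAt M g x ∧ ∀ᶠ z in 𝓝 x, f z - f (z - l z • e) = l z * g z := by
  obtain ⟨A, B, hA, hB, h⟩ := hf.fderiv_apply hM e
  obtain ⟨ε, hε, hball⟩ := Metric.eventually_nhds_iff_ball.1 (h.and hf.eventually)
  set D : ℝ := 1 + ‖l‖ * ‖e‖ with hD
  have hD0 : 0 < D := by positivity
  set U := Metric.ball x (ε / D) with hUdef
  let L : ℝ → E →L[ℝ] E := fun s => ContinuousLinearMap.id ℝ E - (1 - s) • (l.smulRight e)
  have hLapp : ∀ s z, L s z = z - ((1 - s) * l z) • e := by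
    intro s z; simp [L, mul_smul]
  have hLn : ∀ s ∈ Icc (0:ℝ) 1, ‖L s‖ ≤ D := by
    intro s hs
    refine (norm_sub_le _ _).trans ?_
    refine add_le_add ContinuousLinearMap.norm_id_le ?_
    rw [norm_smul, ContinuousLinearMap.norm_smulRight_apply]
    have : ‖1 - s‖ ≤ 1 := by rw [Real.norm_eq_abs, abs_le]; constructor <;> linarith [hs.1, hs.2]
    have h2 : 0 ≤ ‖l‖ * ‖e‖ := by positivity
    nlinarith
  have hLU : ∀ s ∈ Icc (0:ℝ) 1, ∀ z ∈ U, L s z ∈ Metric.ball x ε := by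
    intro s hs z hz
    have hLx : L s x = x := by rw [hLapp, hx]; simp
    rw [mem_ball_iff_norm]
    have : L s z - x = L s (z - x) := by rw [map_sub, hLx]
    rw [this]
    have hz' : ‖z - x‖ < ε / D := by rwa [mem_ball_iff_norm] at hz
    calc _ ≤ ‖L s‖ * ‖z - x‖ := (L s).le_opNorm _
      _ ≤ D * ‖z - x‖ := by gcongr; exact hLn s hs
      _ < D * (ε / D) := by gcongr
      _ = ε := by field_simp
  have hUo : IsOpen U := Metric.isOpen_ball
  have hxU : x ∈ U := Metric.mem_ball_self (by positivity)
  let K : ℝ × E → ℝ := fun p => _root_.fderiv ℝ f (L p.1 p.2) e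
  have hK : Strip U K := by
    intro s hs z hz
    have h1 := (hball _ (hLU s hs z hz)).1.1
    have h2 : ContDiffAt ℝ ∞ (fun p : ℝ × E => L p.1 p.2) (s, z) := by
      simp only [hLapp]
      fun_prop
    exact ContDiffAt.comp (g := fun y => _root_.fderiv ℝ f y e) (s,z) h1 h2
  refine ⟨fun z => ∫ s in (0:ℝ)..1, K (s, z), ?_, ?_⟩
  · refine ⟨A, B * D, hA, by positivity, ?_⟩
    filter_upwards [hUo.mem_nhds hxU] with z hz
    refine ⟨contDiffAt_infty.2 fun k => (Strip.int k hUo hK z hz).1, fun k => ?_⟩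
    refine (Strip.int k hUo hK z hz).2 _ fun s hs => ?_
    have hm := hM.1 k
    refine (norm_iter_comp_clm (f := fun y => _root_.fderiv ℝ f y e) Metric.isOpen_ball
      (fun y hy => (hball y hy).1.1) (L s) (hLU s hs z hz) k).trans ?_
    calc _ ≤ (A * B ^ k * k ! * M k) * D ^ k := by
          gcongr
          · exact (hball _ (hLU s hs z hz)).1.2 k
          · exact hLn s hs
      _ = _ := by rw [mul_pow]; ring
  · filter_upwards [hUo.mem_nhds hxU] with z hz
    rw [← intervalIntegral.integral_const_mul]
    have := intervalIntegral.integral_eq_sub_of_hasDerivAt (a := (0:ℝ)) (b := 1)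
      (f := fun s => f (L s z)) (f' := fun s => l z * K (s, z)) (fun s hs => ?_) ?_
    · rw [this]; simp [hLapp]
    · rw [uIcc_of_le zero_le_one] at hs
      have h1 : HasFDerivAt f (_root_.fderiv ℝ f (L s z)) (L s z) :=
        (hball _ (hLU s hs z hz)).2.differentiableAt.hasFDerivAt
      have h2 : HasDerivAt (fun s => L s z) (l z • e) s := by
        simp only [hLapp]
        have := ((((hasDerivAt_id s).const_sub 1).mul_const (l z)).smul_const e).const_sub z
        simpa using this
      have := h1.comp_hasDerivAt s h2
      have e3 : _root_.fderiv ℝ f (L s z) (l z • e) = l z * K (s, z) := by simp [K]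
      rw [e3] at this
      exact this
    · apply ContinuousOn.intervalIntegrable
      rw [uIcc_of_le zero_le_one]
      exact (hK.continuousOn hz).const_mul _

end DC
end QDC

namespace QDC
open Filter Topology Set
open scoped ContDiff Nat

section Bang
variable {N : ℕ → ℝ} {D : ℕ → ℝ → ℝ}

lemma bang_step (hN : ∀ k, 0 < N k) (hmono : Monotone fun k => N (k+1) / N k)
    (hD : ∀ j, ∀ t ∈ Icc (0:ℝ) 1, HasDerivAt (D j) (D (j+1) t) t)
    (hb : ∀ j, ∀ t ∈ Icc (0:ℝ) 1, |D j t| ≤ N j)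
    (K : ℕ) {x y : ℝ} (hx : 0 ≤ x) (hxy : x ≤ y) (hy : y ≤ 1)
    (h : y - x ≤ Real.exp (-1) * (N K / N (K+1)))
    (hP : ∀ j, |D j x| ≤ Real.exp (-(K+1 : ℕ)) * Real.exp j * N j) :
    ∀ j, |D j y| ≤ Real.exp (-(K : ℕ)) * Real.exp j * N j := by
  set μ := N (K+1) / N K with hμ
  have hμ0 : 0 < μ := div_pos (hN _) (hN _)
  have key : ∀ i j, j + i = K + 1 → ∀ z ∈ Icc x y,
      |D j z| ≤ Real.exp (-(K+1 : ℕ)) * Real.exp j * N j * Real.exp (Real.exp 1 * μ * (z - x)) := by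
    intro i
    induction i with
    | zero =>
      intro j hj z hz
      obtain rfl : j = K + 1 := by omega
      refine (hb _ z ⟨hx.trans hz.1, hz.2.trans hy⟩).trans ?_
      rw [← Real.exp_add, neg_add_cancel, Real.exp_zero, one_mul]
      refine le_mul_of_one_le_right (hN _).le (Real.one_le_exp ?_)
      have : 0 ≤ z - x := by linarith [hz.1]
      positivity
    | succ i ih =>
      intro j hj
      have ih' := ih (j+1) (by omega)
      set c := Real.exp (-(K+1 : ℕ)) * Real.exp j * N j with hc
      have hmem : ∀ z ∈ Icc x y, z ∈ Icc (0:ℝ) 1 := fun z hz => ⟨hx.trans hz.1, hz.2.trans hy⟩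
      have := image_norm_le_of_norm_deriv_right_le_deriv_boundary (f := D j) (f' := D (j+1))
        (a := x) (b := y) (B := fun z => c * Real.exp (Real.exp 1 * μ * (z - x)))
        (B' := fun z => c * (Real.exp (Real.exp 1 * μ * (z - x)) * (Real.exp 1 * μ)))
        (fun z hz => (hD j z (hmem z hz)).continuousAt.continuousWithinAt)
        (fun z hz => (hD j z (hmem z (Ico_subset_Icc_self hz))).hasDerivWithinAt)
        (by rw [sub_self, mul_zero, Real.exp_zero, mul_one]; exact hP j)
        (fun z => by
          have h1 : HasDerivAt (fun z => Real.exp 1 * μ * (z - x)) (Real.exp 1 * μ) z := by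
            simpa using ((hasDerivAt_id z).sub_const x).const_mul (Real.exp 1 * μ)
          exact h1.exp.const_mul c)
        (fun z hz => by
          have h1 := ih' z (Ico_subset_Icc_self hz)
          rw [Real.norm_eq_abs]
          refine h1.trans ?_
          have h2 : N (j+1) ≤ N j * μ := by
            have := hmono (by omega : j ≤ K)
            simp only [] at this
            rw [div_le_iff₀ (hN j)] at this
            linarith
          have : c * (Real.exp (Real.exp 1 * μ * (z - x)) * (Real.exp 1 * μ)) =
            Real.exp (-(K+1 : ℕ)) * Real.exp ((j+1 : ℕ)) * (N j * μ) * Real.exp (Real.exp 1 * μ * (z - x)) := by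
              rw [Nat.cast_succ j, Real.exp_add (j:ℝ) 1, hc]; ring
          rw [this]
          gcongr)
      intro z hz
      exact this hz
  intro j
  by_cases hj : j ≤ K
  · have h1 := key (K + 1 - j) j (by omega) y ⟨hxy, le_rfl⟩
    refine h1.trans ?_
    have hN' := hN j
    have e : Real.exp (-(K:ℕ)) = Real.exp (-(K+1:ℕ)) * Real.exp 1 := by
      rw [← Real.exp_add]; push_cast; congr 1; ring
    have h2 : Real.exp (Real.exp 1 * μ * (y - x)) ≤ Real.exp 1 := by
      apply Real.exp_le_exp.2
      calc Real.exp 1 * μ * (y - x) ≤ Real.exp 1 * μ * (Real.exp (-1) * (N K / N (K+1))) := by gcongr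
        _ = (Real.exp 1 * Real.exp (-1)) * (μ * (N K / N (K+1))) := by ring
        _ = 1 := by
          rw [← Real.exp_add, hμ]
          have := (hN K).ne'; have := (hN (K+1)).ne'
          field_simp
          simp
    calc _ ≤ Real.exp (-(K+1 : ℕ)) * Real.exp j * N j * Real.exp 1 := by gcongr
      _ = _ := by rw [e]; ring
  · refine (hb j y ⟨hx.trans hxy, hy⟩).trans ?_
    rw [← Real.exp_add]
    refine le_mul_of_one_le_left (hN _).le (Real.one_le_exp ?_)
    have : (K:ℝ) ≤ j := by exact_mod_cast (by omega : K ≤ j)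
    linarith

lemma bang (hN : ∀ k, 0 < N k) (hmono : Monotone fun k => N (k+1) / N k)
    (hdiv : ¬ Summable fun k => N k / N (k+1))
    (hD : ∀ j, ∀ t ∈ Icc (0:ℝ) 1, HasDerivAt (D j) (D (j+1) t) t)
    (hb : ∀ j, ∀ t ∈ Icc (0:ℝ) 1, |D j t| ≤ N j)
    (h0 : ∀ j, D j 0 = 0) : ∀ t ∈ Icc (0:ℝ) 1, D 0 t = 0 := by
  have key : ∀ m K : ℕ, ∀ t ∈ Icc (0:ℝ) 1,
      t ≤ ∑ n ∈ Finset.range m, Real.exp (-1) * (N (K+n) / N (K+n+1)) →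
      ∀ j, |D j t| ≤ Real.exp (-(K : ℕ)) * Real.exp j * N j := by
    intro m
    induction m with
    | zero =>
      intro K t ht hle j
      have : t = 0 := le_antisymm (by simpa using hle) ht.1
      subst this
      have := hN j
      rw [h0, abs_zero]; positivity
    | succ m ih =>
      intro K t ht hle
      rw [Finset.sum_range_succ'] at hle
      set st := Real.exp (-1) * (N (K+0) / N (K+0+1)) with hst
      have hst0 : 0 ≤ st := by have := hN (K+0); have := hN (K+0+1); positivity
      have hs : ∀ n, 0 < N n / N (n+1) := fun n => div_pos (hN _) (hN _)
      have ht' : max 0 (t - st) ≤ t := max_le ht.1 (by linarith)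
      have h1 := ih (K+1) (max 0 (t - st)) ⟨le_max_left _ _, ht'.trans ht.2⟩ (by
        refine max_le (Finset.sum_nonneg fun n _ => ?_) ?_
        · have := hs (K+1+n); positivity
        · rw [Finset.sum_congr rfl (g := fun n => Real.exp (-1) * (N (K+(n+1)) / N (K+(n+1)+1)))
            (fun n _ => by rw [show K + 1 + n = K + (n+1) by ring])]
          linarith)
      exact bang_step hN hmono hD hb K (le_max_left _ _) ht' ht.2
        (by have := le_max_right 0 (t - st); simp only [hst, add_zero] at this ⊢; linarith) h1
  intro t ht
  have hbd : ∀ K : ℕ, |D 0 t| ≤ Real.exp (-(K:ℕ)) * N 0 := by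
    intro K
    have hns : ¬ Summable fun n => N (n+K) / N (n+K+1) := by
      rw [summable_nat_add_iff (f := fun k => N k / N (k+1)) K]; exact hdiv
    have htt := (not_summable_iff_tendsto_nat_atTop_of_nonneg
      (fun n => (div_pos (hN _) (hN _)).le)).1 hns
    obtain ⟨m, hm⟩ := (htt.eventually_ge_atTop (Real.exp 1 * t)).exists
    have := key m K t ht (by
      rw [← Finset.mul_sum]
      have e : Real.exp (-1) * (Real.exp 1 * t) = t := by
        rw [← mul_assoc, ← Real.exp_add]; simp
      rw [← e]
      gcongr
      refine hm.trans (le_of_eq (Finset.sum_congr rfl fun n _ => by rw [add_comm n K]))) 0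
    simpa using this
  have hlim : Tendsto (fun K : ℕ => Real.exp (-(K:ℕ)) * N 0) atTop (𝓝 0) := by
    have : Tendsto (fun K : ℕ => Real.exp (-(K:ℝ))) atTop (𝓝 0) :=
      Real.tendsto_exp_neg_atTop_nhds_zero.comp tendsto_natCast_atTop_atTop
    simpa using this.mul_const (N 0)
  have := ge_of_tendsto hlim (Eventually.of_forall hbd)
  exact abs_nonpos_iff.1 this

end Bang

section DC
variable {E F : Type} [NormedAddCommGroup E] [NormedSpace ℝ E] [NormedAddCommGroup F]
  [NormedSpace ℝ F] {M : ℕ → ℝ}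

noncomputable def dv (v : E) (f : E → ℝ) : E → ℝ := fun y => fderiv ℝ f y v

lemma DCAt.dv (hM : IsDCSeq M) {f : E → ℝ} {x : E} (h : DCAt M f x) (v : E) : DCAt M (QDC.dv v f) x :=
  h.fderiv_apply hM v

lemma DCAt.dv_iter (hM : IsDCSeq M) {f : E → ℝ} {x : E} (h : DCAt M f x) (v : E) (j : ℕ) :
    DCAt M ((QDC.dv v)^[j] f) x := by
  induction j with
  | zero => exact h
  | succ j ih => rw [Function.iterate_succ_apply']; exact ih.dv hM v

lemma contDiffAt_dv {f : E → ℝ} {x : E} (h : ContDiffAt ℝ ∞ f x) (v : E) :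
    ContDiffAt ℝ ∞ (dv v f) x := (contDiffAt_fderiv h).clm_apply contDiffAt_const

lemma norm_iter_dv {f : E → ℝ} {x : E} (h : ContDiffAt ℝ ∞ f x) (v : E) (k : ℕ) :
    ‖iteratedFDeriv ℝ k (dv v f) x‖ ≤ ‖iteratedFDeriv ℝ (k+1) f x‖ * ‖v‖ := by
  have h1 : ContDiffAt ℝ k (fderiv ℝ f) x := (contDiffAt_fderiv h).of_le (by exact_mod_cast le_top)
  have := (ContinuousLinearMap.apply ℝ ℝ v : (E →L[ℝ] ℝ) →L[ℝ] ℝ).norm_iteratedFDeriv_comp_left h1 (n := k) le_rfl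
  rw [norm_iteratedFDeriv_fderiv] at this
  refine this.trans ?_
  rw [mul_comm]
  gcongr
  refine ContinuousLinearMap.opNorm_le_bound _ (norm_nonneg v) fun L => ?_
  rw [mul_comm]; exact L.le_opNorm v

lemma norm_dv_iter {f : E → ℝ} {x : E} (h : ContDiffAt ℝ ∞ f x) (v : E) (j k : ℕ) :
    ContDiffAt ℝ ∞ ((dv v)^[j] f) x ∧
    ‖iteratedFDeriv ℝ k ((dv v)^[j] f) x‖ ≤ ‖iteratedFDeriv ℝ (k+j) f x‖ * ‖v‖^j := by
  induction j generalizing k with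
  | zero => exact ⟨h, by simp⟩
  | succ j ih =>
    rw [Function.iterate_succ_apply']
    refine ⟨contDiffAt_dv (ih 0).1 v, (norm_iter_dv (ih 0).1 v k).trans ?_⟩
    have := (ih (k+1)).2
    rw [show k + (j+1) = k + 1 + j by ring, pow_succ, ← mul_assoc]
    gcongr

lemma DC_compact (hM : IsDCSeq M) {f : E → F} {K : Set E} (hK : IsCompact K)
    (h : ∀ x ∈ K, DCAt M f x) : ∃ A B : ℝ, 0 < A ∧ 0 < B ∧ ∀ y ∈ K, ∀ k : ℕ,
      ‖iteratedFDeriv ℝ k f y‖ ≤ A * B ^ k * k ! * M k := by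
  refine hK.induction_on (p := fun K => ∃ A B : ℝ, 0 < A ∧ 0 < B ∧ ∀ y ∈ K, ∀ k : ℕ,
      ‖iteratedFDeriv ℝ k f y‖ ≤ A * B ^ k * k ! * M k) ?_ ?_ ?_ ?_
  · exact ⟨1, 1, one_pos, one_pos, by simp⟩
  · rintro s t hst ⟨A, B, hA, hB, h⟩
    exact ⟨A, B, hA, hB, fun y hy => h y (hst hy)⟩
  · rintro s t ⟨A, B, hA, hB, h⟩ ⟨A', B', hA', hB', h'⟩
    refine ⟨max A A', max B B', by positivity, by positivity, fun y hy k => ?_⟩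
    have m := hM.1 k
    rcases hy with hy | hy
    · refine (h y hy k).trans ?_
      gcongr <;> exact le_max_left _ _
    · refine (h' y hy k).trans ?_
      gcongr <;> exact le_max_right _ _
  · intro x hx
    obtain ⟨A, B, hA, hB, h⟩ := h x hx
    exact ⟨_, mem_nhdsWithin_of_mem_nhds h, A, B, hA, hB, fun y hy k => hy.2 k⟩

lemma identity_seg (hM : IsDCSeq M) {f : E → ℝ} {x v : E}
    (h : ∀ t ∈ Icc (0:ℝ) 1, DCAt M f (x + t • v)) (h0 : ∀ j, (dv v)^[j] f x = 0) : f (x + v) = 0 := by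
  have hK : IsCompact ((fun t : ℝ => x + t • v) '' Icc 0 1) :=
    isCompact_Icc.image (by fun_prop)
  obtain ⟨A, B, hA, hB, hAB⟩ := DC_compact hM hK (by rintro _ ⟨t, ht, rfl⟩; exact h t ht)
  set B' := B * (‖v‖ + 1) with hB'
  have hB'0 : 0 < B' := by positivity
  have hMk := hM.1
  have := bang (N := fun k => A * B' ^ k * k ! * M k) (D := fun j t => (dv v)^[j] f (x + t • v))
    (fun k => by have := hMk k; positivity)
    (by
      intro i j hij
      have h1 := ratio_mono hM hij
      have e : ∀ k, A * B' ^ (k+1) * (k+1)! * M (k+1) / (A * B' ^ k * k ! * M k) =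
          B' * (k+1) * (M (k+1) / M k) := by
        intro k
        have := (hMk k).ne'
        have : (k ! : ℝ) ≠ 0 := by positivity
        rw [Nat.factorial_succ]; push_cast; field_simp; ring
      simp only [e]
      simp only [] at h1
      have := div_pos (hMk (i+1)) (hMk i)
      gcongr)
    (by
      intro hs
      apply hM.2.2.2
      have := hs.mul_left B'
      refine this.congr fun k => ?_
      have := (hMk k).ne'
      have := (hMk (k+1)).ne'
      have : (k ! : ℝ) ≠ 0 := by positivity
      rw [Nat.factorial_succ]; push_cast; field_simp; ring)
    (by
      intro j t ht
      have hd := ((h t ht).dv_iter hM v j).differentiableAt.hasFDerivAt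
      have h2 : HasDerivAt (fun t : ℝ => x + t • v) v t := by
        simpa using ((hasDerivAt_id t).smul_const v).const_add x
      have := hd.comp_hasDerivAt t h2
      rw [Function.iterate_succ_apply']
      exact this)
    (by
      intro j t ht
      have h1 := (norm_dv_iter (h t ht).contDiffAt v j 0).2
      rw [norm_iteratedFDeriv_zero, Real.norm_eq_abs, zero_add] at h1
      refine h1.trans ?_
      have h2 := hAB (x + t • v) ⟨t, ht, rfl⟩ j
      have m := hMk j
      calc _ ≤ A * B ^ j * j ! * M j * (‖v‖+1) ^ j := by
            gcongr; linarith
        _ = _ := by rw [hB', mul_pow]; ring)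
    (by simpa using h0) 1 (by simp)
  simpa using this

lemma dv_congr {f g : E → ℝ} {x : E} (h : f =ᶠ[𝓝 x] g) (v : E) : dv v f =ᶠ[𝓝 x] dv v g := by
  filter_upwards [h.fderiv (𝕜 := ℝ)] with y hy
  simp [dv, hy]

lemma dv_iter_congr {f g : E → ℝ} {x : E} (h : f =ᶠ[𝓝 x] g) (v : E) (j : ℕ) :
    (dv v)^[j] f =ᶠ[𝓝 x] (dv v)^[j] g := by
  induction j with
  | zero => exact h
  | succ j ih => rw [Function.iterate_succ_apply', Function.iterate_succ_apply']; exact dv_congr ih v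

lemma dv_iter_zero (v : E) (j : ℕ) : (dv v)^[j] (fun _ : E => (0:ℝ)) = fun _ => 0 := by
  induction j with
  | zero => rfl
  | succ j ih => rw [Function.iterate_succ_apply', ih]; ext y; simp [dv]

lemma identity_convex (hM : IsDCSeq M) {f : E → ℝ} {W : Set E} (hW : Convex ℝ W)
    (h : ∀ x ∈ W, DCAt M f x) {x : E} (hx : x ∈ W) (h0 : ∀ᶠ y in 𝓝 x, f y = 0) :
    ∀ y ∈ W, f y = 0 := by
  intro y hy
  have := identity_seg hM (f := f) (x := x) (v := y - x)
    (fun t ht => h _ (hW.add_smul_sub_mem hx hy ht)) (fun j => by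
      have := (dv_iter_congr (g := fun _ => 0) h0 (y - x) j).eq_of_nhds
      rw [this, dv_iter_zero])
  simpa using this

lemma DCAt.ball (f : E → F) {x : E} (h : DCAt M f x) :
    ∃ ε > 0, ∀ y ∈ Metric.ball x ε, DCAt M f y :=
  Metric.eventually_nhds_iff_ball.1 h.eventually

lemma DCAt.mul_eq_zero (hM : IsDCSeq M) {f g : E → ℝ} {x : E} (hf : DCAt M f x) (hg : DCAt M g x)
    (h : ∀ᶠ y in 𝓝 x, f y * g y = 0) : (∀ᶠ y in 𝓝 x, f y = 0) ∨ ∀ᶠ y in 𝓝 x, g y = 0 := by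
  obtain ⟨ε, hε, hb⟩ := Metric.eventually_nhds_iff_ball.1 (h.and (hf.eventually.and hg.eventually))
  by_cases hz : ∀ y ∈ Metric.ball x ε, f y = 0
  · exact Or.inl (Metric.eventually_nhds_iff_ball.2 ⟨ε, hε, hz⟩)
  · push Not at hz
    obtain ⟨p, hp, hfp⟩ := hz
    refine Or.inr (Metric.eventually_nhds_iff_ball.2 ⟨ε, hε, ?_⟩)
    refine identity_convex hM (convex_ball x ε) (fun y hy => (hb y hy).2.2) hp ?_
    filter_upwards [Metric.isOpen_ball.mem_nhds hp, (hb p hp).2.1.continuousAt.eventually_ne hfp] with y h1 h2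
    exact (_root_.mul_eq_zero.1 (hb y h1).1).resolve_left h2

end DC
end QDC

namespace QDC
open Filter Topology Set
open scoped ContDiff Nat

set_option linter.unusedSectionVars false
section Mem
variable {σ : Type} [Fintype σ] [DecidableEq σ] {M : ℕ → ℝ}

noncomputable def fld (l : List σ) (α : σ → ℕ) (f : (σ → ℝ) → ℝ) : (σ → ℝ) → ℝ :=
  l.foldr (fun i g => (pd i)^[α i] g) f

lemma pd_eq_dv (i : σ) : (pd i : ((σ → ℝ) → ℝ) → _) = dv (Pi.single i 1) := rfl

lemma norm_single_le (i : σ) : ‖(Pi.single i (1:ℝ) : σ → ℝ)‖ ≤ 1 := by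
  rw [pi_norm_le_iff_of_nonneg zero_le_one]
  intro j
  by_cases h : j = i
  · subst h; simp
  · simp [h]

lemma fld_bound (l : List σ) (α : σ → ℕ) {f : (σ → ℝ) → ℝ} {x : σ → ℝ} (h : ContDiffAt ℝ ∞ f x)
    (k : ℕ) : ContDiffAt ℝ ∞ (fld l α f) x ∧
      ‖iteratedFDeriv ℝ k (fld l α f) x‖ ≤ ‖iteratedFDeriv ℝ (k + (l.map α).sum) f x‖ := by
  induction l generalizing k with
  | nil => exact ⟨h, le_rfl⟩
  | cons i l ih =>
    have e : fld (i :: l) α f = (dv (Pi.single i 1))^[α i] (fld l α f) := rfl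
    rw [e]
    have h1 := norm_dv_iter (ih 0).1 (Pi.single i 1) (α i) k
    refine ⟨h1.1, h1.2.trans ?_⟩
    have h2 : ‖(Pi.single i (1:ℝ) : σ → ℝ)‖ ^ α i ≤ 1 := pow_le_one₀ (norm_nonneg _) (norm_single_le i)
    have h3 := (ih (k + α i)).2
    rw [List.map_cons, List.sum_cons, ← add_assoc]
    calc _ ≤ ‖iteratedFDeriv ℝ (k + α i) (fld l α f) x‖ * 1 := by gcongr
      _ ≤ _ := by rw [mul_one]; exact h3

lemma mdeg_eq (α : σ → ℕ) : mdeg α = ((Finset.univ : Finset σ).toList.map α).sum := by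
  simp [mdeg, Finset.sum_map_toList]

lemma mfact_eq (α : σ → ℕ) :
    mfact α = ((Finset.univ : Finset σ).toList.map (fun i => (α i)!)).prod := by
  simp [mfact, Finset.prod_map_toList]

lemma fact_list (l : List σ) (α : σ → ℕ) :
    ((l.map α).sum)! ≤ (2 ^ l.length) ^ (l.map α).sum * (l.map fun i => (α i)!).prod := by
  induction l with
  | nil => simp
  | cons i l ih =>
    simp only [List.map_cons, List.sum_cons, List.prod_cons, List.length_cons]
    set s := (l.map α).sum
    set P := (l.map fun i => (α i)!).prod
    have h1 : (α i + s)! ≤ 2 ^ (α i + s) * ((α i)! * s !) := by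
      have := Nat.add_choose_mul_factorial_mul_factorial (α i) s
      rw [← this, mul_assoc]
      gcongr
      exact Nat.choose_le_two_pow _ _
    calc _ ≤ _ := h1
      _ ≤ 2 ^ (α i + s) * ((α i)! * ((2 ^ l.length) ^ s * P)) := by gcongr
      _ ≤ 2 ^ (α i + s) * ((α i)! * ((2 ^ l.length) ^ (α i + s) * P)) := by
        gcongr
        · exact Nat.one_le_two_pow
        · omega
      _ = _ := by rw [pow_succ, mul_pow]; ring

lemma memDC_of_DCAt (hM : IsDCSeq M) {V : Set (σ → ℝ)} {f : (σ → ℝ) → ℝ}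
    (h : ∀ x ∈ V, DCAt M f x) : MemDC M V f := by
  refine ⟨fun x hx => (h x hx).contDiffAt.contDiffWithinAt, fun K hK hKc => ?_⟩
  obtain ⟨A, B, hA, hB, hAB⟩ := DC_compact hM hKc fun x hx => h x (hK hx)
  set c : ℝ := 2 ^ (Finset.univ : Finset σ).toList.length with hc
  refine ⟨A, B * c, hA, by positivity, fun x hx α => ?_⟩
  have h1 := (fld_bound (Finset.univ : Finset σ).toList α (h x (hK hx)).contDiffAt 0).2
  rw [norm_iteratedFDeriv_zero, Real.norm_eq_abs, zero_add, ← mdeg_eq] at h1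
  refine h1.trans ((hAB x hx _).trans ?_)
  have h2 : ((mdeg α)! : ℝ) ≤ c ^ mdeg α * mfact α := by
    have := fact_list (Finset.univ : Finset σ).toList α
    rw [← mdeg_eq, ← mfact_eq] at this
    rw [hc]
    exact_mod_cast this
  have m := hM.1 (mdeg α)
  calc _ ≤ A * B ^ mdeg α * (c ^ mdeg α * mfact α) * M (mdeg α) := by gcongr
    _ = _ := by rw [mul_pow]; ring

def SmOn (V : Set (σ → ℝ)) (g : (σ → ℝ) → ℝ) : Prop := ∀ x ∈ V, ContDiffAt ℝ ∞ g x

lemma SmOn.pd {V : Set (σ → ℝ)} {g} (h : SmOn V g) (i : σ) : SmOn V (pd i g) :=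
  fun x hx => contDiffAt_dv (h x hx) _

lemma SmOn.pd_iter {V : Set (σ → ℝ)} {g} (h : SmOn V g) (i : σ) (a : ℕ) :
    SmOn V ((QDC.pd i)^[a] g) := by
  induction a with
  | zero => exact h
  | succ a ih => rw [Function.iterate_succ_apply']; exact ih.pd i

lemma SmOn.fld {V : Set (σ → ℝ)} {g} (h : SmOn V g) (l : List σ) (α) : SmOn V (fld l α g) :=
  fun x hx => (fld_bound l α (h x hx) 0).1

lemma pd_eqOn {V : Set (σ → ℝ)} (hV : IsOpen V) {g h} (e : EqOn g h V) (i : σ) :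
    EqOn (pd i g) (pd i h) V := fun x hx =>
  (dv_congr (Filter.eventuallyEq_of_mem (hV.mem_nhds hx) e) _).eq_of_nhds

lemma pd_iter_eqOn {V : Set (σ → ℝ)} (hV : IsOpen V) {g h} (e : EqOn g h V) (i : σ) (a : ℕ) :
    EqOn ((pd i)^[a] g) ((pd i)^[a] h) V := by
  induction a with
  | zero => exact e
  | succ a ih => rw [Function.iterate_succ_apply', Function.iterate_succ_apply']; exact pd_eqOn hV ih i

lemma pd_comm {V : Set (σ → ℝ)} {g} (h : SmOn V g) (i j : σ) :
    EqOn (pd i (pd j g)) (pd j (pd i g)) V := by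
  intro x hx
  have hs : IsSymmSndFDerivAt ℝ g x := (h x hx).isSymmSndFDerivAt (by simp only [minSmoothness_of_isRCLikeNormedField]; exact WithTop.coe_le_coe.2 le_top)
  have hd : DifferentiableAt ℝ (fderiv ℝ g) x := (contDiffAt_fderiv (h x hx)).differentiableAt (by simp)
  have e : ∀ a b : σ → ℝ, dv a (dv b g) x = fderiv ℝ (fderiv ℝ g) x a b := by
    intro a b
    have : HasFDerivAt (fun y => fderiv ℝ g y b) ((fderiv ℝ (fderiv ℝ g) x).flip b) x := by
      have := hd.hasFDerivAt.clm_apply (hasFDerivAt_const b x)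
      simpa using this
    change fderiv ℝ (fun y => fderiv ℝ g y b) x a = _
    rw [this.fderiv]; rfl
  rw [pd_eq_dv, pd_eq_dv, e, e]
  exact hs _ _

lemma pd_comm_iter {V : Set (σ → ℝ)} (hV : IsOpen V) {g} (h : SmOn V g) (i j : σ) (a : ℕ) :
    EqOn (pd i ((pd j)^[a] g)) ((pd j)^[a] (pd i g)) V := by
  induction a with
  | zero => exact fun x _ => rfl
  | succ a ih =>
    rw [Function.iterate_succ_apply', Function.iterate_succ_apply']
    exact (pd_comm (h.pd_iter j a) i j).trans (pd_eqOn hV ih j)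

lemma fld_congr (l : List σ) {α β : σ → ℕ} (h : ∀ i ∈ l, α i = β i) (f) : fld l α f = fld l β f := by
  induction l with
  | nil => rfl
  | cons i l ih =>
    change (pd i)^[α i] (fld l α f) = (pd i)^[β i] (fld l β f)
    rw [ih fun j hj => h j (by simp [hj]), h i (by simp)]

lemma pd_fld {V : Set (σ → ℝ)} (hV : IsOpen V) {f} (h : SmOn V f) (l : List σ) (hl : l.Nodup)
    (α : σ → ℕ) (i : σ) (hi : i ∈ l) :
    EqOn (pd i (fld l α f)) (fld l (Function.update α i (α i + 1)) f) V := by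
  induction l with
  | nil => simp at hi
  | cons j l ih =>
    change EqOn (pd i ((pd j)^[α j] (fld l α f)))
      ((pd j)^[Function.update α i (α i + 1) j] (fld l (Function.update α i (α i + 1)) f)) V
    rw [List.nodup_cons] at hl
    by_cases hij : i = j
    · subst hij
      rw [Function.update_self, Function.iterate_succ_apply', fld_congr l (α := Function.update α i (α i + 1)) (β := α)]
      · exact fun _ _ => rfl
      · intro k hk
        rw [Function.update_of_ne]
        rintro rfl; exact hl.1 hk
    · rw [Function.update_of_ne (Ne.symm hij)]
      refine (pd_comm_iter hV (h.fld l α) i j _).trans ?_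
      refine pd_iter_eqOn hV (ih hl.2 ?_) j _
      simpa [hij] using hi

lemma norm_iter_succ_le {g : (σ → ℝ) → ℝ} {x : σ → ℝ} (h : ContDiffAt ℝ ∞ g x) (k : ℕ) :
    ‖iteratedFDeriv ℝ (k+1) g x‖ ≤ ∑ i, ‖iteratedFDeriv ℝ k (pd i g) x‖ := by
  let L : σ → ℝ →L[ℝ] ((σ → ℝ) →L[ℝ] ℝ) := fun i =>
    (ContinuousLinearMap.smulRightL ℝ ℝ ((σ → ℝ) →L[ℝ] ℝ)
      (ContinuousLinearMap.id ℝ ℝ)) (ContinuousLinearMap.proj i)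
  have hL : ∀ i c, L i c = c • (ContinuousLinearMap.proj i : (σ → ℝ) →L[ℝ] ℝ) := fun i c => by
    simp [L]
  have hpn : ∀ i, ‖(ContinuousLinearMap.proj i : (σ → ℝ) →L[ℝ] ℝ)‖ ≤ 1 := fun i =>
    ContinuousLinearMap.opNorm_le_bound _ zero_le_one fun v => by
      simpa using norm_le_pi_norm v i
  have hLn : ∀ i, ‖L i‖ ≤ 1 := fun i => by
    refine ContinuousLinearMap.opNorm_le_bound _ zero_le_one fun c => ?_
    rw [hL, norm_smul, mul_comm]
    exact mul_le_mul_of_nonneg_right (hpn i) (norm_nonneg _)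
  have e : fderiv ℝ g = fun y => ∑ i, L i (pd i g y) := by
    ext y v
    simp only [hL, sum_apply, smul_apply, pd,
      ContinuousLinearMap.proj_apply, smul_eq_mul]
    conv_lhs => rw [pi_eq_sum_univ' v, map_sum]
    refine Finset.sum_congr rfl fun i _ => ?_
    rw [map_smul, smul_eq_mul, mul_comm]
  have hc : ∀ i, ContDiffAt ℝ k (pd i g) x := fun i =>
    (contDiffAt_dv h _).of_le (by exact_mod_cast le_top)
  have hc' : ∀ i ∈ Finset.univ, ContDiffAt ℝ k (fun y => L i (pd i g y)) x := fun i _ =>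
    (L i).contDiff.contDiffAt.comp x (hc i)
  rw [← norm_iteratedFDeriv_fderiv, e, iteratedFDeriv_fun_sum_apply hc']
  refine (norm_sum_le _ _).trans (Finset.sum_le_sum fun i _ => ?_)
  refine ((L i).norm_iteratedFDeriv_comp_left (hc i) (n := k) le_rfl).trans ?_
  exact mul_le_of_le_one_left (norm_nonneg _) (hLn i)

lemma iter_mpd {V : Set (σ → ℝ)} (hV : IsOpen V) {f} (h : SmOn V f) {x : σ → ℝ} (hx : x ∈ V)
    {C : ℝ} (k : ℕ) : ∀ α : σ → ℕ, (∀ β : σ → ℕ, mdeg β = mdeg α + k → |mpd β f x| ≤ C) →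
    ‖iteratedFDeriv ℝ k (mpd α f) x‖ ≤ (Fintype.card σ : ℝ) ^ k * C := by
  induction k with
  | zero =>
    intro α hα
    simpa using hα α rfl
  | succ k ih =>
    intro α hα
    refine (norm_iter_succ_le (h.fld _ α x hx) k).trans ?_
    have : ∀ i ∈ (Finset.univ : Finset σ), ‖iteratedFDeriv ℝ k (pd i (mpd α f)) x‖ ≤
        (Fintype.card σ : ℝ) ^ k * C := by
      intro i _
      have h1 := pd_fld hV h (Finset.univ : Finset σ).toList (Finset.nodup_toList _) α i (by simp)
      have h2 : pd i (mpd α f) =ᶠ[𝓝 x] mpd (Function.update α i (α i + 1)) f :=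
        Filter.eventuallyEq_of_mem (hV.mem_nhds hx) h1
      rw [(h2.iteratedFDeriv ℝ k).eq_of_nhds]
      refine ih _ fun β hβ => hα β ?_
      rw [hβ]
      have : mdeg (Function.update α i (α i + 1)) = mdeg α + 1 := by
        unfold mdeg
        rw [Finset.sum_update_of_mem (Finset.mem_univ i),
          ← Finset.add_sum_erase _ α (Finset.mem_univ i), Finset.sdiff_singleton_eq_erase]
        ring
      omega
    refine (Finset.sum_le_sum this).trans ?_
    rw [Finset.sum_const, Finset.card_univ, nsmul_eq_mul, pow_succ]
    exact le_of_eq (by ring)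

lemma mfact_le (α : σ → ℕ) : mfact α ≤ (mdeg α)! :=
  Nat.le_of_dvd (Nat.factorial_pos _) (Nat.prod_factorial_dvd_factorial_sum _ _)

lemma MemDC.dcAt (hM : IsDCSeq M) {V : Set (σ → ℝ)} (hV : IsOpen V) {f : (σ → ℝ) → ℝ}
    (h : MemDC M V f) {x : σ → ℝ} (hx : x ∈ V) : DCAt M f x := by
  have hs : SmOn V f := fun y hy => h.1.contDiffAt (hV.mem_nhds hy)
  obtain ⟨ε, hε, hball⟩ := Metric.nhds_basis_closedBall.mem_iff.1 (hV.mem_nhds hx)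
  obtain ⟨A, B, hA, hB, hAB⟩ := h.2 _ hball (isCompact_closedBall x ε)
  refine ⟨A, B * (Fintype.card σ + 1), hA, by positivity, ?_⟩
  filter_upwards [Metric.closedBall_mem_nhds x hε] with y hy
  refine ⟨hs y (hball hy), fun k => ?_⟩
  have m := hM.1 k
  have h0 : mpd (fun _ => 0) f = f := by
    unfold mpd
    generalize (Finset.univ : Finset σ).toList = l
    induction l with
    | nil => rfl
    | cons i l ih => rw [List.foldr_cons, ih]; rfl
  have := iter_mpd hV hs (hball hy) (C := A * B ^ k * k ! * M k) k (fun _ => 0) (by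
    intro β hβ
    have hβ' : mdeg β = k := by simpa [mdeg] using hβ
    refine (hAB y hy β).trans ?_
    rw [hβ']
    gcongr
    rw [← hβ']; exact mfact_le β)
  rw [h0] at this
  refine this.trans ?_
  rw [mul_pow]
  calc _ ≤ ((Fintype.card σ : ℝ) + 1)^k * (A * B ^ k * k ! * M k) := by gcongr; linarith
    _ = _ := by ring

end Mem
end QDC

namespace QDC
open Filter Topology Set
open scoped ContDiff Nat

section Ref
variable {E E' E'' : Type} [NormedAddCommGroup E] [NormedSpace ℝ E] [NormedAddCommGroup E']
  [NormedSpace ℝ E'] [NormedAddCommGroup E''] [NormedSpace ℝ E''] {M : ℕ → ℝ} {ι : Type}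
  {𝒰 : Ultrafilter ι}

/-- `c` is obtained from `c'` through the DC map germ `φ`. -/
structure Ref (M : ℕ → ℝ) (𝒰 : Ultrafilter ι) (c : ι → E) (c' : ι → E') (p : E' → E) : Prop where
  tend : Tendsto c' 𝒰 (𝓝 0)
  dc : DCAt M p 0
  zero : p 0 = 0
  eq : ∀ᶠ i in 𝒰, c i = p (c' i)

lemma Ref.trans (hM : IsDCSeq M) {c : ι → E} {c' : ι → E'} {c'' : ι → E''} {p : E' → E} {q : E'' → E'}
    (h : Ref M 𝒰 c c' p) (h' : Ref M 𝒰 c' c'' q) : Ref M 𝒰 c c'' (fun z => p (q z)) where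
  tend := h'.tend
  dc := DCAt.comp hM (by rw [h'.zero]; exact h.dc) h'.dc
  zero := by rw [h'.zero, h.zero]
  eq := by
    filter_upwards [h.eq, h'.eq] with i h1 h2
    rw [h1, h2]

lemma Ref.refl (hM : IsDCSeq M) {c : ι → E} (h : Tendsto c 𝒰 (𝓝 0)) : Ref M 𝒰 c c (fun z => z) :=
  ⟨h, DCAt.id hM 0, rfl, Eventually.of_forall fun _ => rfl⟩

lemma Ref.tendsto {c : ι → E} {c' : ι → E'} {p : E' → E} (h : Ref M 𝒰 c c' p) :
    Tendsto c 𝒰 (𝓝 0) := by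
  have h1 : Tendsto p (𝓝 0) (𝓝 0) := by simpa [ContinuousAt, h.zero] using h.dc.continuousAt
  exact (h1.comp h.tend).congr' (h.eq.mono fun i hi => hi.symm)

lemma Ref.tendsto_p {c : ι → E} {c' : ι → E'} {p : E' → E} (h : Ref M 𝒰 c c' p) :
    Tendsto p (𝓝 0) (𝓝 0) := by simpa [ContinuousAt, h.zero] using h.dc.continuousAt

lemma Ref.comp (hM : IsDCSeq M) {F : Type} [NormedAddCommGroup F] [NormedSpace ℝ F]
    {c : ι → E} {c' : ι → E'} {p : E' → E} (h : Ref M 𝒰 c c' p) {f : E → F} (hf : DCAt M f 0) :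
    DCAt M (fun z => f (p z)) 0 := DCAt.comp hM (by rw [h.zero]; exact hf) h.dc

/-- minimality of the dimension -/
def Mini (M : ℕ → ℝ) (𝒰 : Ultrafilter ι) (m : ℕ) (c : ι → E) : Prop :=
  ∀ m' < m, ∀ (c' : ι → (Fin m' → ℝ)) (p : (Fin m' → ℝ) → E), ¬ Ref M 𝒰 c c' p

lemma Mini.ref (hM : IsDCSeq M) {m : ℕ} {c : ι → E} {c' : ι → E'} {p : E' → E} (hc : Mini M 𝒰 m c)
    (h : Ref M 𝒰 c c' p) : Mini M 𝒰 m c' :=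
  fun m' hm' c'' q hq => hc m' hm' c'' _ (h.trans hM hq)

lemma Mini.coord (hM : IsDCSeq M) {m : ℕ} {c : ι → (Fin m → ℝ)} (h0 : Tendsto c 𝒰 (𝓝 0))
    (hc : Mini M 𝒰 m c) (j : Fin m) : ∀ᶠ i in 𝒰, c i j ≠ 0 := by
  by_contra hcon
  replace hcon := Ultrafilter.eventually_not.2 hcon
  obtain _ | m := m
  · exact j.elim0
  refine hc m (by omega) (fun i k => c i (j.succAbove k))
    (fun x => (j.insertNth (0:ℝ) x : Fin (m+1) → ℝ)) ⟨?_, ?_, ?_, ?_⟩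
  · rw [tendsto_pi_nhds] at h0 ⊢
    exact fun k => h0 _
  · refine DCAt.pi hM fun k => ?_
    refine Fin.succAboveCases j ?_ (fun l => ?_) k
    · simpa using DCAt.const hM (0:ℝ) _
    · simpa using (DCAt.id hM (0 : Fin m → ℝ)).apply hM l
  · ext k
    refine Fin.succAboveCases j ?_ (fun l => ?_) k <;> simp
  · filter_upwards [hcon] with i hi
    have hi : c i j = 0 := by simpa using hi
    ext k
    refine Fin.succAboveCases j ?_ (fun l => ?_) k <;> simp [hi]

lemma Mini.fst (hM : IsDCSeq M) {m : ℕ} {c : ι → (Fin m → ℝ) × ℝ} (h0 : Tendsto c 𝒰 (𝓝 0))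
    (hc : Mini M 𝒰 (m+1) c) : Mini M 𝒰 m (fun i => (c i).1) := by
  intro m' hm' c' p hp
  refine hc (m'+1) (by omega) (fun i => Fin.cons (c i).2 (c' i))
    (fun v => (p (Fin.tail v), v 0)) ⟨?_, ?_, ?_, ?_⟩
  · rw [tendsto_pi_nhds]
    intro k
    refine Fin.cases ?_ (fun l => ?_) k
    · exact (continuous_snd.tendsto (0 : (Fin m → ℝ) × ℝ)).comp h0
    · simpa using (tendsto_pi_nhds.1 hp.tend) l
  · refine DCAt.prodMk hM ?_ ((DCAt.id hM (0 : Fin (m'+1) → ℝ)).apply hM 0)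
    refine DCAt.comp hM (g := fun v : Fin (m'+1) → ℝ => Fin.tail v) ?_ ?_
    · exact hp.dc
    · exact DCAt.pi hM fun k => (DCAt.id hM (0 : Fin (m'+1) → ℝ)).apply hM k.succ
  · have : (Fin.tail (0 : Fin (m'+1) → ℝ)) = 0 := rfl
    rw [this, hp.zero]; rfl
  · filter_upwards [hp.eq] with i hi
    ext1
    · simpa using hi
    · simp

lemma Mini.snd (hM : IsDCSeq M) {m : ℕ} {c : ι → (Fin m → ℝ) × ℝ} (h0 : Tendsto c 𝒰 (𝓝 0))
    (hc : Mini M 𝒰 (m+1) c) : ∀ᶠ i in 𝒰, (c i).2 ≠ 0 := by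
  by_contra hcon
  replace hcon := Ultrafilter.eventually_not.2 hcon
  refine hc m (by omega) (fun i => (c i).1) (fun x => (x, 0)) ⟨?_, ?_, rfl, ?_⟩
  · exact (continuous_fst.tendsto _).comp h0
  · exact DCAt.prodMk hM (DCAt.id hM _) (DCAt.const hM _ _)
  · filter_upwards [hcon] with i hi
    ext1
    · rfl
    · simpa using hi

end Ref

section Mon
variable {E E' : Type} [NormedAddCommGroup E] [NormedSpace ℝ E] [NormedAddCommGroup E']
  [NormedSpace ℝ E'] {M : ℕ → ℝ} {κ κ' : Type} [Fintype κ] [Fintype κ']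

def Mon (M : ℕ → ℝ) (X : κ → E → ℝ) (g : E → ℝ) : Prop :=
  ∃ (α : κ → ℕ) (u : E → ℝ), DCAt M u 0 ∧ u 0 ≠ 0 ∧ ∀ᶠ x in 𝓝 0, g x = (∏ i, X i x ^ α i) * u x

lemma Mon.congr {X : κ → E → ℝ} {g h : E → ℝ} (hg : Mon M X g) (e : g =ᶠ[𝓝 0] h) : Mon M X h := by
  obtain ⟨α, u, h1, h2, h3⟩ := hg
  exact ⟨α, u, h1, h2, by filter_upwards [h3, e] with x a b; rw [← b, a]⟩

lemma Mon.unit {X : κ → E → ℝ} {g : E → ℝ} (hg : DCAt M g 0) (h : g 0 ≠ 0) : Mon M X g :=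
  ⟨fun _ => 0, g, hg, h, by simp⟩

lemma Mon.mul (hM : IsDCSeq M) {X : κ → E → ℝ} {g h : E → ℝ} (hg : Mon M X g) (hh : Mon M X h) :
    Mon M X (fun x => g x * h x) := by
  obtain ⟨α, u, h1, h2, h3⟩ := hg
  obtain ⟨β, v, k1, k2, k3⟩ := hh
  refine ⟨fun i => α i + β i, fun x => u x * v x, h1.mul hM k1, mul_ne_zero h2 k2, ?_⟩
  filter_upwards [h3, k3] with x a b
  rw [a, b]
  simp only [pow_add, Finset.prod_mul_distrib]
  ring

lemma Mon.prod (hM : IsDCSeq M) {X : κ → E → ℝ} {τ : Type*} (s : Finset τ) {g : τ → E → ℝ}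
    (h : ∀ i ∈ s, Mon M X (g i)) : Mon M X (fun x => ∏ i ∈ s, g i x) := by
  classical
  induction s using Finset.induction_on with
  | empty => simpa using Mon.unit (DCAt.const hM (1:ℝ) 0) one_ne_zero
  | insert a s ha ih =>
    simp only [Finset.prod_insert ha]
    exact (h a (by simp)).mul hM (ih fun i hi => h i (by simp [hi]))

lemma Mon.pow (hM : IsDCSeq M) {X : κ → E → ℝ} {g : E → ℝ} (hg : Mon M X g) (k : ℕ) :
    Mon M X (fun x => g x ^ k) := by
  simpa using Mon.prod hM (Finset.range k) (g := fun _ => g) (fun _ _ => hg)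

lemma Mon.coord (hM : IsDCSeq M) [DecidableEq κ] {X : κ → E → ℝ} (i : κ) : Mon M X (X i) := by
  refine ⟨Pi.single i 1, fun _ => 1, DCAt.const hM _ _, one_ne_zero, Eventually.of_forall fun x => ?_⟩
  rw [Finset.prod_eq_single i]
  · simp
  · intro j _ hj; simp [hj]
  · simp

lemma Mon.comp (hM : IsDCSeq M) {X : κ → E → ℝ} {X' : κ' → E' → ℝ} {p : E' → E} (hp : DCAt M p 0)
    (hp0 : p 0 = 0) (hX : ∀ i, Mon M X' (fun z => X i (p z))) {g : E → ℝ} (hg : Mon M X g) :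
    Mon M X' (fun z => g (p z)) := by
  obtain ⟨α, u, h1, h2, h3⟩ := hg
  have ht : Tendsto p (𝓝 0) (𝓝 0) := by simpa [ContinuousAt, hp0] using hp.continuousAt
  have hu : Mon M X' (fun z => u (p z)) :=
    Mon.unit (DCAt.comp hM (by rw [hp0]; exact h1) hp) (by rw [hp0]; exact h2)
  have := (Mon.prod hM Finset.univ (g := fun i z => X i (p z) ^ α i)
    (fun i _ => (hX i).pow hM (α i))).mul hM hu
  refine this.congr ?_
  filter_upwards [ht.eventually h3] with z hz
  exact hz.symm

lemma Mon.ne_zero {X : κ → E → ℝ} {g : E → ℝ} (hg : Mon M X g) {ι : Type} {𝒰 : Ultrafilter ι}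
    {c : ι → E} (hc : Tendsto c 𝒰 (𝓝 0)) (hX : ∀ j, ∀ᶠ i in 𝒰, X j (c i) ≠ 0) :
    ∀ᶠ i in 𝒰, g (c i) ≠ 0 := by
  obtain ⟨α, u, h1, h2, h3⟩ := hg
  have h4 := h1.continuousAt.eventually_ne h2
  filter_upwards [hc.eventually h3, hc.eventually h4, eventually_all.2 hX] with i a b d
  rw [a]
  exact mul_ne_zero (Finset.prod_ne_zero_iff.2 fun j _ => pow_ne_zero _ (d j)) b

def crd (m : ℕ) : Fin m → (Fin m → ℝ) → ℝ := fun i x => x i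

def crdP (m : ℕ) : Option (Fin m) → ((Fin m → ℝ) × ℝ) → ℝ := fun o p => o.elim p.2 (fun i => p.1 i)

lemma crd_dc (hM : IsDCSeq M) {m : ℕ} (i : Fin m) (x) : DCAt M (crd m i) x :=
  (DCAt.id hM x).apply hM i

lemma mono_dc (hM : IsDCSeq M) {m : ℕ} (α : Fin m → ℕ) (x) :
    DCAt M (fun x => ∏ i, crd m i x ^ α i) x :=
  DCAt.prod hM _ fun i _ => (crd_dc hM i x).pow hM _

lemma coord_not_zero {m : ℕ} (i : Fin m) : ¬ ∀ᶠ x : Fin m → ℝ in 𝓝 0, x i = 0 := by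
  intro h
  have ht : Tendsto (fun t : ℝ => (fun _ : Fin m => t)) (𝓝 0) (𝓝 0) := by
    rw [tendsto_pi_nhds]; exact fun _ => tendsto_id
  have h1 : ∀ᶠ t : ℝ in 𝓝[≠] 0, t = 0 := (ht.eventually h).filter_mono nhdsWithin_le_nhds
  obtain ⟨t, ht1, ht2⟩ := (h1.and self_mem_nhdsWithin).exists
  exact ht2 ht1

lemma split_coord (hM : IsDCSeq M) {m : ℕ} {f : (Fin m → ℝ) → ℝ} (hf : DCAt M f 0)
    (i : Fin m) (h : ∀ᶠ x : Fin m → ℝ in 𝓝 0, f (x - x i • Pi.single i 1) = 0) :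
    ∃ f1, DCAt M f1 0 ∧ ∀ᶠ x in 𝓝 0, f x = x i * f1 x := by
  obtain ⟨f1, h1, h2⟩ := hf.divide hM (ContinuousLinearMap.proj i : (Fin m → ℝ) →L[ℝ] ℝ)
    (Pi.single i 1) (by simp)
  refine ⟨f1, h1, ?_⟩
  filter_upwards [h, h2] with x a b
  simp only [ContinuousLinearMap.proj_apply] at b
  rw [a, sub_zero] at b; exact b

lemma Mon.factor (hM : IsDCSeq M) {m : ℕ} (n : ℕ) : ∀ (α : Fin m → ℕ) (f g u : (Fin m → ℝ) → ℝ),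
    ∑ i, α i = n → DCAt M f 0 → DCAt M g 0 → DCAt M u 0 → u 0 ≠ 0 →
    (∀ᶠ x in 𝓝 0, f x * g x = (∏ i, crd m i x ^ α i) * u x) → Mon M (crd m) f := by
  induction n with
  | zero =>
    intro α f g u hα hf hg hu hu0 h
    have hα' : ∀ i, α i = 0 := by simpa using hα
    refine Mon.unit hf fun h0 => ?_
    have := h.self_of_nhds
    simp [hα', h0] at this
    exact hu0 this.symm
  | succ n ih =>
    intro α f g u hα hf hg hu hu0 h
    obtain ⟨i, hi⟩ : ∃ i, α i ≠ 0 := by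
      by_contra hcon
      push Not at hcon
      simp [hcon] at hα
    set β := Function.update α i (α i - 1) with hβ
    have hβn : ∑ j, β j = n := by
      rw [hβ, Finset.sum_update_of_mem (Finset.mem_univ i), Finset.sdiff_singleton_eq_erase]
      rw [← Finset.add_sum_erase _ α (Finset.mem_univ i)] at hα
      omega
    have hprod : ∀ x, ∏ j, crd m j x ^ α j = x i * ∏ j, crd m j x ^ β j := by
      intro x
      rw [← Finset.mul_prod_erase _ _ (Finset.mem_univ i),
        ← Finset.mul_prod_erase _ (fun j => crd m j x ^ β j) (Finset.mem_univ i), ← mul_assoc]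
      congr 1
      · rw [hβ, Function.update_self, crd]
        conv_lhs => rw [show α i = (α i - 1) + 1 by omega]
        rw [pow_succ, mul_comm]
      · refine Finset.prod_congr rfl fun j hj => ?_
        rw [hβ, Function.update_of_ne (Finset.ne_of_mem_erase hj)]
    let π : (Fin m → ℝ) → (Fin m → ℝ) := fun x => x - x i • (Pi.single i (1:ℝ) : Fin m → ℝ)
    have hπ : DCAt M π 0 := (DCAt.id hM 0).sub hM
      (DCAt.clm hM ((ContinuousLinearMap.proj i : (Fin m → ℝ) →L[ℝ] ℝ).smulRight (Pi.single i (1:ℝ) : Fin m → ℝ)) 0)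
    have hπ0 : π 0 = 0 := by simp [π]
    have hπt : Tendsto π (𝓝 0) (𝓝 0) := by simpa [ContinuousAt, hπ0] using hπ.continuousAt
    have hz : ∀ᶠ x in 𝓝 0, f (π x) * g (π x) = 0 := by
      filter_upwards [hπt.eventually h] with x hx
      rw [hx, hprod]; simp [π]
    have cancel : ∀ f1 g1 : (Fin m → ℝ) → ℝ, DCAt M f1 0 → DCAt M g1 0 →
        (∀ᶠ x in 𝓝 0, f x * g x = x i * (f1 x * g1 x)) →
        ∀ᶠ x in 𝓝 0, f1 x * g1 x = (∏ j, crd m j x ^ β j) * u x := by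
      intro f1 g1 hf1 hg1 he
      have : ∀ᶠ x in 𝓝 0, crd m i x * (f1 x * g1 x - (∏ j, crd m j x ^ β j) * u x) = 0 := by
        filter_upwards [he, h] with x a b
        rw [b, hprod] at a
        rw [mul_sub, sub_eq_zero, crd, ← a]; ring
      rcases DCAt.mul_eq_zero hM (crd_dc hM i 0)
        ((hf1.mul hM hg1).sub hM ((mono_dc hM β 0).mul hM hu)) this with h1 | h1
      · exact absurd h1 (coord_not_zero i)
      · exact h1.mono fun x hx => sub_eq_zero.1 hx
    rcases DCAt.mul_eq_zero hM (DCAt.comp hM (by rw [hπ0]; exact hf) hπ)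
      (DCAt.comp hM (by rw [hπ0]; exact hg) hπ) hz with h1 | h1
    · obtain ⟨f1, hf1, e1⟩ := split_coord hM hf i h1
      have := ih β f1 g u hβn hf1 hg hu hu0 (cancel f1 g hf1 hg (by
        filter_upwards [e1] with x hx; rw [hx]; ring))
      refine ((Mon.coord hM i).mul hM this).congr ?_
      filter_upwards [e1] with x hx
      rw [hx]; rfl
    · obtain ⟨g1, hg1, e1⟩ := split_coord hM hg i h1
      exact ih β f g1 u hβn hf hg1 hu hu0 (cancel f g1 hf hg1 (by
        filter_upwards [e1] with x hx; rw [hx]; ring))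

lemma Mon.of_mul (hM : IsDCSeq M) {m : ℕ} {f g : (Fin m → ℝ) → ℝ} (hf : DCAt M f 0) (hg : DCAt M g 0)
    (h : Mon M (crd m) (fun x => f x * g x)) : Mon M (crd m) f := by
  obtain ⟨α, u, h1, h2, h3⟩ := h
  exact Mon.factor hM _ α f g u rfl hf hg h1 h2 h3

end Mon

section A
variable {M : ℕ → ℝ} {ι : Type}

def AA (M : ℕ → ℝ) (𝒰 : Ultrafilter ι) (m : ℕ) : Prop :=
  ∀ c : ι → (Fin m → ℝ), Tendsto c 𝒰 (𝓝 0) → Mini M 𝒰 m c → ∀ f : (Fin m → ℝ) → ℝ, DCAt M f 0 →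
    (¬ ∀ᶠ x in 𝓝 0, f x = 0) → ∃ (c' : ι → (Fin m → ℝ)) (p : (Fin m → ℝ) → (Fin m → ℝ)),
      Ref M 𝒰 c c' p ∧ Mon M (crd m) (fun x => f (p x))

variable {𝒰 : Ultrafilter ι}

lemma AA.list (hM : IsDCSeq M) {m : ℕ} (hA : AA M 𝒰 m) {c : ι → (Fin m → ℝ)}
    (h0 : Tendsto c 𝒰 (𝓝 0)) (hc : Mini M 𝒰 m c) {τ : Type*} (s : Finset τ)
    {f : τ → (Fin m → ℝ) → ℝ} (hf : ∀ t ∈ s, DCAt M (f t) 0)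
    (hf0 : ∀ t ∈ s, ¬ ∀ᶠ x in 𝓝 0, f t x = 0) :
    ∃ (c' : ι → (Fin m → ℝ)) (p : (Fin m → ℝ) → (Fin m → ℝ)),
      Ref M 𝒰 c c' p ∧ ∀ t ∈ s, Mon M (crd m) (fun x => f t (p x)) := by
  classical
  have hp : ¬ ∀ᶠ x in 𝓝 0, ∏ t ∈ s, f t x = 0 := by
    induction s using Finset.induction_on with
    | empty => simp [nhds_neBot.ne]
    | insert a s ha ih =>
      intro hz
      simp only [Finset.prod_insert ha] at hz
      rcases DCAt.mul_eq_zero hM (hf a (by simp))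
        (DCAt.prod hM s fun i hi => hf i (by simp [hi])) hz with h | h
      · exact hf0 a (by simp) h
      · exact ih (fun i hi => hf i (by simp [hi])) (fun i hi => hf0 i (by simp [hi])) h
  obtain ⟨c', p, hr, hm⟩ := hA c h0 hc _ (DCAt.prod hM s hf) hp
  refine ⟨c', p, hr, fun t ht => ?_⟩
  refine Mon.of_mul (g := fun x => ∏ i ∈ s.erase t, f i (p x)) hM (hr.comp hM (hf t ht)) ?_ ?_
  · exact DCAt.prod hM _ fun i hi => hr.comp hM (hf i (Finset.mem_of_mem_erase hi))
  · exact hm.congr (Eventually.of_forall fun x => (Finset.mul_prod_erase s (fun t => f t (p x)) ht).symm)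

lemma AA.ne_zero (hM : IsDCSeq M) {m : ℕ} (hA : AA M 𝒰 m) {c : ι → (Fin m → ℝ)}
    (h0 : Tendsto c 𝒰 (𝓝 0)) (hc : Mini M 𝒰 m c) {f : (Fin m → ℝ) → ℝ} (hf : DCAt M f 0)
    (hf0 : ¬ ∀ᶠ x in 𝓝 0, f x = 0) : ∀ᶠ i in 𝒰, f (c i) ≠ 0 := by
  obtain ⟨c', p, hr, hm⟩ := hA c h0 hc f hf hf0
  have := hm.ne_zero hr.tend ((hc.ref hM hr).coord hM hr.tend)
  filter_upwards [this, hr.eq] with i a b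
  rwa [b]

lemma not_zero_of_ev {E : Type} [NormedAddCommGroup E] {c : ι → E} (h0 : Tendsto c 𝒰 (𝓝 0))
    {f : E → ℝ} (h : ∀ᶠ i in 𝒰, f (c i) ≠ 0) : ¬ ∀ᶠ x in 𝓝 0, f x = 0 := by
  intro hz
  obtain ⟨i, h1, h2⟩ := (h.and (h0.eventually hz)).exists
  exact h1 h2

end A
end QDC

namespace QDC
open Filter Topology Set
open scoped ContDiff Nat

section Prep
variable {M : ℕ → ℝ} {ι : Type} {𝒰 : Ultrafilter ι}

lemma pow_subst (hM : IsDCSeq M) {m : ℕ} {c : ι → (Fin m → ℝ)} (h0 : Tendsto c 𝒰 (𝓝 0))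
    (hc : Mini M 𝒰 m c) {k : ℕ} (hk : 0 < k) : ∃ ε : Fin m → ℝ, (∀ i, ε i ≠ 0) ∧
      ∃ c' : ι → (Fin m → ℝ), Ref M 𝒰 c c' (fun t i => ε i * t i ^ k) := by
  classical
  have hk0 : (k:ℝ) ≠ 0 := by positivity
  refine ⟨fun i => if ∀ᶠ l in 𝒰, 0 < c l i then 1 else -1, fun i => by dsimp only; split_ifs <;> norm_num,
    fun l i => |c l i| ^ ((k:ℝ)⁻¹), ?_, ?_, ?_, ?_⟩
  · rw [tendsto_pi_nhds] at h0 ⊢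
    intro i
    have h1 := (h0 i).abs
    simp only [Pi.zero_apply, abs_zero] at h1
    have h2 := h1.rpow_const (p := (k:ℝ)⁻¹) (Or.inr (by positivity))
    rw [Real.zero_rpow (by positivity)] at h2
    exact h2
  · exact DCAt.pi hM fun i => (DCAt.const hM _ _).mul hM ((crd_dc hM i 0).pow hM k)
  · ext i; simp [hk.ne']
  · have := eventually_all.2 (hc.coord hM h0)
    have h3 : ∀ᶠ l in 𝒰, ∀ i, (¬ (∀ᶠ l in 𝒰, 0 < c l i)) → ¬ 0 < c l i := by
      rw [eventually_all]
      intro i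
      by_cases h : ∀ᶠ l in 𝒰, 0 < c l i
      · simp [h]
      · simp only [h, not_false_eq_true, true_imp_iff]
        exact Ultrafilter.eventually_not.2 h
    have h4 : ∀ᶠ l in 𝒰, ∀ i, (∀ᶠ l in 𝒰, 0 < c l i) → 0 < c l i := by
      rw [eventually_all]
      intro i
      by_cases h : ∀ᶠ l in 𝒰, 0 < c l i
      · simp [h]
      · simp [h]
    filter_upwards [this, h3, h4] with l h1 h3 h4
    ext i
    have e1 : (|c l i| ^ ((k:ℝ)⁻¹)) ^ k = |c l i| := by
      rw [← Real.rpow_natCast, ← Real.rpow_mul (abs_nonneg _), inv_mul_cancel₀ hk0, Real.rpow_one]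
    simp only [e1]
    split_ifs with h
    · rw [abs_of_pos (h4 i h), one_mul]
    · rw [abs_of_nonpos (not_lt.1 (h3 i h))]; ring

lemma mono_le {m : ℕ} {α γ : Fin m → ℕ} {u w : (Fin m → ℝ) → ℝ} (hu : ContinuousAt u 0)
    (hw : ContinuousAt w 0) (hu0 : u 0 ≠ 0)
    (h : ∀ᶠ x in 𝓝 0, |(∏ i, crd m i x ^ α i) * u x| ≤ |(∏ i, crd m i x ^ γ i) * w x|) (l : Fin m) :
    γ l ≤ α l := by
  classical
  by_contra hcon
  push Not at hcon
  have hu' : ∀ᶠ x in 𝓝 0, |u 0| / 2 < |u x| :=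
    hu.abs.eventually (lt_mem_nhds (by simpa using half_lt_self (abs_pos.2 hu0)))
  have hw' : ∀ᶠ x in 𝓝 0, |w x| < |w 0| + 1 :=
    hw.abs.eventually (gt_mem_nhds (by linarith))
  obtain ⟨r, hr, hb⟩ := Metric.eventually_nhds_iff.1 (h.and (hu'.and hw'))
  set δ := r / 2 with hδ
  have hδ0 : 0 < δ := by positivity
  set D : (Fin m → ℕ) → ℝ := fun β => ∏ i ∈ Finset.univ.erase l, δ ^ β i with hD
  have hDpos : ∀ β, 0 < D β := fun β => Finset.prod_pos fun i _ => by positivity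
  have key : ∀ s, 0 < s → s < δ → D α * (|u 0| / 2) ≤ D γ * (|w 0| + 1) * s ^ (γ l - α l) := by
    intro s hs hsδ
    set x : Fin m → ℝ := Function.update (fun _ => δ) l s with hx
    have hxr : dist x 0 < r := by
      rw [dist_zero_right, pi_norm_lt_iff hr]
      intro i
      rw [hx]
      by_cases hi : i = l
      · subst hi; simp only [Function.update_self, Real.norm_eq_abs, abs_of_pos hs]; linarith
      · simp only [Function.update_of_ne hi, Real.norm_eq_abs, abs_of_pos hδ0]; linarith
    obtain ⟨h1, h2, h3⟩ := hb hxr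
    have hp : ∀ β : Fin m → ℕ, ∏ i, crd m i x ^ β i = s ^ β l * D β := by
      intro β
      rw [← Finset.mul_prod_erase _ _ (Finset.mem_univ l)]
      congr 1
      · simp [crd, hx]
      · refine Finset.prod_congr rfl fun i hi => ?_
        simp [crd, hx, Function.update_of_ne (Finset.ne_of_mem_erase hi)]
    rw [hp, hp, abs_mul, abs_mul (_ * D γ), abs_of_pos (mul_pos (pow_pos hs _) (hDpos _)),
      abs_of_pos (mul_pos (pow_pos hs _) (hDpos _))] at h1
    have h4 : s ^ γ l = s ^ α l * s ^ (γ l - α l) := by rw [← pow_add]; congr 1; omega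
    rw [h4] at h1
    have h5 : s ^ α l * (D α * (|u 0| / 2)) ≤ s ^ α l * (D γ * (|w 0| + 1) * s ^ (γ l - α l)) := by
      calc s ^ α l * (D α * (|u 0| / 2)) ≤ s ^ α l * D α * |u x| := by
            rw [mul_assoc]
            have := hDpos α
            gcongr
        _ ≤ _ := h1
        _ ≤ s ^ α l * s ^ (γ l - α l) * D γ * (|w 0| + 1) := by
            have := hDpos γ
            gcongr
        _ = _ := by ring
    exact le_of_mul_le_mul_left h5 (by positivity)
  have ht : Tendsto (fun s : ℝ => D γ * (|w 0| + 1) * s ^ (γ l - α l)) (𝓝[>] 0) (𝓝 0) := by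
    have : Tendsto (fun s : ℝ => D γ * (|w 0| + 1) * s ^ (γ l - α l)) (𝓝 0)
        (𝓝 (D γ * (|w 0| + 1) * 0 ^ (γ l - α l))) :=
      (Continuous.tendsto (by fun_prop) 0)
    rw [zero_pow (by omega), mul_zero] at this
    exact this.mono_left nhdsWithin_le_nhds
  have := ge_of_tendsto ht (b := D α * (|u 0| / 2)) (by
    filter_upwards [Ioo_mem_nhdsGT hδ0] with s hs
    exact key s hs.1 hs.2)
  have h6 := mul_pos (hDpos α) (half_pos (abs_pos.2 hu0))
  linarith

lemma mono_not_zero (hM : IsDCSeq M) {m : ℕ} (α : Fin m → ℕ) : ¬ ∀ᶠ x in 𝓝 0, ∏ i, crd m i x ^ α i = 0 := by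
  intro h
  have ht : Tendsto (fun t : ℝ => (fun _ : Fin m => t)) (𝓝 0) (𝓝 0) := by
    rw [tendsto_pi_nhds]; exact fun _ => tendsto_id
  have h1 := (ht.eventually h).filter_mono (nhdsWithin_le_nhds (s := {0}ᶜ))
  obtain ⟨t, ht1, ht2⟩ := (h1.and self_mem_nhdsWithin).exists
  rw [Finset.prod_eq_zero_iff] at ht1
  obtain ⟨i, _, hi⟩ := ht1
  exact ht2 ((pow_eq_zero_iff (n := α i) (by rintro h0; simp [h0] at hi)).1 hi)

lemma prep (hM : IsDCSeq M) {m : ℕ} (hA : AA M 𝒰 m) {c : ι → (Fin m → ℝ)}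
    (h0 : Tendsto c 𝒰 (𝓝 0)) (hc : Mini M 𝒰 m c) (d : ℕ) (a : ℕ → (Fin m → ℝ) → ℝ)
    (ha : ∀ j < d, DCAt M (a j) 0) (ha0 : ∀ j < d, a j 0 = 0)
    (hne : ∃ j < d, ¬ ∀ᶠ x in 𝓝 0, a j x = 0) (e : (Fin m → ℝ) → ℝ) (he : DCAt M e 0)
    (he0 : ¬ ∀ᶠ x in 𝓝 0, e x = 0) :
    ∃ (c' : ι → (Fin m → ℝ)) (p : (Fin m → ℝ) → (Fin m → ℝ)) (γ : Fin m → ℕ)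
      (b : ℕ → (Fin m → ℝ) → ℝ), Ref M 𝒰 c c' p ∧ (∏ i, crd m i 0 ^ γ i = 0) ∧
      (∀ j < d, DCAt M (b j) 0 ∧
        (∀ᶠ x in 𝓝 0, a j (p x) = (∏ i, crd m i x ^ γ i) ^ (d - j) * b j x) ∧
        ((∀ᶠ x in 𝓝 0, a j x = 0) → b j 0 = 0)) ∧
      (∃ j < d, b j 0 ≠ 0) ∧ Mon M (crd m) (fun x => e (p x)) := by
  classical
  set J : Finset ℕ := (Finset.range d).filter (fun j => ¬ ∀ᶠ x in 𝓝 0, a j x = 0) with hJ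
  have hJd : ∀ j ∈ J, j < d := fun j hj => by simp [hJ] at hj; exact hj.1
  have hJne : ∀ j ∈ J, ¬ ∀ᶠ x in 𝓝 0, a j x = 0 := fun j hj => (Finset.mem_filter.1 hj).2
  set N : ℕ → ℕ := fun j => 2 * (d ! / (d - j)) with hN
  have hNd : ∀ j < d, N j * (d - j) = 2 * d ! := by
    intro j hj
    rw [hN]; dsimp only
    rw [mul_assoc, Nat.div_mul_cancel (Nat.dvd_factorial (by omega) (by omega))]
  have hfac : 0 < 2 * d ! := by positivity
  have hNpos : ∀ j < d, 0 < N j := by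
    intro j hj
    refine Nat.pos_of_ne_zero fun h => ?_
    have := hNd j hj
    rw [h] at this; omega
  have hNeven : ∀ j, Even (N j) := fun j => even_two_mul _
  set h : (Fin m → ℝ) → ℝ := fun x => ∑ j ∈ J, a j x ^ N j with hh
  have hdc : DCAt M h 0 := DCAt.sum hM J fun j hj => (ha j (hJd j hj)).pow hM _
  have hle : ∀ j ∈ J, ∀ x, a j x ^ N j ≤ h x := fun j hj x =>
    Finset.single_le_sum (f := fun j => a j x ^ N j) (fun i _ => (hNeven i).pow_nonneg _) hj
  have hhne : ¬ ∀ᶠ x in 𝓝 0, h x = 0 := by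
    intro hz
    obtain ⟨j, hj, hj2⟩ := hne
    have hjJ : j ∈ J := Finset.mem_filter.2 ⟨Finset.mem_range.2 hj, hj2⟩
    refine hj2 (hz.mono fun x hx => ?_)
    have := hle j hjJ x
    rw [hx] at this
    exact pow_eq_zero_iff (hNpos j hj).ne' |>.1 (le_antisymm this ((hNeven j).pow_nonneg _))
  let f : Option (Option ℕ) → (Fin m → ℝ) → ℝ := fun o => o.elim e (fun o' => o'.elim h a)
  obtain ⟨c1, p1, hr1, hm1⟩ := hA.list hM h0 hc
    (insert none (insert (some none) (J.image fun j => some (some j)))) (f := f)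
    (by
      intro t ht
      simp only [Finset.mem_insert, Finset.mem_image] at ht
      rcases ht with rfl | rfl | ⟨j, hj, rfl⟩
      · exact he
      · exact hdc
      · exact ha j (hJd j hj))
    (by
      intro t ht
      simp only [Finset.mem_insert, Finset.mem_image] at ht
      rcases ht with rfl | rfl | ⟨j, hj, rfl⟩
      · exact he0
      · exact hhne
      · exact hJne j hj)
  have me : Mon M (crd m) (fun x => e (p1 x)) := hm1 none (by simp)
  obtain ⟨γ, w, hw, hw0, hwe⟩ : Mon M (crd m) (fun x => h (p1 x)) := hm1 (some none) (by simp)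
  have ma : ∀ j ∈ J, Mon M (crd m) (fun x => a j (p1 x)) := fun j hj =>
    hm1 (some (some j)) (by simp [hj])
  choose! α u hu hu0 hue using ma
  have hγα : ∀ j ∈ J, ∀ i, γ i ≤ N j * α j i := by
    intro j hj i
    refine mono_le (α := fun i => N j * α j i) (u := fun x => u j x ^ N j) ((hu j hj).continuousAt.pow _)
      hw.continuousAt (pow_ne_zero _ (hu0 j hj)) ?_ i
    filter_upwards [hwe, hue j hj] with x hx1 hx2
    have e1 : (∏ i, crd m i x ^ (N j * α j i)) * u j x ^ N j = a j (p1 x) ^ N j := by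
      rw [hx2, mul_pow, ← Finset.prod_pow]
      congr 1
      exact Finset.prod_congr rfl fun i _ => by rw [← pow_mul, mul_comm]
    rw [e1, ← hx1, abs_of_nonneg ((hNeven j).pow_nonneg _)]
    exact (hle j hj _).trans (le_abs_self _)
  set β : ℕ → Fin m → ℕ := fun j i => N j * α j i - γ i with hβ
  have hβe : ∀ j ∈ J, ∀ i, N j * α j i = γ i + β j i := fun j hj i => by
    have := hγα j hj i
    simp only [hβ]; omega
  have hex : ∃ j ∈ J, β j = 0 := by
    by_contra hcon
    push Not at hcon
    have hz : ∀ᶠ x in 𝓝 0, (∏ i, crd m i x ^ γ i) *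
        (w x - ∑ j ∈ J, (∏ i, crd m i x ^ β j i) * u j x ^ N j) = 0 := by
      have : ∀ᶠ x in 𝓝 0, ∀ j ∈ J, a j (p1 x) = (∏ i, crd m i x ^ α j i) * u j x :=
        (Finset.eventually_all J).2 hue
      filter_upwards [hwe, this] with x hx1 hx2
      rw [mul_sub, ← hx1, hh, Finset.mul_sum, sub_eq_zero]
      refine Finset.sum_congr rfl fun j hj => ?_
      rw [hx2 j hj, mul_pow, ← Finset.prod_pow, ← mul_assoc, ← Finset.prod_mul_distrib]
      congr 1
      refine Finset.prod_congr rfl fun i _ => ?_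
      rw [← pow_mul, ← pow_add, ← hβe j hj, mul_comm]
    rcases DCAt.mul_eq_zero hM (mono_dc hM γ 0) (hw.sub hM (DCAt.sum hM J fun j hj =>
      (mono_dc hM (β j) 0).mul hM ((hu j hj).pow hM _))) hz with h1 | h1
    · exact mono_not_zero hM γ h1
    · have := h1.self_of_nhds
      rw [Finset.sum_eq_zero, sub_zero] at this
      · exact hw0 this
      · intro j hj
        obtain ⟨i, hi⟩ := Function.ne_iff.1 (hcon j hj)
        rw [Finset.prod_eq_zero (Finset.mem_univ i), zero_mul]
        simpa [crd] using hi
  obtain ⟨ε, hε, c2, hr2⟩ := pow_subst hM hr1.tend (hc.ref hM hr1) hfac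
  set p2 : (Fin m → ℝ) → (Fin m → ℝ) := fun t i => ε i * t i ^ (2 * d !) with hp2
  refine ⟨c2, _, γ, fun j => if j ∈ J then fun t => (∏ i, crd m i t ^ ((d - j) * β j i)) *
    (∏ i, ε i ^ α j i) * u j (p2 t) else fun _ => 0, hr1.trans hM hr2, ?_, ?_, ?_, ?_⟩
  · have h1 := hwe.self_of_nhds
    dsimp only at h1
    rw [hr1.zero] at h1
    have h2 : h 0 = 0 := Finset.sum_eq_zero fun j hj => by
      rw [ha0 j (hJd j hj), zero_pow (hNpos j (hJd j hj)).ne']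
    rw [h2] at h1
    exact (mul_eq_zero.1 h1.symm).resolve_right hw0
  · intro j hj
    by_cases hjJ : j ∈ J
    · simp only [hjJ, if_true]
      refine ⟨?_, ?_, fun h => absurd h (hJne j hjJ)⟩
      · exact ((mono_dc hM (fun i => (d - j) * β j i) 0).mul hM (DCAt.const hM _ _)).mul hM
          (hr2.comp hM (hu j hjJ))
      · filter_upwards [hr2.tendsto_p.eventually (hue j hjJ)] with t ht
        rw [ht, ← mul_assoc, ← mul_assoc]
        congr 1
        rw [← Finset.prod_pow, ← Finset.prod_mul_distrib, ← Finset.prod_mul_distrib]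
        refine Finset.prod_congr rfl fun i _ => ?_
        simp only [crd, hp2]
        rw [mul_pow, ← pow_mul, ← pow_mul, ← pow_add, mul_comm]
        congr 2
        rw [← hNd j hj, mul_comm (N j), mul_assoc, hβe j hjJ]
        ring
    · simp only [hjJ, if_false]
      refine ⟨DCAt.const hM _ _, ?_, fun _ => trivial⟩
      have : ∀ᶠ x in 𝓝 0, a j x = 0 := by
        by_contra hcon
        exact hjJ (Finset.mem_filter.2 ⟨Finset.mem_range.2 hj, hcon⟩)
      filter_upwards [(hr1.trans hM hr2).tendsto_p.eventually this] with x hx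
      rw [hx, mul_zero]
  · obtain ⟨j, hj, hjβ⟩ := hex
    refine ⟨j, hJd j hj, ?_⟩
    simp only [hj, if_true, hjβ]
    rw [hr2.zero]
    simp only [Pi.zero_apply, mul_zero, pow_zero, Finset.prod_const_one, one_mul]
    exact mul_ne_zero (Finset.prod_ne_zero_iff.2 fun i _ => pow_ne_zero _ (hε i)) (hu0 j hj)
  · refine Mon.comp hM hr2.dc hr2.zero (fun i => ?_) me
    exact (Mon.unit (DCAt.const hM (ε i) 0) (hε i)).mul hM ((Mon.coord hM i).pow hM _)

end Prep
end QDC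

namespace QDC
open Filter Topology Set
open scoped ContDiff Nat

section Toric
variable {M : ℕ → ℝ} {ι : Type} {𝒰 : Ultrafilter ι}

lemma ultra_lim (𝒰 : Ultrafilter ι) (r : ι → ℝ) :
    (∃ z, Tendsto r 𝒰 (𝓝 z)) ∨ Tendsto (fun i => (r i)⁻¹) 𝒰 (𝓝 0) := by
  by_cases h : ∃ C, ∀ᶠ i in 𝒰, |r i| ≤ C
  · obtain ⟨C, hC⟩ := h
    left
    have hK : IsCompact (Icc (-C) C) := isCompact_Icc
    obtain ⟨z, _, hz⟩ := hK.ultrafilter_le_nhds' (𝒰.map r) (by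
      rw [Ultrafilter.mem_map]
      filter_upwards [hC] with i hi
      exact abs_le.1 hi)
    exact ⟨z, hz⟩
  · push Not at h
    right
    have h1 : Tendsto (fun i => |r i|) 𝒰 atTop := by
      rw [tendsto_atTop]
      intro b
      filter_upwards [h b] with i hi
      exact hi.le
    have h2 := h1.inv_tendsto_atTop
    refine squeeze_zero_norm (fun i => ?_) h2
    simp

lemma update_dc (hM : IsDCSeq M) {m : ℕ} {E : Type} [NormedAddCommGroup E] [NormedSpace ℝ E]
    {f : E → Fin m → ℝ} {g : E → ℝ} {x : E} (i : Fin m)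
    (hf : DCAt M f x) (hg : DCAt M g x) : DCAt M (fun z => Function.update (f z) i (g z)) x := by
  refine DCAt.pi hM fun j => ?_
  by_cases h : j = i
  · subst h; simpa using hg
  · simpa [Function.update_of_ne h] using hf.apply hM j

lemma tend_fst {m : ℕ} {c : ι → (Fin m → ℝ) × ℝ} (h : Tendsto c 𝒰 (𝓝 0)) :
    Tendsto (fun i => (c i).1) 𝒰 (𝓝 0) :=
  (continuous_fst.tendsto (0 : (Fin m → ℝ) × ℝ)).comp h

lemma tend_snd {m : ℕ} {c : ι → (Fin m → ℝ) × ℝ} (h : Tendsto c 𝒰 (𝓝 0)) :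
    Tendsto (fun i => (c i).2) 𝒰 (𝓝 0) :=
  (continuous_snd.tendsto (0 : (Fin m → ℝ) × ℝ)).comp h

lemma tend_mk {m : ℕ} {a : ι → (Fin m → ℝ)} {b : ι → ℝ} (h : Tendsto a 𝒰 (𝓝 0))
    (h' : Tendsto b 𝒰 (𝓝 0)) : Tendsto (fun i => (a i, b i)) 𝒰 (𝓝 (0 : (Fin m → ℝ) × ℝ)) :=
  h.prodMk_nhds h'

lemma toric (hM : IsDCSeq M) {m : ℕ} (n : ℕ) : ∀ (γ : Fin m → ℕ), ∑ i, γ i = n →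
    ∀ c : ι → (Fin m → ℝ) × ℝ, Tendsto c 𝒰 (𝓝 0) → Mini M 𝒰 (m+1) c →
    Tendsto (fun l => (∏ i, crd m i (c l).1 ^ γ i) / (c l).2) 𝒰 (𝓝 0) →
    ∃ (c' : ι → (Fin m → ℝ) × ℝ) (p : (Fin m → ℝ) × ℝ → (Fin m → ℝ) × ℝ) (q : (Fin m → ℝ) × ℝ → ℝ),
      Ref M 𝒰 c c' p ∧ (∀ o, Mon M (crdP m) (fun z => crdP m o (p z))) ∧ DCAt M q 0 ∧
      ∀ᶠ z in 𝓝 0, (∏ i, crd m i (p z).1 ^ γ i) = (p z).2 * q z := by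
  classical
  induction n with
  | zero =>
    intro γ hγ c h0 hc h
    exfalso
    have hγ' : ∀ i, γ i = 0 := by simpa using hγ
    have h1 := (tend_snd h0).mul h
    rw [mul_zero] at h1
    have h2 : Tendsto (fun _ : ι => (1:ℝ)) 𝒰 (𝓝 0) := by
      refine h1.congr' ?_
      filter_upwards [hc.snd hM h0] with i hi
      simp [hγ', mul_inv_cancel₀ hi]
    exact zero_ne_one (tendsto_nhds_unique h2 tendsto_const_nhds)
  | succ n ih =>
    intro γ hγ c h0 hc h
    obtain ⟨i, hi⟩ : ∃ i, γ i ≠ 0 := by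
      by_contra hcon
      push Not at hcon
      simp [hcon] at hγ
    have hF : ∀ j, DCAt M (fun z : (Fin m → ℝ) × ℝ => z.1 j) 0 := fun j => (DCAt.fst hM 0).apply hM j
    have hS : DCAt M (fun z : (Fin m → ℝ) × ℝ => z.2) 0 := DCAt.snd hM 0
    rcases ultra_lim 𝒰 (fun l => (c l).1 i / (c l).2) with ⟨z0, hz⟩ | hz
    · have hw : Tendsto (fun l => (c l).1 i / (c l).2 - z0) 𝒰 (𝓝 0) := by
        simpa using hz.sub_const z0
      refine ⟨fun l => (Function.update (c l).1 i ((c l).1 i / (c l).2 - z0), (c l).2),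
        fun z => (Function.update z.1 i (z.2 * (z0 + z.1 i)), z.2),
        fun z => (z.2 ^ (γ i - 1) * (z0 + z.1 i) ^ γ i) * ∏ j ∈ Finset.univ.erase i, z.1 j ^ γ j,
        ⟨?_, ?_, ?_, ?_⟩, ?_, ?_, ?_⟩
      · refine tend_mk ?_ (tend_snd h0)
        rw [tendsto_pi_nhds]
        intro j
        by_cases hj : j = i
        · subst hj; simpa using hw
        · simpa [Function.update_of_ne hj] using (tendsto_pi_nhds.1 (tend_fst h0)) j
      · exact (update_dc hM i (DCAt.fst hM 0) (hS.mul hM ((DCAt.const hM _ _).add hM (hF i)))).prodMk hM hS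
      · ext j
        · by_cases hj : j = i
          · subst hj; simp
          · simp [Function.update_of_ne hj]
        · simp
      · filter_upwards [hc.snd hM h0] with l hl
        ext j
        · by_cases hj : j = i
          · subst hj; simp; field_simp
          · simp [Function.update_of_ne hj]
        · simp
      · rintro (_ | j)
        · exact Mon.coord hM none
        · by_cases hj : j = i
          · subst hj
            have h1 : Mon M (crdP m) (fun z => z0 + z.1 j) := by
              by_cases h00 : z0 = 0
              · subst h00; simp only [zero_add]; exact Mon.coord (X := crdP m) hM (some j)
              · exact Mon.unit ((DCAt.const hM _ _).add hM (hF j)) (by simpa using h00)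
            simpa [crdP] using (Mon.coord (X := crdP m) hM none).mul hM h1
          · simp only [crdP, Option.elim, Function.update_of_ne hj]
            exact Mon.coord (X := crdP m) hM (some j)
      · exact ((hS.pow hM _).mul hM (((DCAt.const hM _ _).add hM (hF i)).pow hM _)).mul hM
          (DCAt.prod hM _ fun j _ => (hF j).pow hM _)
      · refine Eventually.of_forall fun z => ?_
        rw [← Finset.mul_prod_erase _ _ (Finset.mem_univ i), ← mul_assoc]
        congr 1
        · simp only [crd, Function.update_self, mul_pow]
          conv_lhs => rw [show γ i = (γ i - 1) + 1 by omega, pow_succ' z.2]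
          rw [show γ i - 1 + 1 = γ i by omega]
          ring
        · refine Finset.prod_congr rfl fun j hj => ?_
          simp [crd, Function.update_of_ne (Finset.ne_of_mem_erase hj)]
    · have hx := (hc.fst hM h0).coord hM (tend_fst h0) i
      simp only [inv_div] at hz
      set β := Function.update γ i (γ i - 1) with hβ
      have hβn : ∑ j, β j = n := by
        rw [hβ, Finset.sum_update_of_mem (Finset.mem_univ i), Finset.sdiff_singleton_eq_erase]
        rw [← Finset.add_sum_erase _ γ (Finset.mem_univ i)] at hγ
        omega
      have hprod : ∀ x, ∏ j, crd m j x ^ γ j = x i * ∏ j, crd m j x ^ β j := by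
        intro x
        rw [← Finset.mul_prod_erase _ _ (Finset.mem_univ i),
          ← Finset.mul_prod_erase _ (fun j => crd m j x ^ β j) (Finset.mem_univ i), ← mul_assoc]
        congr 1
        · rw [hβ, Function.update_self, crd]
          conv_lhs => rw [show γ i = (γ i - 1) + 1 by omega]
          rw [pow_succ, mul_comm]
        · refine Finset.prod_congr rfl fun j hj => ?_
          rw [hβ, Function.update_of_ne (Finset.ne_of_mem_erase hj)]
      have hr : Ref M 𝒰 c (fun l => ((c l).1, (c l).2 / (c l).1 i)) (fun z => (z.1, z.1 i * z.2)) := by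
        refine ⟨tend_mk (tend_fst h0) hz, (DCAt.fst hM 0).prodMk hM ((hF i).mul hM hS), by simp, ?_⟩
        filter_upwards [hx] with l hl
        ext j
        · rfl
        · simp; field_simp
      obtain ⟨c', p', q', hr', hm', hq', he'⟩ := ih β hβn _ hr.tend (hc.ref hM hr) (by
        refine h.congr' ?_
        filter_upwards [hx] with l hl
        rw [hprod, mul_comm, div_div_eq_mul_div])
      refine ⟨c', _, q', hr.trans hM hr', fun o => ?_, hq', ?_⟩
      · rcases o with _ | j
        · exact (hm' (some i)).mul hM (hm' none)
        · exact hm' (some j)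
      · filter_upwards [he'] with z hz
        rw [hprod, hz]; ring

end Toric
end QDC

namespace QDC
open Filter Topology Set
open scoped ContDiff Nat

section Tay
variable {M : ℕ → ℝ} {m : ℕ}

/-- the last basis vector -/
def ey (m : ℕ) : (Fin m → ℝ) × ℝ := (0, 1)

lemma dv_comp (hM : IsDCSeq M) {E F : Type} [NormedAddCommGroup E] [NormedSpace ℝ E]
    [NormedAddCommGroup F] [NormedSpace ℝ F] {p : E → F} {f : F → ℝ} {x : E} (hp : DCAt M p x)
    (hf : DCAt M f (p x)) (e : E) (v : F) (h : ∀ᶠ z in 𝓝 x, fderiv ℝ p z e = v) (k : ℕ) :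
    (dv e)^[k] (fun z => f (p z)) =ᶠ[𝓝 x] fun z => (dv v)^[k] f (p z) := by
  induction k with
  | zero => exact EventuallyEq.rfl
  | succ k ih =>
    simp only [Function.iterate_succ_apply']
    refine (dv_congr ih e).trans ?_
    filter_upwards [h, hp.eventually, hp.continuousAt.eventually (hf.dv_iter hM v k).eventually] with z a b c
    unfold dv
    change (fderiv ℝ (((dv v)^[k] f) ∘ p) z) e = _
    rw [fderiv_comp z c.differentiableAt b.differentiableAt, ContinuousLinearMap.comp_apply, a]
    rfl

lemma dv_mul_snd (hM : IsDCSeq M) {H : (Fin m → ℝ) × ℝ → ℝ} {G : (Fin m → ℝ) → ℝ}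
    (hG : DCAt M G 0) (hH : DCAt M H 0) (k : ℕ) :
    (dv (ey m))^[k+1] (fun z => G z.1 + z.2 * H z) =ᶠ[𝓝 0]
      fun z => z.2 * (dv (ey m))^[k+1] H z + (k+1) * (dv (ey m))^[k] H z := by
  have hprod : ∀ (A : (Fin m → ℝ) × ℝ → ℝ) z, DifferentiableAt ℝ A z →
      HasFDerivAt (fun z : (Fin m → ℝ) × ℝ => z.2 * A z)
        (z.2 • fderiv ℝ A z + A z • ContinuousLinearMap.snd ℝ _ _) z := fun A z hA =>
    hasFDerivAt_snd.mul hA.hasFDerivAt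
  induction k with
  | zero =>
    have hGe : ∀ᶠ z : (Fin m → ℝ) × ℝ in 𝓝 0, DCAt M G z.1 :=
      (continuous_fst.tendsto (0 : (Fin m → ℝ) × ℝ)).eventually hG.eventually
    filter_upwards [hGe, hH.eventually] with z a b
    simp only [Nat.zero_add, Function.iterate_one, Function.iterate_zero, id]
    unfold dv
    have h1 : HasFDerivAt (fun z : (Fin m → ℝ) × ℝ => G z.1)
        ((fderiv ℝ G z.1).comp (ContinuousLinearMap.fst ℝ _ _)) z :=
      HasFDerivAt.comp z (a.differentiableAt.hasFDerivAt) hasFDerivAt_fst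
    have h2 := h1.add (hprod H z b.differentiableAt)
    have h3 := h2.fderiv
    rw [show (fun z : (Fin m → ℝ) × ℝ => G z.1 + z.2 * H z) = (fun z => G z.1) + (fun z => z.2 * H z) from rfl, h3]
    simp [ey]
  | succ k ih =>
    rw [Function.iterate_succ_apply']
    refine (dv_congr ih _).trans ?_
    filter_upwards [(hH.dv_iter hM (ey m) (k+1)).eventually, (hH.dv_iter hM (ey m) k).eventually] with z a b
    have h2 := (hprod _ z a.differentiableAt).add (b.differentiableAt.hasFDerivAt.const_mul ((k:ℝ)+1))
    have h3 := h2.fderiv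
    conv_lhs => unfold dv
    change (fderiv ℝ ((fun z => z.2 * (dv (ey m))^[k+1] H z) + fun z => ((k:ℝ)+1) * (dv (ey m))^[k] H z) z) (ey m) = _
    rw [h3, Function.iterate_succ_apply' _ (k+1)]
    have h4 : fderiv ℝ ((dv (ey m))^[k] H) z (ey m) = (dv (ey m))^[k+1] H z := by
      rw [Function.iterate_succ_apply']; rfl
    have h5 : fderiv ℝ ((dv (ey m))^[k+1] H) z (ey m) = dv (ey m) ((dv (ey m))^[k+1] H) z := rfl
    simp only [add_apply, smul_apply, h4, h5, smul_eq_mul,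
      ContinuousLinearMap.coe_snd']
    simp only [ey, mul_one]; push_cast; ring

lemma ev_mk0 {p : (Fin m → ℝ) × ℝ → Prop} (h : ∀ᶠ z in 𝓝 0, p z) : ∀ᶠ x in 𝓝 0, p (x, 0) := by
  have : Tendsto (fun x : Fin m → ℝ => (x, (0:ℝ))) (𝓝 0) (𝓝 0) :=
    Continuous.tendsto' (by fun_prop) _ _ rfl
  exact this.eventually h

lemma mk0_dc (hM : IsDCSeq M) {f : (Fin m → ℝ) × ℝ → ℝ} (hf : DCAt M f 0) :
    DCAt M (fun x => f (x, 0)) 0 :=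
  DCAt.comp hM (g := fun x : Fin m → ℝ => (x, (0:ℝ))) hf ((DCAt.id hM 0).prodMk hM (DCAt.const hM _ _))

lemma taylor (hM : IsDCSeq M) (d : ℕ) : ∀ {f : (Fin m → ℝ) × ℝ → ℝ}, DCAt M f 0 →
    ∃ (a : ℕ → (Fin m → ℝ) → ℝ) (u : (Fin m → ℝ) × ℝ → ℝ), (∀ j, DCAt M (a j) 0) ∧ DCAt M u 0 ∧
      (∀ᶠ z in 𝓝 0, f z = ∑ j ∈ Finset.range d, a j z.1 * z.2 ^ j + z.2 ^ d * u z) ∧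
      (∀ j < d, ∀ᶠ x in 𝓝 0, (dv (ey m))^[j] f (x, 0) = j ! * a j x) ∧
      ∀ᶠ x in 𝓝 0, (dv (ey m))^[d] f (x, 0) = d ! * u (x, 0) := by
  induction d with
  | zero =>
    intro f hf
    exact ⟨fun _ _ => 0, f, fun _ => DCAt.const hM _ _, hf, by simp, by simp, by simp⟩
  | succ d ih =>
    intro f hf
    obtain ⟨H, hH, he⟩ := hf.divide hM (ContinuousLinearMap.snd ℝ (Fin m → ℝ) ℝ) (ey m) (by simp)
    obtain ⟨a, u, ha, hu, h1, h2, h3⟩ := ih hH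
    have he' : f =ᶠ[𝓝 0] fun z => (fun x => f (x, 0)) z.1 + z.2 * H z := by
      filter_upwards [he] with z hz
      have : z - z.2 • ey m = (z.1, 0) := by ext <;> simp [ey]
      simp only [ContinuousLinearMap.coe_snd', this] at hz
      linarith
    have hD : ∀ j, ∀ᶠ x in 𝓝 0, (dv (ey m))^[j+1] f (x, 0) = (j+1) * (dv (ey m))^[j] H (x, 0) := by
      intro j
      filter_upwards [ev_mk0 ((dv_iter_congr he' (ey m) (j+1)).trans (dv_mul_snd hM (mk0_dc hM hf) hH j))] with x hx
      rw [hx]; simp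
    refine ⟨fun j => Nat.casesOn j (fun x => f (x, 0)) a, u, ?_, hu, ?_, ?_, ?_⟩
    · rintro (_ | j)
      · exact mk0_dc hM hf
      · exact ha j
    · filter_upwards [he', h1] with z hz hz1
      rw [hz, hz1, Finset.sum_range_succ', mul_add, Finset.mul_sum]
      simp only [pow_zero, mul_one, pow_succ]
      have : ∀ j, z.2 * (a j z.1 * z.2 ^ j) = a j z.1 * (z.2 ^ j * z.2) := fun j => by ring
      simp only [this]
      rw [show (Nat.rec (motive := fun _ => (Fin m → ℝ) → ℝ) (fun x => f (x, 0)) (fun n _ => a n) 0 z.1)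
        = f (z.1, 0) from rfl]
      ring
    · rintro (_ | j) hj
      · simp
      · filter_upwards [hD j, h2 j (by omega)] with x hx1 hx2
        rw [hx1, hx2, Nat.factorial_succ]; push_cast; ring
    · filter_upwards [hD d, h3] with x hx1 hx2
      rw [hx1, hx2, Nat.factorial_succ]; push_cast; ring

/-- Tschirnhausen shift -/
lemma tschirn (hM : IsDCSeq M) {h : (Fin m → ℝ) × ℝ → ℝ} (hh : DCAt M h 0) (h0 : h 0 = 0)
    (h1 : dv (ey m) h 0 ≠ 0) : ∃ b : (Fin m → ℝ) → ℝ, DCAt M b 0 ∧ b 0 = 0 ∧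
      ∀ᶠ x in 𝓝 0, h (x, b x) = 0 := by
  let P : (Fin m → ℝ) × ℝ → (Fin m → ℝ) × ℝ := fun z => (z.1, h z)
  have hP : DCAt M P 0 := (DCAt.fst hM 0).prodMk hM hh
  have hP0 : P 0 = 0 := by simp [P, h0]
  set A := fderiv ℝ h 0 with hA
  have ha : A (0, 1) ≠ 0 := h1
  have hf : fderiv ℝ P 0 = (ContinuousLinearMap.fst ℝ (Fin m → ℝ) ℝ).prod A :=
    (hasFDerivAt_fst.prodMk hh.differentiableAt.hasFDerivAt).fderiv
  have hu : IsUnit (fderiv ℝ P 0) := by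
    rw [hf]
    let B : (Fin m → ℝ) × ℝ →L[ℝ] (Fin m → ℝ) × ℝ := (ContinuousLinearMap.fst ℝ (Fin m → ℝ) ℝ).prod
      ((A (0, 1))⁻¹ • (ContinuousLinearMap.snd ℝ (Fin m → ℝ) ℝ -
        A.comp ((ContinuousLinearMap.inl ℝ (Fin m → ℝ) ℝ).comp (ContinuousLinearMap.fst ℝ (Fin m → ℝ) ℝ))))
    have hsplit : ∀ x y, A (x, y) = A (x, 0) + y * A (0, 1) := by
      intro x y
      rw [← smul_eq_mul, ← map_smul, ← map_add]; simp
    refine ⟨⟨_, B, ?_, ?_⟩, rfl⟩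
    · ext1
      · ext z <;> simp [B]
        rw [hsplit]; field_simp; simp
      · ext <;> simp [B]
        rw [hsplit]; field_simp; simp
    · ext1
      · ext z <;> simp [B]
      · have hz : A ((0 : Fin m → ℝ), (0:ℝ)) = 0 := map_zero A
        ext <;> simp [B, ha, hz]
  obtain ⟨Q, hQ0, hQ, hPQ, -⟩ := hP.inverse_fun hM hu
  rw [hP0] at hQ0 hQ hPQ
  refine ⟨fun x => (Q (x, 0)).2, ?_, ?_, ?_⟩
  · have : DCAt M (fun x : Fin m → ℝ => Q (x, 0)) 0 :=
      DCAt.comp hM (g := fun x : Fin m → ℝ => (x, (0:ℝ))) hQ ((DCAt.id hM 0).prodMk hM (DCAt.const hM _ _))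
    exact DCAt.comp hM (DCAt.snd hM _) this
  · have : Q ((0 : Fin m → ℝ), (0:ℝ)) = 0 := hQ0
    simp [this]
  · filter_upwards [ev_mk0 hPQ] with x hx
    have e1 : (Q (x, 0)).1 = x := congrArg Prod.fst hx
    have e2 : h (Q (x, 0)) = 0 := congrArg Prod.snd hx
    have e3 : (x, (Q (x, 0)).2) = Q (x, 0) := Prod.ext e1.symm rfl
    rw [e3, e2]

lemma dv_line (hM : IsDCSeq M) {E : Type} [NormedAddCommGroup E] [NormedSpace ℝ E] {f : E → ℝ}
    (hf : DCAt M f 0) (e : E) (j : ℕ) :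
    iteratedDeriv j (fun t : ℝ => f (t • e)) =ᶠ[𝓝 0] fun t => (dv e)^[j] f (t • e) := by
  have ht : Tendsto (fun t : ℝ => t • e) (𝓝 0) (𝓝 0) :=
    Continuous.tendsto' (by fun_prop) _ _ (by simp)
  induction j with
  | zero => simp
  | succ j ih =>
    rw [iteratedDeriv_succ]
    refine ih.deriv.trans ?_
    filter_upwards [ht.eventually (hf.dv_iter hM e j).eventually] with t h
    rw [Function.iterate_succ_apply']
    have h1 : HasDerivAt (fun t : ℝ => t • e) e t := by
      simpa using (hasDerivAt_id t).smul_const e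
    exact (h.differentiableAt.hasFDerivAt.comp_hasDerivAt t h1).deriv

lemma poly_iter (P : Polynomial ℝ) (j : ℕ) :
    iteratedDeriv j (fun t : ℝ => P.eval t) = fun t => (Polynomial.derivative^[j] P).eval t := by
  induction j with
  | zero => simp
  | succ j ih =>
    rw [iteratedDeriv_succ, ih, Function.iterate_succ_apply']
    ext t; exact Polynomial.deriv _

lemma poly_order (d : ℕ) (b : ℕ → ℝ) (u z0 : ℝ) (hd : 0 < d) (hb : b (d - 1) = 0) (hu : u ≠ 0)
    (hj : ∃ j < d, b j ≠ 0) : ∃ j < d, iteratedDeriv j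
      (fun t : ℝ => ∑ j ∈ Finset.range d, b j * (z0 + t) ^ j + (z0 + t) ^ d * u) 0 ≠ 0 := by
  classical
  by_contra hcon
  push Not at hcon
  let R : Polynomial ℝ := ∑ j ∈ Finset.range d, Polynomial.C (b j) * Polynomial.X ^ j +
    Polynomial.C u * Polynomial.X ^ d
  have hR : ∀ j < d, R.coeff j = b j := by
    intro j hj
    simp only [R, Polynomial.coeff_add, Polynomial.finsetSum_coeff, Polynomial.coeff_C_mul_X_pow]
    simp [hj, hj.ne]
  have hRd : R.coeff d = u := by
    simp only [R, Polynomial.coeff_add, Polynomial.finsetSum_coeff, Polynomial.coeff_C_mul_X_pow]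
    simp
  have hRdeg : R.natDegree ≤ d := by
    refine Polynomial.natDegree_le_iff_coeff_eq_zero.2 fun N hN => ?_
    simp only [R, Polynomial.coeff_add, Polynomial.finsetSum_coeff, Polynomial.coeff_C_mul_X_pow]
    rw [Finset.sum_eq_zero, if_neg (by omega), add_zero]
    intro i hi
    rw [if_neg]
    have := Finset.mem_range.1 hi
    omega
  set T := Polynomial.taylor z0 R with hT
  have hfun : (fun t : ℝ => ∑ j ∈ Finset.range d, b j * (z0 + t) ^ j + (z0 + t) ^ d * u) =
      fun t => T.eval t := by
    ext t
    rw [hT, Polynomial.taylor_eval]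
    simp only [R, Polynomial.eval_add, Polynomial.eval_finsetSum, Polynomial.eval_mul, Polynomial.eval_C,
      Polynomial.eval_pow, Polynomial.eval_X, add_comm z0 t, mul_comm u]
  have hTj : ∀ j < d, T.coeff j = 0 := by
    intro j hj
    have := hcon j hj
    rw [hfun, poly_iter] at this
    dsimp only at this
    rw [← Polynomial.coeff_zero_eq_eval_zero, Polynomial.coeff_iterate_derivative, zero_add,
      Nat.descFactorial_self, nsmul_eq_mul] at this
    exact (mul_eq_zero.1 this).resolve_left (by positivity)
  have hTd : T.natDegree ≤ d := by rw [hT, Polynomial.natDegree_taylor]; exact hRdeg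
  have hTe : T = Polynomial.C (T.coeff d) * Polynomial.X ^ d := by
    ext j
    rw [Polynomial.coeff_C_mul_X_pow]
    rcases lt_trichotomy j d with h | h | h
    · rw [hTj j h, if_neg h.ne]
    · subst h; simp
    · rw [if_neg h.ne', Polynomial.coeff_eq_zero_of_natDegree_lt (by omega)]
  have hRT : R = Polynomial.C (T.coeff d) * (Polynomial.X + Polynomial.C (-z0)) ^ d := by
    have : Polynomial.taylor (-z0) T = R := by
      rw [hT, Polynomial.taylor_taylor]; simp
    rw [← this]
    conv_lhs => rw [hTe]
    rw [Polynomial.taylor_mul, Polynomial.taylor_C, Polynomial.taylor_X_pow]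
  have hcoef : ∀ j, R.coeff j = T.coeff d * ((-z0) ^ (d - j) * d.choose j) := by
    intro j
    rw [hRT, Polynomial.coeff_C_mul, Polynomial.coeff_X_add_C_pow]
  have hTu : T.coeff d = u := by
    have := hcoef d
    rw [hRd] at this; simpa using this.symm
  have h1 := hcoef (d - 1)
  rw [hR _ (by omega), hb, hTu, show d - (d - 1) = 1 by omega, pow_one] at h1
  have hz : z0 = 0 := by
    have h2 : (d.choose (d-1) : ℝ) ≠ 0 := by
      exact_mod_cast (Nat.choose_pos (by omega)).ne'
    have := (mul_eq_zero.1 ((mul_eq_zero.1 h1.symm).resolve_left hu)).resolve_right h2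
    linarith
  obtain ⟨j, hj, hbj⟩ := hj
  apply hbj
  rw [← hR j hj, hcoef, hz, neg_zero, zero_pow (by omega), zero_mul, mul_zero]

end Tay
end QDC

namespace QDC
open Filter Topology Set
open scoped ContDiff Nat

section PA
variable {M : ℕ → ℝ} {ι : Type} {𝒰 : Ultrafilter ι} {m : ℕ}

lemma Ref.lift (hM : IsDCSeq M) {c : ι → (Fin m → ℝ) × ℝ} (h0 : Tendsto c 𝒰 (𝓝 0))
    {c1 : ι → (Fin m → ℝ)} {p : (Fin m → ℝ) → (Fin m → ℝ)} (h : Ref M 𝒰 (fun i => (c i).1) c1 p) :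
    Ref M 𝒰 c (fun i => (c1 i, (c i).2)) (fun z => (p z.1, z.2)) := by
  refine ⟨tend_mk h.tend (tend_snd h0), ?_, by simp [h.zero], ?_⟩
  · exact (DCAt.comp hM (f := p) (g := fun z : (Fin m → ℝ) × ℝ => z.1) (x := 0) h.dc (DCAt.fst hM 0)).prodMk hM (DCAt.snd hM 0)
  · filter_upwards [h.eq] with i hi
    exact Prod.ext hi rfl

lemma Mon.lift (hM : IsDCSeq M) {g : (Fin m → ℝ) → ℝ} (h : Mon M (crd m) g) :
    Mon M (crdP m) (fun z => g z.1) :=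
  Mon.comp hM (DCAt.fst hM 0) rfl (fun i => Mon.coord hM (some i)) h

lemma Mon.y (hM : IsDCSeq M) : Mon M (crdP m) (fun z => z.2) := Mon.coord hM none

/-- The conclusion of the inductive statement. -/
def PAc (M : ℕ → ℝ) (𝒰 : Ultrafilter ι) (m : ℕ) (c : ι → (Fin m → ℝ) × ℝ)
    (f : (Fin m → ℝ) × ℝ → ℝ) (e : (Fin m → ℝ) → ℝ) : Prop :=
  ∃ (c' : ι → (Fin m → ℝ) × ℝ) (p : (Fin m → ℝ) × ℝ → (Fin m → ℝ) × ℝ), Ref M 𝒰 c c' p ∧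
    Mon M (crdP m) (fun z => f (p z) * e (p z).1)

lemma PAc.easy (hM : IsDCSeq M) (hA : AA M 𝒰 m) {c : ι → (Fin m → ℝ) × ℝ} (h0 : Tendsto c 𝒰 (𝓝 0))
    (hc : Mini M 𝒰 (m+1) c) {f u : (Fin m → ℝ) × ℝ → ℝ} {d : ℕ} (hu : DCAt M u 0) (hu0 : u 0 ≠ 0)
    (hf : ∀ᶠ z in 𝓝 0, f z = z.2 ^ d * u z) {e : (Fin m → ℝ) → ℝ} (he : DCAt M e 0)
    (he0 : ¬ ∀ᶠ x in 𝓝 0, e x = 0) : PAc M 𝒰 m c f e := by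
  obtain ⟨c1, p1, hr, hm⟩ := hA _ (tend_fst h0) (hc.fst hM h0) e he he0
  have hr' := hr.lift hM h0
  refine ⟨_, _, hr', ?_⟩
  have := (((Mon.y (m := m) hM).pow hM d).mul hM (Mon.unit (X := crdP m) (hr'.comp hM hu)
    (by rw [hr'.zero]; exact hu0))).mul hM (hm.lift hM)
  refine this.congr ?_
  filter_upwards [hr'.tendsto_p.eventually hf] with z hz
  rw [hz]

lemma PAc.ref (hM : IsDCSeq M) {c c' : ι → (Fin m → ℝ) × ℝ} {f : (Fin m → ℝ) × ℝ → ℝ}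
    {p : (Fin m → ℝ) × ℝ → (Fin m → ℝ) × ℝ} (hr : Ref M 𝒰 c c' p)
    {f' : (Fin m → ℝ) × ℝ → ℝ} {e e' : (Fin m → ℝ) → ℝ} (h : PAc M 𝒰 m c' f' e')
    (he : ∀ᶠ z in 𝓝 0, f (p z) * e (p z).1 = f' z * e' z.1) : PAc M 𝒰 m c f e := by
  obtain ⟨c'', q, hq, hm⟩ := h
  refine ⟨c'', _, hr.trans hM hq, hm.congr ?_⟩
  filter_upwards [hq.tendsto_p.eventually he] with z hz
  exact hz.symm

def PA (M : ℕ → ℝ) (𝒰 : Ultrafilter ι) (m d : ℕ) : Prop :=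
  ∀ c : ι → (Fin m → ℝ) × ℝ, Tendsto c 𝒰 (𝓝 0) → Mini M 𝒰 (m+1) c →
    ∀ f : (Fin m → ℝ) × ℝ → ℝ, DCAt M f 0 → (∀ j < d, (dv (ey m))^[j] f 0 = 0) →
    (dv (ey m))^[d] f 0 ≠ 0 → ∀ e : (Fin m → ℝ) → ℝ, DCAt M e 0 → (¬ ∀ᶠ x in 𝓝 0, e x = 0) →
    PAc M 𝒰 m c f e

lemma PA.of_lt {d : ℕ} (h : ∀ d' < d, PA M 𝒰 m d') {c : ι → (Fin m → ℝ) × ℝ}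
    (h0 : Tendsto c 𝒰 (𝓝 0)) (hc : Mini M 𝒰 (m+1) c) {f : (Fin m → ℝ) × ℝ → ℝ} (hf : DCAt M f 0)
    (hj : ∃ j < d, (dv (ey m))^[j] f 0 ≠ 0) {e : (Fin m → ℝ) → ℝ} (he : DCAt M e 0)
    (he0 : ¬ ∀ᶠ x in 𝓝 0, e x = 0) : PAc M 𝒰 m c f e := by
  classical
  have hj' : ∃ j, (dv (ey m))^[j] f 0 ≠ 0 := by
    obtain ⟨j, _, h⟩ := hj; exact ⟨j, h⟩
  obtain ⟨j, hjd, hj1⟩ := hj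
  refine h (Nat.find hj') (lt_of_le_of_lt (Nat.find_min' hj' hj1) hjd) c h0 hc f hf
    (fun j hj => not_not.1 (Nat.find_min hj' hj)) (Nat.find_spec hj') e he he0

/-- the core case after Tschirnhausen and Taylor -/
lemma PA.core (hM : IsDCSeq M) (hA : AA M 𝒰 m) {d : ℕ} (hd : 0 < d) (ih : ∀ d' < d, PA M 𝒰 m d')
    {c : ι → (Fin m → ℝ) × ℝ} (h0 : Tendsto c 𝒰 (𝓝 0)) (hc : Mini M 𝒰 (m+1) c)
    {f u : (Fin m → ℝ) × ℝ → ℝ} {a : ℕ → (Fin m → ℝ) → ℝ} (ha : ∀ j, DCAt M (a j) 0)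
    (hu : DCAt M u 0) (hu0 : u 0 ≠ 0)
    (hf : ∀ᶠ z in 𝓝 0, f z = ∑ j ∈ Finset.range d, a j z.1 * z.2 ^ j + z.2 ^ d * u z)
    (ha0 : ∀ j < d, a j 0 = 0) (had : ∀ᶠ x in 𝓝 0, a (d - 1) x = 0)
    {e : (Fin m → ℝ) → ℝ} (he : DCAt M e 0)
    (he0 : ¬ ∀ᶠ x in 𝓝 0, e x = 0) : PAc M 𝒰 m c f e := by
  by_cases hz : ∃ j < d, ¬ ∀ᶠ x in 𝓝 0, a j x = 0
  swap
  · push Not at hz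
    refine PAc.easy hM hA h0 hc hu hu0 (d := d) ?_ he he0
    have h1 : ∀ᶠ x in 𝓝 0, ∀ j ∈ Finset.range d, a j x = 0 :=
      (Finset.eventually_all _).2 fun j hj => hz j (Finset.mem_range.1 hj)
    filter_upwards [hf, (continuous_fst.tendsto (0 : (Fin m → ℝ) × ℝ)).eventually h1] with z h2 h3
    rw [h2, Finset.sum_eq_zero, zero_add]
    intro j hj; rw [h3 j hj, zero_mul]
  obtain ⟨c1, p1, γ, b, hr, hγ0, hb, hb0, hme⟩ := prep hM hA (tend_fst h0) (hc.fst hM h0) d a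
    (fun j _ => ha j) ha0 hz e he he0
  have hr1 := hr.lift hM h0
  have hc1 := hc.ref hM hr1
  have h01 := hr1.tend
  set ρ : (Fin m → ℝ) → ℝ := fun x => ∏ i, crd m i x ^ γ i with hρ
  have hρdc : DCAt M ρ 0 := mono_dc hM γ 0
  have hρ0 : ρ 0 = 0 := hγ0
  set u1 : (Fin m → ℝ) × ℝ → ℝ := fun z => u (p1 z.1, z.2) with hu1
  have hu1dc : DCAt M u1 0 := hr1.comp hM hu
  have hu10 : u1 0 ≠ 0 := by
    have : u1 0 = u 0 := by
      exact congrArg u hr1.zero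
    rw [this]; exact hu0
  have hf1 : ∀ᶠ z in 𝓝 0, f (p1 z.1, z.2) =
      ∑ j ∈ Finset.range d, ρ z.1 ^ (d - j) * b j z.1 * z.2 ^ j + z.2 ^ d * u1 z := by
    have h1 : ∀ᶠ x in 𝓝 0, ∀ j ∈ Finset.range d, a j (p1 x) = ρ x ^ (d - j) * b j x :=
      (Finset.eventually_all _).2 fun j hj => (hb j (Finset.mem_range.1 hj)).2.1
    filter_upwards [hr1.tendsto_p.eventually hf,
      (continuous_fst.tendsto (0 : (Fin m → ℝ) × ℝ)).eventually h1] with z h2 h3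
    rw [h2]
    congr 1
    exact Finset.sum_congr rfl fun j hj => by rw [h3 j hj]
  have hρne : ∀ᶠ l in 𝒰, ρ (c1 l) ≠ 0 := by
    have h2 := eventually_all.2 ((hc1.fst hM h01).coord hM (tend_fst h01))
    filter_upwards [h2] with l hl
    exact Finset.prod_ne_zero_iff.2 fun i _ => pow_ne_zero _ (hl i)
  have hFρ : DCAt M (fun z : (Fin m → ℝ) × ℝ => ρ z.1) 0 := DCAt.comp hM (f := ρ) hρdc (DCAt.fst hM 0)
  have hFb : ∀ j < d, DCAt M (fun z : (Fin m → ℝ) × ℝ => b j z.1) 0 := fun j hj =>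
    DCAt.comp hM (f := b j) (hb j hj).1 (DCAt.fst hM 0)
  rcases ultra_lim 𝒰 (fun l => (c l).2 / ρ (c1 l)) with ⟨z0, hlim⟩ | hlim
  · -- finite limit
    have hZ : DCAt M (fun z : (Fin m → ℝ) × ℝ => z0 + z.2) 0 := (DCAt.const hM _ _).add hM (DCAt.snd hM 0)
    let p2 : (Fin m → ℝ) × ℝ → (Fin m → ℝ) × ℝ := fun z => (z.1, ρ z.1 * (z0 + z.2))
    have hr2 : Ref M 𝒰 (fun i => (c1 i, (c i).2)) (fun l => (c1 l, (c l).2 / ρ (c1 l) - z0)) p2 := by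
      refine ⟨tend_mk hr.tend (by simpa using hlim.sub_const z0), ?_, by simp [p2, hρ0], ?_⟩
      · exact (DCAt.fst hM 0).prodMk hM (hFρ.mul hM hZ)
      · filter_upwards [hρne] with l hl
        refine Prod.ext rfl ?_
        simp only [p2]; field_simp; ring
    let g : (Fin m → ℝ) × ℝ → ℝ := fun z => ∑ j ∈ Finset.range d, b j z.1 * (z0 + z.2) ^ j +
      (z0 + z.2) ^ d * u1 (p2 z)
    have hg : DCAt M g 0 := (DCAt.sum hM _ fun j hj => (hFb j (Finset.mem_range.1 hj)).mul hM
      (hZ.pow hM j)).add hM ((hZ.pow hM d).mul hM (hr2.comp hM hu1dc))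
    have hord : ∃ j < d, (dv (ey m))^[j] g 0 ≠ 0 := by
      obtain ⟨j, hj, hj1⟩ := poly_order d (fun j => b j 0) (u1 0) z0 hd
        ((hb (d-1) (by omega)).2.2 had) hu10 hb0
      refine ⟨j, hj, ?_⟩
      have h1 := (dv_line hM hg (ey m) j).self_of_nhds
      simp only [zero_smul] at h1
      rw [← h1]
      have hgt : (fun t : ℝ => g (t • ey m)) = fun t : ℝ => ∑ j ∈ Finset.range d, b j 0 * (z0 + t) ^ j +
          (z0 + t) ^ d * u1 0 := by
        ext t
        have hp2t : p2 (t • ey m) = 0 := by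
          ext <;> simp [p2, ey, hρ0]
        simp only [g, hp2t]
        simp [ey]
      rw [hgt]
      exact hj1
    refine PAc.ref hM (hr1.trans hM hr2) (f' := g) (e' := fun x => ρ x ^ d * e (p1 x))
      (PA.of_lt ih hr2.tend (hc1.ref hM hr2) hg hord ((hρdc.pow hM d).mul hM (hr.comp hM he)) ?_) ?_
    · refine not_zero_of_ev hr.tend ?_
      have h3 := hme.ne_zero hr.tend ((hc1.fst hM h01).coord hM (tend_fst h01))
      filter_upwards [h3, hρne] with l a1 a2
      exact mul_ne_zero (pow_ne_zero _ a2) a1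
    · filter_upwards [hr2.tendsto_p.eventually hf1] with z hz
      rw [hz]
      simp only [p2, g]
      rw [← mul_assoc]
      congr 1
      rw [add_mul, Finset.sum_mul]
      congr 1
      · refine Finset.sum_congr rfl fun j hj => ?_
        have : ρ z.1 ^ d = ρ z.1 ^ (d - j) * ρ z.1 ^ j := by
          rw [← pow_add]; congr 1; have := Finset.mem_range.1 hj; omega
        rw [this, mul_pow]; ring
      · rw [mul_pow]; ring
  · -- infinite limit
    simp only [inv_div] at hlim
    obtain ⟨c2, p2, q, hr2, hm2, hq, hqe⟩ := toric hM _ γ rfl _ h01 hc1 hlim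
    have hq0 : q 0 = 0 := by
      have h1 : Tendsto (fun l => q (c2 l)) 𝒰 (𝓝 (q 0)) := hq.continuousAt.tendsto.comp hr2.tend
      refine tendsto_nhds_unique h1 (hlim.congr' ?_)
      filter_upwards [hr2.tend.eventually hqe, hr2.eq, hc1.snd hM h01] with l a1 a2 a3
      rw [← a2] at a1
      simp only [] at a1 a3
      rw [hρ]
      dsimp only
      rw [a1]; field_simp
    refine ⟨c2, _, hr1.trans hM hr2, ?_⟩
    have hU : DCAt M (fun z => ∑ j ∈ Finset.range d, q z ^ (d - j) * b j (p2 z).1 + u1 (p2 z)) 0 := by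
      refine (DCAt.sum hM _ fun j hj => (hq.pow hM _).mul hM ?_).add hM (hr2.comp hM hu1dc)
      exact hr2.comp hM (hFb j (Finset.mem_range.1 hj))
    have hU0 : (∑ j ∈ Finset.range d, q 0 ^ (d - j) * b j (p2 0).1 + u1 (p2 0)) ≠ 0 := by
      rw [Finset.sum_eq_zero, zero_add, hr2.zero]
      · exact hu10
      · intro j hj
        have := Finset.mem_range.1 hj
        rw [hq0, zero_pow (by omega), zero_mul]
    have hM1 := (((hm2 none).pow hM d).mul hM (Mon.unit (X := crdP m) hU hU0)).mul hM
      (Mon.comp hM hr2.dc hr2.zero hm2 (hme.lift hM))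
    refine hM1.congr ?_
    filter_upwards [hr2.tendsto_p.eventually hf1, hqe] with z h1 h2
    rw [h1]
    congr 1
    have h2' : ρ (p2 z).1 = (p2 z).2 * q z := h2
    have hy : crdP m none (p2 z) = (p2 z).2 := rfl
    rw [hy, mul_add, Finset.mul_sum]
    congr 1
    refine Finset.sum_congr rfl fun j hj => ?_
    have : (p2 z).2 ^ d = (p2 z).2 ^ (d - j) * (p2 z).2 ^ j := by
      rw [← pow_add]; congr 1; have := Finset.mem_range.1 hj; omega
    rw [this, h2', mul_pow]; ring

lemma PA.all (hM : IsDCSeq M) (hA : AA M 𝒰 m) (d : ℕ) : PA M 𝒰 m d := by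
  induction d using Nat.strong_induction_on with
  | _ d ih =>
    intro c h0 hc f hf hlt hd e he he0
    rcases Nat.eq_zero_or_pos d with rfl | hpos
    · exact PAc.easy hM hA h0 hc hf (by simpa using hd) (d := 0) (by simp) he he0
    obtain ⟨b, hb, hb0, hbe⟩ := tschirn hM (hf.dv_iter hM (ey m) (d-1)) (hlt (d-1) (by omega))
      (by
        have : dv (ey m) ((dv (ey m))^[d-1] f) = (dv (ey m))^[d] f := by
          rw [← Function.iterate_succ_apply' (dv (ey m)), Nat.succ_eq_add_one, Nat.sub_add_cancel hpos]
        rw [this]; exact hd)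
    have hFb : DCAt M (fun z : (Fin m → ℝ) × ℝ => b z.1) 0 := DCAt.comp hM (f := b) hb (DCAt.fst hM 0)
    let p : (Fin m → ℝ) × ℝ → (Fin m → ℝ) × ℝ := fun z => (z.1, z.2 + b z.1)
    have hr : Ref M 𝒰 c (fun l => ((c l).1, (c l).2 - b (c l).1)) p := by
      refine ⟨tend_mk (tend_fst h0) ?_, (DCAt.fst hM 0).prodMk hM ((DCAt.snd hM 0).add hM hFb),
        by simp [p, hb0], ?_⟩
      · have h1 : Tendsto (fun l => b (c l).1) 𝒰 (𝓝 (b 0)) := hb.continuousAt.tendsto.comp (tend_fst h0)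
        rw [hb0] at h1
        simpa using (tend_snd h0).sub h1
      · exact Eventually.of_forall fun l => by simp [p]
    have hF : DCAt M (fun z => f (p z)) 0 := hr.comp hM hf
    have hder : ∀ k, (dv (ey m))^[k] (fun z => f (p z)) =ᶠ[𝓝 0] fun z => (dv (ey m))^[k] f (p z) := by
      intro k
      refine dv_comp hM hr.dc (by rw [hr.zero]; exact hf) (ey m) (ey m) ?_ k
      have hbE : ∀ᶠ z : (Fin m → ℝ) × ℝ in 𝓝 0, DCAt M b z.1 :=
        (continuous_fst.tendsto (0 : (Fin m → ℝ) × ℝ)).eventually hb.eventually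
      filter_upwards [hbE] with z hz
      have h1 : HasFDerivAt (fun z : (Fin m → ℝ) × ℝ => b z.1)
        ((fderiv ℝ b z.1).comp (ContinuousLinearMap.fst ℝ _ _)) z :=
        HasFDerivAt.comp z (hz.differentiableAt.hasFDerivAt) hasFDerivAt_fst
      have h2 : HasFDerivAt p _ z := hasFDerivAt_fst.prodMk (hasFDerivAt_snd.add h1)
      rw [h2.fderiv]
      simp [ey]
    have hp0 : p 0 = 0 := hr.zero
    have hder0 : ∀ k, (dv (ey m))^[k] (fun z => f (p z)) 0 = (dv (ey m))^[k] f 0 := by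
      intro k
      rw [(hder k).self_of_nhds]; dsimp only; rw [hp0]
    obtain ⟨a, u, ha, hu, h1, h2, h3⟩ := taylor hM d hF
    refine PAc.ref hM hr (f' := fun z => f (p z)) (e' := e) ?_ (Eventually.of_forall fun z => rfl)
    refine PA.core hM hA hpos ih hr.tend (hc.ref hM hr) ha hu ?_ h1 ?_ ?_ he he0
    · intro hu0
      have := h3.self_of_nhds
      rw [show ((0 : Fin m → ℝ), (0:ℝ)) = 0 from rfl, hu0, mul_zero, hder0] at this
      exact hd this
    · intro j hj
      have := (h2 j hj).self_of_nhds
      rw [show ((0 : Fin m → ℝ), (0:ℝ)) = 0 from rfl, hder0, hlt j hj] at this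
      exact (mul_eq_zero.1 this.symm).resolve_left (by positivity)
    · filter_upwards [h2 (d-1) (by omega), ev_mk0 (hder (d-1)), hbe] with x x1 x2 x3
      rw [x2] at x1
      simp only [p, zero_add] at x1
      rw [x3] at x1
      exact (mul_eq_zero.1 x1.symm).resolve_left (by positivity)

end PA
end QDC

namespace QDC
open Filter Topology Set
open scoped ContDiff Nat

section AAall
variable {M : ℕ → ℝ} {ι : Type} {𝒰 : Ultrafilter ι} {m : ℕ}

lemma AA.unit_case (hM : IsDCSeq M) {c : ι → (Fin m → ℝ)} (h0 : Tendsto c 𝒰 (𝓝 0))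
    {f : (Fin m → ℝ) → ℝ} (hf : DCAt M f 0) (hf0 : f 0 ≠ 0) :
    ∃ (c' : ι → (Fin m → ℝ)) (p : (Fin m → ℝ) → (Fin m → ℝ)),
      Ref M 𝒰 c c' p ∧ Mon M (crd m) (fun x => f (p x)) :=
  ⟨c, _, Ref.refl hM h0, Mon.unit hf hf0⟩

lemma exists_dir (hM : IsDCSeq M) {E : Type} [NormedAddCommGroup E] [NormedSpace ℝ E] {f : E → ℝ}
    (hf : DCAt M f 0) (h : ¬ ∀ᶠ x in 𝓝 0, f x = 0) : ∃ v j, (dv v)^[j] f 0 ≠ 0 := by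
  by_contra hcon
  push Not at hcon
  apply h
  obtain ⟨r, hr, hb⟩ := Metric.eventually_nhds_iff.1 hf.eventually
  refine Metric.eventually_nhds_iff.2 ⟨r, hr, fun v hv => ?_⟩
  have := identity_seg hM (f := f) (x := 0) (v := v) (fun t ht => hb (by
    rw [zero_add, dist_zero_right, norm_smul, Real.norm_eq_abs, abs_of_nonneg ht.1]
    rw [dist_zero_right] at hv
    exact lt_of_le_of_lt (mul_le_of_le_one_left (norm_nonneg _) ht.2) hv)) (hcon v)
  simpa using this

noncomputable def insL (i : Fin (m+1)) : (Fin m → ℝ) →L[ℝ] (Fin (m+1) → ℝ) :=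
  ContinuousLinearMap.pi (i.insertNth (α := fun _ => (Fin m → ℝ) →L[ℝ] ℝ) 0
    (fun l => ContinuousLinearMap.proj l))

lemma insL_self (i : Fin (m+1)) (x : Fin m → ℝ) : insL i x i = 0 := by
  simp [insL]

lemma insL_succ (i : Fin (m+1)) (x : Fin m → ℝ) (l : Fin m) : insL i x (i.succAbove l) = x l := by
  simp [insL]

lemma AA.succ (hM : IsDCSeq M) (hA : AA M 𝒰 m) : AA M 𝒰 (m+1) := by
  intro c h0 hc f hf hf0
  by_cases hf00 : f 0 ≠ 0
  · exact AA.unit_case hM h0 hf hf00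
  push Not at hf00
  obtain ⟨v, j, hj⟩ := exists_dir hM hf hf0
  have hv : v ≠ 0 := by
    rintro rfl
    cases j with
    | zero => exact hj hf00
    | succ j => rw [Function.iterate_succ_apply'] at hj; simp [dv] at hj
  obtain ⟨i, hi⟩ := Function.ne_iff.1 hv
  simp only [Pi.zero_apply] at hi
  let L : (Fin m → ℝ) × ℝ →L[ℝ] (Fin (m+1) → ℝ) :=
    (ContinuousLinearMap.snd ℝ (Fin m → ℝ) ℝ).smulRight v +
      (insL i).comp (ContinuousLinearMap.fst ℝ (Fin m → ℝ) ℝ)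
  have hL : ∀ z, L z = z.2 • v + insL i z.1 := fun z => rfl
  have hr : Ref M 𝒰 c (fun l => ((fun k => c l (i.succAbove k) - c l i / v i * v (i.succAbove k)),
      c l i / v i)) L := by
    have ht := tendsto_pi_nhds.1 h0
    have hy : Tendsto (fun l => c l i / v i) 𝒰 (𝓝 0) := by simpa using (ht i).div_const (v i)
    refine ⟨tend_mk ?_ hy, DCAt.clm hM L 0, by simp, Eventually.of_forall fun l => ?_⟩
    · rw [tendsto_pi_nhds]
      intro k
      simpa using (ht (i.succAbove k)).sub (hy.mul_const (v (i.succAbove k)))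
    · ext k
      rw [hL]
      refine Fin.succAboveCases i ?_ (fun k => ?_) k
      · simp [insL_self, hi]
      · simp [insL_succ]
  have hder : (dv (ey m))^[j] (fun z => f (L z)) 0 = (dv v)^[j] f 0 := by
    have := (dv_comp hM (DCAt.clm hM L 0) (by rw [map_zero]; exact hf) (ey m) v
      (Eventually.of_forall fun z => by rw [L.fderiv, hL]; simp [ey]) j).self_of_nhds
    rw [this]; dsimp only; rw [map_zero]
  obtain ⟨c2, p, hr2, hm⟩ := PA.of_lt (d := j+1) (fun d _ => PA.all hM hA d) hr.tend (hc.ref hM hr)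
    (hr.comp hM hf) ⟨j, by omega, by rw [hder]; exact hj⟩ (e := fun _ => 1) (DCAt.const hM _ _)
    (by simp [nhds_neBot.ne])
  let T : (Fin (m+1) → ℝ) → (Fin m → ℝ) × ℝ := fun w => (fun k => w k.succ, w 0)
  have hr3 : Ref M 𝒰 c2 (fun l => (Fin.cons (c2 l).2 (c2 l).1 : Fin (m+1) → ℝ)) T := by
    refine ⟨?_, ?_, rfl, Eventually.of_forall fun l => ?_⟩
    · rw [tendsto_pi_nhds]
      intro k
      refine Fin.cases ?_ (fun l => ?_) k
      · simpa using tend_snd hr2.tend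
      · simpa using (tendsto_pi_nhds.1 (tend_fst hr2.tend)) l
    · exact (DCAt.pi hM fun k => crd_dc hM _ _).prodMk hM (crd_dc hM 0 _)
    · ext <;> simp [T]
  refine ⟨_, _, (hr.trans hM hr2).trans hM hr3, ?_⟩
  have := Mon.comp hM (X' := crd (m+1)) hr3.dc hr3.zero (fun o => by
    rcases o with _ | k
    · exact Mon.coord hM 0
    · exact Mon.coord hM k.succ) hm
  simpa using this

lemma AA.all (hM : IsDCSeq M) (m : ℕ) : AA M 𝒰 m := by
  induction m with
  | zero =>
    intro c h0 hc f hf hf0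
    refine AA.unit_case hM h0 hf fun h => hf0 (Eventually.of_forall fun x => ?_)
    rw [Subsingleton.elim x 0, h]
  | succ m ih => exact AA.succ hM ih

end AAall
end QDC

namespace QDC
open Filter Topology Set
open scoped ContDiff Nat

section Noeth
variable {M : ℕ → ℝ} {n : ℕ}

lemma noeth_seq (hM : IsDCSeq M) {O K : Set (Fin n → ℝ)} (hO : IsOpen O) (hK : IsCompact K) (hKO : K ⊆ O)
    (f : ℕ → (Fin n → ℝ) → ℝ) (hf : ∀ k, ∀ x ∈ O, DCAt M (f k) x) (b : ℕ → Fin n → ℝ)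
    (hb : ∀ k, b k ∈ K) (h0 : ∀ i k, i < k → f i (b k) = 0) (h1 : ∀ k, f k (b k) ≠ 0) : False := by
  classical
  let 𝒰 : Ultrafilter ℕ := Filter.hyperfilter ℕ
  have hev : ∀ i : ℕ, ∀ᶠ k : ℕ in (𝒰 : Filter ℕ), i < k := fun i => by
    have : ∀ᶠ k : ℕ in atTop, i < k := eventually_gt_atTop i
    exact (Nat.hyperfilter_le_atTop) this
  obtain ⟨a, haK, ha⟩ := hK.ultrafilter_le_nhds' (𝒰.map b)
    (Ultrafilter.mem_map.2 (Filter.univ_mem' hb))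
  have ht : Tendsto b 𝒰 (𝓝 a) := ha
  have ht0 : Tendsto (fun k => b k - a) 𝒰 (𝓝 0) := by
    simpa using ht.sub_const a
  have hex : ∃ m, ∃ (c : ℕ → Fin m → ℝ) (p : (Fin m → ℝ) → (Fin n → ℝ)),
      Ref M 𝒰 (fun k => b k - a) c p := ⟨n, _, _, Ref.refl hM ht0⟩
  obtain ⟨c, p, hr⟩ := Nat.find_spec hex
  have hmin : Mini M 𝒰 (Nat.find hex) (fun k => b k - a) := fun m' hm' c' p' h =>
    Nat.find_min hex hm' ⟨c', p', h⟩
  have hminc := hmin.ref hM hr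
  have hA : Tendsto (fun z => a + p z) (𝓝 0) (𝓝 a) := by
    simpa using hr.tendsto_p.const_add a
  obtain ⟨ε, hε, hball⟩ := Metric.eventually_nhds_iff_ball.1
    (hr.dc.eventually.and (hA.eventually (hO.mem_nhds (hKO haK))))
  have hdc : ∀ i, ∀ z ∈ Metric.ball (0 : Fin (Nat.find hex) → ℝ) ε, DCAt M (fun z => f i (a + p z)) z := by
    intro i z hz
    exact DCAt.comp hM (hf i _ (hball z hz).2) ((DCAt.const hM a z).add hM (hball z hz).1)
  have hz : ∀ i, ∀ z ∈ Metric.ball (0 : Fin (Nat.find hex) → ℝ) ε, f i (a + p z) = 0 := by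
    intro i
    refine identity_convex hM (convex_ball _ _) (hdc i) (Metric.mem_ball_self hε) ?_
    by_contra hcon
    have := AA.ne_zero hM (AA.all hM _) hr.tend hminc (hdc i 0 (Metric.mem_ball_self hε)) hcon
    obtain ⟨k, hk1, hk2, hk3⟩ := (this.and (hr.eq.and (hev i))).exists
    apply hk1
    rw [← hk2]
    simpa using h0 i k hk3
  obtain ⟨k, hk1, hk2⟩ := (hr.eq.and (hr.tend.eventually (Metric.ball_mem_nhds 0 hε))).exists
  apply h1 k
  have := hz k _ hk2
  rw [← hk1] at this
  simpa using this

/-- Zariski closed subsets of `V` w.r.t. functions on `O`. -/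
def ZC (M : ℕ → ℝ) (O V Y : Set (Fin n → ℝ)) : Prop :=
  Y ⊆ V ∧ ∀ x ∈ V, (∀ f : (Fin n → ℝ) → ℝ, (∀ z ∈ O, DCAt M f z) → (∀ y ∈ Y, f y = 0) → f x = 0) → x ∈ Y

lemma ZC.wf (hM : IsDCSeq M) {O K V : Set (Fin n → ℝ)} (hO : IsOpen O) (hK : IsCompact K) (hKO : K ⊆ O)
    (hVK : V ⊆ K) : WellFounded (fun A B : {Y // ZC M O V Y} => A.1 ⊂ B.1) := by
  rw [wellFounded_iff_isEmpty_descending_chain]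
  refine ⟨fun ⟨Y, hY⟩ => ?_⟩
  have hs : ∀ k, ∃ (b : Fin n → ℝ) (f : (Fin n → ℝ) → ℝ), b ∈ (Y k).1 ∧ (∀ z ∈ O, DCAt M f z) ∧ (∀ y ∈ (Y (k+1)).1, f y = 0) ∧ f b ≠ 0 := by
    intro k
    obtain ⟨b, hb, hb'⟩ := exists_of_ssubset (hY k)
    by_contra hcon
    push Not at hcon
    exact hb' ((Y (k+1)).2.2 b ((Y k).2.1 hb) fun f hf hf0 => hcon b f hb hf hf0)
  choose b f hb hf hf0 hfb using hs
  have hanti : Antitone fun k => (Y k).1 := antitone_nat_of_succ_le fun k => (hY k).1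
  exact noeth_seq hM hO hK hKO f hf b (fun k => hVK ((Y k).2.1 (hb k)))
    (fun i k hik => hf0 i _ (hanti (Nat.succ_le_of_lt hik) (hb k))) hfb

lemma ZC.zeros {O V : Set (Fin n → ℝ)} (G : Set ((Fin n → ℝ) → ℝ)) (hG : ∀ f ∈ G, ∀ z ∈ O, DCAt M f z) :
    ZC M O V {x ∈ V | ∀ f ∈ G, f x = 0} :=
  ⟨fun _ hx => hx.1, fun _ hx h => ⟨hx, fun f hf => h f (hG f hf) fun _ hy => hy.2 f hf⟩⟩

lemma ZC.inter {O V Y : Set (Fin n → ℝ)} (hY : ZC M O V Y) {H : (Fin n → ℝ) → ℝ} (hH : ∀ z ∈ O, DCAt M H z) :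
    ZC M O V {x ∈ Y | H x = 0} :=
  ⟨fun _ hx => hY.1 hx.1, fun x hx h => ⟨hY.2 x hx fun f hf hf0 => h f hf fun y hy => hf0 y hy.1,
    h H hH fun _ hy => hy.2⟩⟩

lemma ZC.fin (hM : IsDCSeq M) {O K V Y : Set (Fin n → ℝ)} (hO : IsOpen O) (hK : IsCompact K) (hKO : K ⊆ O)
    (hVK : V ⊆ K) (hY : ZC M O V Y) : ∃ s : Finset ((Fin n → ℝ) → ℝ),
      (∀ f ∈ s, ∀ z ∈ O, DCAt M f z) ∧ Y = {x ∈ V | ∀ f ∈ s, f x = 0} := by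
  classical
  let 𝒮 : Set {Y // ZC M O V Y} := {Z | ∃ s : Finset ((Fin n → ℝ) → ℝ),
    (∀ f ∈ s, ∀ z ∈ O, DCAt M f z) ∧ (∀ f ∈ s, ∀ y ∈ Y, f y = 0) ∧ Z.1 = {x ∈ V | ∀ f ∈ s, f x = 0}}
  have hne : 𝒮.Nonempty := ⟨⟨{x ∈ V | ∀ f ∈ ((∅ : Finset ((Fin n → ℝ) → ℝ)) : Set ((Fin n → ℝ) → ℝ)), f x = 0},
    ZC.zeros _ (by simp)⟩, ∅, by simp, by simp, by simp⟩
  obtain ⟨Z, ⟨s, hs, hs0, hZ⟩, hmin⟩ := (ZC.wf hM hO hK hKO hVK).has_min 𝒮 hne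
  refine ⟨s, hs, subset_antisymm (fun y hy => ⟨hY.1 hy, fun f hf => hs0 f hf y hy⟩) fun x hx => ?_⟩
  refine hY.2 x hx.1 fun f hf hf0 => ?_
  by_contra hfx
  refine hmin ⟨_, ZC.zeros (M := M) (O := O) (V := V) ((insert f s : Finset _) : Set ((Fin n → ℝ) → ℝ)) ?_⟩
    ⟨insert f s, ?_, ?_, rfl⟩ ?_
  · intro g hg
    rcases Finset.mem_insert.1 (Finset.mem_coe.1 hg) with rfl | h
    exacts [hf, hs g h]
  · intro g hg
    rcases Finset.mem_insert.1 hg with rfl | h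
    exacts [hf, hs g h]
  · intro g hg
    rcases Finset.mem_insert.1 hg with rfl | h
    exacts [hf0, hs0 g h]
  · rw [hZ]
    refine ⟨fun y hy => ⟨hy.1, fun g hg => hy.2 g (by simp [hg])⟩, fun hsub => hfx ?_⟩
    exact (hsub hx).2 f (by simp)

lemma ZC.closed (hM : IsDCSeq M) {O K V Y : Set (Fin n → ℝ)} (hO : IsOpen O) (hK : IsCompact K) (hKO : K ⊆ O)
    (hVK : V ⊆ K) (hV : IsOpen V) (hY : ZC M O V Y) : IsQMClosed M V Y := by
  obtain ⟨s, hs, hYs⟩ := hY.fin hM hO hK hKO hVK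
  refine ⟨hY.1, fun x hx => hY.2 x hx.2 fun f hf hf0 => ?_, fun b hb => ⟨V, hV, hY.1 hb, subset_rfl, s.card,
    fun i => (s.equivFin.symm i).1, fun i => memDC_of_DCAt hM fun x hx =>
      hs _ (s.equivFin.symm i).2 x (hKO (hVK hx)), ?_⟩⟩
  · have hc : ContinuousAt f x := (hf x (hKO (hVK hx.2))).continuousAt
    have h1 := mem_closure_iff_clusterPt.1 hx.1
    have : (𝓝[Y] x).NeBot := mem_closure_iff_nhdsWithin_neBot.1 hx.1
    refine tendsto_nhds_unique (hc.tendsto.mono_left (nhdsWithin_le_nhds (s := Y)))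
      (tendsto_const_nhds.congr' ?_)
    filter_upwards [self_mem_nhdsWithin] with y hy
    exact (hf0 y hy).symm
  · rw [inter_eq_left.2 hY.1, hYs]
    ext x
    refine and_congr_right fun _ => ⟨fun h i => h _ (s.equivFin.symm i).2, fun h f hf => ?_⟩
    simpa using h (s.equivFin ⟨f, hf⟩)

end Noeth
end QDC

namespace QDC
open Filter Topology Set
open scoped ContDiff Nat

section Smooth
variable {M : ℕ → ℝ} {n : ℕ}

noncomputable def jac (g : Fin n → (Fin n → ℝ) → ℝ) (x : Fin n → ℝ) : Matrix (Fin n) (Fin n) ℝ :=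
  Matrix.of fun k l => dv (Pi.single l 1) (g k) x

lemma jac_dc (hM : IsDCSeq M) {g : Fin n → (Fin n → ℝ) → ℝ} {x : Fin n → ℝ} (hg : ∀ k, DCAt M (g k) x) :
    DCAt M (fun x => (jac g x).det) x := by
  simp only [Matrix.det_apply']
  exact DCAt.sum hM _ fun s _ => (DCAt.const hM _ x).mul hM (DCAt.prod hM _ fun k _ => (hg _).dv hM _)

lemma clm_eq_sum (L : (Fin n → ℝ) →L[ℝ] ℝ) (w : Fin n → ℝ) : L w = ∑ l, w l * L (Pi.single l 1) := by
  conv_lhs => rw [pi_eq_sum_univ' w]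
  simp

lemma fderiv_Phi {g : Fin n → (Fin n → ℝ) → ℝ} {x : Fin n → ℝ}
    (hg : ∀ k, DifferentiableAt ℝ (g k) x) :
    HasFDerivAt (fun x k => g k x) (ContinuousLinearMap.pi fun k => fderiv ℝ (g k) x) x :=
  hasFDerivAt_pi.2 fun k => (hg k).hasFDerivAt

lemma jac_unit {g : Fin n → (Fin n → ℝ) → ℝ} {x : Fin n → ℝ}
    (hg : ∀ k, DifferentiableAt ℝ (g k) x) (h : (jac g x).det ≠ 0) :
    IsUnit (fderiv ℝ (fun x k => g k x) x) := by
  rw [(fderiv_Phi hg).fderiv, ContinuousLinearMap.isUnit_iff_bijective]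
  set L : (Fin n → ℝ) →L[ℝ] (Fin n → ℝ) := ContinuousLinearMap.pi fun k => fderiv ℝ (g k) x with hL
  have hinj : Function.Injective (L : (Fin n → ℝ) →ₗ[ℝ] (Fin n → ℝ)) := by
    rw [injective_iff_map_eq_zero]
    intro w hw
    refine Matrix.eq_zero_of_mulVec_eq_zero h ?_
    ext k
    have := congrFun hw k
    simp only [hL, ContinuousLinearMap.coe_coe, ContinuousLinearMap.coe_pi'] at this
    rw [clm_eq_sum] at this
    simp only [Matrix.mulVec, dotProduct, jac, Matrix.of_apply, dv]
    refine Eq.trans ?_ this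
    exact Finset.sum_congr rfl fun l _ => mul_comm _ _
  exact ⟨hinj, LinearMap.injective_iff_surjective.1 hinj⟩

lemma jac_update (g : Fin n → (Fin n → ℝ) → ℝ) (i : Fin n) (f : (Fin n → ℝ) → ℝ) (x : Fin n → ℝ) :
    jac (Function.update g i f) x = (jac g x).updateRow i (fun l => dv (Pi.single l 1) f x) := by
  ext k l
  by_cases h : k = i
  · subst h; simp [jac]
  · simp [jac, h]

lemma cramer {g : Fin n → (Fin n → ℝ) → ℝ} {x : Fin n → ℝ} {f : (Fin n → ℝ) → ℝ}
    {Q : (Fin n → ℝ) → (Fin n → ℝ)}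
    (hg : ∀ k, DifferentiableAt ℝ (g k) x) (hf : DifferentiableAt ℝ f x)
    (hQ : DifferentiableAt ℝ Q (fun k => g k x)) (hQx : ∀ᶠ z in 𝓝 x, Q (fun k => g k z) = z) (i : Fin n) :
    (jac (Function.update g i f) x).det
      = dv (Pi.single i 1) (fun y => f (Q y)) (fun k => g k x) * (jac g x).det := by
  set w : Fin n → ℝ := fun k => dv (Pi.single k 1) (fun y => f (Q y)) (fun k => g k x) with hw
  have hxx : Q (fun k => g k x) = x := hQx.self_of_nhds
  have hfQ : DifferentiableAt ℝ (fun y => f (Q y)) (fun k => g k x) :=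
    DifferentiableAt.comp (g := f) _ (by rw [hxx]; exact hf) hQ
  have h1 : fderiv ℝ f x = (fderiv ℝ (fun y => f (Q y)) (fun k => g k x)).comp
      (ContinuousLinearMap.pi fun k => fderiv ℝ (g k) x) := by
    have h2 : f =ᶠ[𝓝 x] fun z => f (Q (fun k => g k z)) := by
      filter_upwards [hQx] with z hz
      rw [hz]
    rw [h2.fderiv_eq]
    exact (HasFDerivAt.comp (g := fun y => f (Q y)) x hfQ.hasFDerivAt (fderiv_Phi hg)).fderiv
  have h3 : (fun l => dv (Pi.single l 1) f x) = ∑ k, w k • (jac g x) k := by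
    ext l
    simp only [dv, h1, ContinuousLinearMap.comp_apply]
    rw [clm_eq_sum]
    simp [hw, jac, dv, mul_comm]
  rw [jac_update, h3, Matrix.det_updateRow_sum, smul_eq_mul]

/-- the derivation `D_v`. -/
noncomputable def Dd (g : Fin n → (Fin n → ℝ) → ℝ) (v : Fin n → ℝ) (f : (Fin n → ℝ) → ℝ) : (Fin n → ℝ) → ℝ :=
  fun x => ∑ i, v i * (jac (Function.update g i f) x).det

lemma Dd_dc (hM : IsDCSeq M) {g : Fin n → (Fin n → ℝ) → ℝ} {x v : Fin n → ℝ} {f : (Fin n → ℝ) → ℝ}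
    (hg : ∀ k, DCAt M (g k) x) (hf : DCAt M f x) : DCAt M (Dd g v f) x := by
  refine DCAt.sum hM _ fun i _ => (DCAt.const hM _ x).mul hM (jac_dc hM fun k => ?_)
  by_cases h : k = i
  · subst h; simpa using hf
  · simpa [h] using hg k

lemma Dd_eq {g : Fin n → (Fin n → ℝ) → ℝ} {x : Fin n → ℝ} {f : (Fin n → ℝ) → ℝ}
    {Q : (Fin n → ℝ) → (Fin n → ℝ)}
    (hg : ∀ k, DifferentiableAt ℝ (g k) x) (hf : DifferentiableAt ℝ f x)
    (hQ : DifferentiableAt ℝ Q (fun k => g k x)) (hQx : ∀ᶠ z in 𝓝 x, Q (fun k => g k z) = z) (v : Fin n → ℝ) :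
    Dd g v f x = dv v (fun y => f (Q y)) (fun k => g k x) * (jac g x).det := by
  simp only [Dd, cramer hg hf hQ hQx]
  conv_rhs => rw [dv, clm_eq_sum]
  rw [Finset.sum_mul]
  exact Finset.sum_congr rfl fun i _ => by rw [dv]; ring

lemma flat_aux (hM : IsDCSeq M) {O B : Set (Fin n → ℝ)} {g : Fin n → (Fin n → ℝ) → ℝ} {Q : (Fin n → ℝ) → (Fin n → ℝ)}
    (P : ((Fin n → ℝ) → ℝ) → Prop) (hB : IsOpen B) (hg : ∀ k, ∀ x ∈ O, DCAt M (g k) x)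
    (hQO : ∀ y ∈ B, Q y ∈ O) (hQ : ∀ y ∈ B, DCAt M Q y) (hPQ : ∀ y ∈ B, (fun k => g k (Q y)) = y)
    (hQP : ∀ y ∈ B, ∀ᶠ z in 𝓝 (Q y), Q (fun k => g k z) = z)
    (v : Fin n → ℝ) (hPd : ∀ f, P f → ∀ x ∈ O, DCAt M f x)
    (hPD : ∀ f, P f → P (Dd g v f))
    (hPs : ∀ f f', P f → P f' → P (fun x => f x - f' x))
    (hPm : ∀ f q, P f → (∀ x ∈ O, DCAt M q x) → P (fun x => q x * f x))
    {f : (Fin n → ℝ) → ℝ} (hf : P f) (j : ℕ) :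
    ∃ f' N, P f' ∧ ∀ y ∈ B, (dv v)^[j] (fun y => f (Q y)) y * (jac g (Q y)).det ^ N = f' (Q y) := by
  induction j with
  | zero => exact ⟨f, 0, hf, fun y _ => by simp⟩
  | succ j ih =>
    obtain ⟨f', N, hf', h⟩ := ih
    set δ : (Fin n → ℝ) → ℝ := fun x => (jac g x).det with hδ
    have hδdc : ∀ x ∈ O, DCAt M δ x := fun x hx => jac_dc hM fun k => hg k x hx
    refine ⟨fun x => δ x * Dd g v f' x - (N * Dd g v δ x) * f' x, N + 2,
      hPs _ _ (hPm _ _ (hPD _ hf') hδdc) (hPm _ _ hf' fun x hx => (DCAt.const hM _ x).mul hM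
        (Dd_dc hM (fun k => hg k x hx) (hδdc x hx))), fun y hy => ?_⟩
    rw [Function.iterate_succ_apply']
    set G := (dv v)^[j] (fun y => f (Q y)) with hG
    have hO := hQO y hy
    have hGd : DifferentiableAt ℝ G y :=
      (DCAt.dv_iter hM (DCAt.comp hM (hPd f hf _ hO) (hQ y hy)) v j).differentiableAt
    have hδQ : DifferentiableAt ℝ (fun y => δ (Q y)) y :=
      (DCAt.comp hM (hδdc _ hO) (hQ y hy)).differentiableAt
    have key : ∀ q : (Fin n → ℝ) → ℝ, DCAt M q (Q y) → Dd g v q (Q y) = dv v (fun y => q (Q y)) y * δ (Q y) := by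
      intro q hq
      have := Dd_eq (Q := Q) (x := Q y) (g := g) (f := q) (fun k => (hg k _ hO).differentiableAt)
        hq.differentiableAt (by rw [hPQ y hy]; exact (hQ y hy).differentiableAt) (hQP y hy) v
      rwa [hPQ y hy] at this
    have k1 := key f' (hPd _ hf' _ hO)
    have k2 := key δ (hδdc _ hO)
    have hev : (fun y => G y * δ (Q y) ^ N) =ᶠ[𝓝 y] fun y => f' (Q y) := by
      filter_upwards [hB.mem_nhds hy] with z hz
      exact h z hz
    have hd : dv v (fun y => f' (Q y)) y
        = dv v G y * δ (Q y) ^ N + G y * (N * δ (Q y) ^ (N-1) * dv v (fun y => δ (Q y)) y) := by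
      rw [dv, ← hev.fderiv_eq]
      have := (hGd.hasFDerivAt.mul (hδQ.hasFDerivAt.pow N))
      have e := this.fderiv
      rw [show (fun y => G y * δ (Q y) ^ N) = G * (fun y => δ (Q y) ^ N) from rfl]
      rw [e]
      simp [dv]
      ring
    have hN : (N:ℝ) * δ (Q y) ^ (N-1) * δ (Q y) = N * δ (Q y) ^ N := by
      rcases N with _ | N
      · simp
      · simp [pow_succ]; ring
    have hy' := h y hy
    show dv v G y * δ (Q y) ^ (N+2) = δ (Q y) * Dd g v f' (Q y) - (N * Dd g v δ (Q y)) * f' (Q y)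
    rw [k1, k2, hd, ← hy']
    linear_combination (-G y * dv v (fun y => δ (Q y)) y * δ (Q y)) * hN

end Smooth
end QDC

namespace QDC
open Filter Topology Set
open scoped ContDiff Nat

section Step
variable {M : ℕ → ℝ} {n : ℕ}

lemma smooth_at (hM : IsDCSeq M) {O V Y : Set (Fin n → ℝ)} (hO : IsOpen O) (hVO : V ⊆ O) (hV : IsOpen V)
    (hY : ZC M O V Y) {J : Finset (Fin n)} {g : Fin n → (Fin n → ℝ) → ℝ} {H : (Fin n → ℝ) → ℝ}
    (hg : ∀ k, ∀ x ∈ O, DCAt M (g k) x) (hH : ∀ x ∈ O, DCAt M H x)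
    (hgJ : ∀ k ∉ J, g k = fun x => x k) (hgY : ∀ k ∈ J, ∀ y ∈ Y, H y ≠ 0 → g k y = 0)
    (hδ : ∀ y, H y ≠ 0 → (jac g y).det ≠ 0)
    (hD : ∀ i ∉ J, ∀ f : (Fin n → ℝ) → ℝ, (∀ x ∈ O, DCAt M f x) → (∀ y ∈ Y, H y ≠ 0 → f y = 0) →
      ∀ y ∈ Y, H y ≠ 0 → (jac (Function.update g i f) y).det = 0)
    {b : Fin n → ℝ} (hb : b ∈ Y) (hHb : H b ≠ 0) : QMSmoothPt M Y b := by
  classical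
  have hbO : b ∈ O := hVO (hY.1 hb)
  set Φ : (Fin n → ℝ) → (Fin n → ℝ) := fun x k => g k x with hΦ
  have hΦdc : DCAt M Φ b := DCAt.pi hM fun k => hg k b hbO
  obtain ⟨Q, hQb, hQdc, hPQ, hQP⟩ := DCAt.inverse_fun hM hΦdc
    (jac_unit (fun k => (hg k b hbO).differentiableAt) (hδ b hHb))
  have hQc : Tendsto Q (𝓝 (Φ b)) (𝓝 b) := by simpa [ContinuousAt, hQb] using hQdc.continuousAt
  have hHne : ∀ᶠ x in 𝓝 b, H x ≠ 0 := (hH b hbO).continuousAt.eventually_ne hHb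
  obtain ⟨ε, hε, hball⟩ := Metric.eventually_nhds_iff_ball.1
    (hQdc.eventually.and (hPQ.and ((hQc.eventually (hO.mem_nhds hbO)).and
      (hQc.eventually hQP.eventually_nhds))))
  set I : Finset (Fin n) := Finset.univ \ J with hI
  have memI : ∀ k, k ∈ I ↔ k ∉ J := fun k => by simp [hI]
  let ext : ({i // i ∈ I} → ℝ) → (Fin n → ℝ) := fun u k => if h : k ∈ I then u ⟨k, h⟩ else 0
  have hextdc : ∀ u, DCAt M ext u := fun u => DCAt.pi hM fun k => by
    by_cases h : k ∈ I
    · simp only [ext, h, dif_pos]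
      exact DCAt.apply hM (DCAt.id hM u) _
    · simp only [ext, h, dif_neg, not_false_iff]
      exact DCAt.const hM _ _
  have hextc : Continuous ext := continuous_iff_continuousAt.2 fun u => (hextdc u).continuousAt
  have hΦext : ∀ y ∈ Y, H y ≠ 0 → Φ y = ext (fun i : {i // i ∈ I} => y i) := by
    intro y hy hHy
    ext k
    by_cases h : k ∈ I
    · simp [ext, h, hΦ, hgJ k ((memI k).1 h)]
    · simp [ext, h, hΦ, hgY k (by simpa [memI] using h) y hy hHy]
  have hev : ∀ᶠ x in 𝓝 b, x ∈ V ∧ Φ x ∈ Metric.ball (Φ b) ε ∧ Q (Φ x) = x ∧ H x ≠ 0 :=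
    Eventually.and (hV.eventually_mem (hY.1 hb)) ((hΦdc.continuousAt.eventually (Metric.ball_mem_nhds _ hε)).and
      (hQP.and hHne))
  obtain ⟨W, hW, hWo, hbW⟩ := mem_nhds_iff.1 hev
  refine ⟨W, hWo, hbW, I, ext ⁻¹' Metric.ball (Φ b) ε, fun u j => Q (ext u) j,
    Metric.isOpen_ball.preimage hextc, fun j => memDC_of_DCAt hM fun u hu =>
      DCAt.apply hM (DCAt.comp hM (hball _ hu).1 (hextdc u)) _, ?_⟩
  ext y
  constructor
  · rintro ⟨hyY, hyW⟩
    obtain ⟨hyV, hyB, hyQ, hyH⟩ := hW hyW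
    have e := hΦext y hyY hyH
    refine ⟨hyW, ?_, fun j => ?_⟩
    · rw [mem_preimage, ← e]; exact hyB
    · beta_reduce
      rw [← e, hyQ]
  · rintro ⟨hyW, hyΩ, hyj⟩
    obtain ⟨hyV, hyB, hyQ, hyH⟩ := hW hyW
    refine ⟨hY.2 y hyV fun f hf hf0 => ?_, hyW⟩
    set u : {i // i ∈ I} → ℝ := fun i => y i with hu
    have hPQu : Φ (Q (ext u)) = ext u := (hball _ hyΩ).2.1
    have hyQu : y = Q (ext u) := by
      ext k
      by_cases h : k ∈ I
      · have := congrFun hPQu k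
        simp only [hΦ, hgJ k ((memI k).1 h)] at this
        rw [this]
        simp [ext, h, hu]
      · exact hyj ⟨k, h⟩
    set v : Fin n → ℝ := ext u - Φ b with hv
    have hvJ : ∀ k ∈ J, v k = 0 := by
      intro k hk
      have h : k ∉ I := by simpa [memI] using hk
      simp [hv, hΦext b hb hHb, ext, h]
    have hconv : ∀ t ∈ Icc (0:ℝ) 1, Φ b + t • v ∈ Metric.ball (Φ b) ε := fun t ht =>
      (convex_ball (Φ b) ε).add_smul_sub_mem (Metric.mem_ball_self hε) hyΩ ht
    have := identity_seg hM (f := fun y => f (Q y)) (x := Φ b) (v := v)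
      (fun t ht => DCAt.comp hM (hf _ (hball _ (hconv t ht)).2.2.1) (hball _ (hconv t ht)).1) (fun j => by
        obtain ⟨f', N, ⟨hf'1, hf'2⟩, hf'3⟩ := flat_aux hM (O := O) (B := Metric.ball (Φ b) ε) (g := g) (Q := Q)
          (P := fun f => (∀ x ∈ O, DCAt M f x) ∧ (∀ y ∈ Y, H y ≠ 0 → f y = 0)) Metric.isOpen_ball hg
          (fun y hy => (hball y hy).2.2.1) (fun y hy => (hball y hy).1) (fun y hy => (hball y hy).2.1)
          (fun y hy => (hball y hy).2.2.2) v (fun f hf => hf.1)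
          (fun f hf => ⟨fun x hx => Dd_dc hM (fun k => hg k x hx) (hf.1 x hx), fun y hy hHy => by
            refine Finset.sum_eq_zero fun i _ => ?_
            by_cases hi : i ∈ J
            · rw [hvJ i hi, zero_mul]
            · rw [hD i hi f hf.1 hf.2 y hy hHy, mul_zero]⟩)
          (fun f f' hf hf' => ⟨fun x hx => (hf.1 x hx).sub hM (hf'.1 x hx), fun y hy hHy => by
            beta_reduce
            rw [hf.2 y hy hHy, hf'.2 y hy hHy, sub_zero]⟩)
          (fun f q hf hq => ⟨fun x hx => (hq x hx).mul hM (hf.1 x hx), fun y hy hHy => by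
            beta_reduce
            rw [hf.2 y hy hHy, mul_zero]⟩)
          (f := f) ⟨hf, fun y hy _ => hf0 y hy⟩ j
        have h1 := hf'3 (Φ b) (Metric.mem_ball_self hε)
        rw [hQb, hf'2 b hb hHb] at h1
        exact (mul_eq_zero.1 h1).resolve_right (pow_ne_zero _ (hδ b hHb)))
    rw [hyQu]
    simpa [hv] using this

lemma smooth_step (hM : IsDCSeq M) {O V Y : Set (Fin n → ℝ)} (hO : IsOpen O) (hVO : V ⊆ O) (hV : IsOpen V)
    (hY : ZC M O V Y) (hne : Y.Nonempty) : ∃ H : (Fin n → ℝ) → ℝ, (∀ x ∈ O, DCAt M H x) ∧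
      (∃ y ∈ Y, H y ≠ 0) ∧ ∀ b ∈ Y, H b ≠ 0 → QMSmoothPt M Y b := by
  classical
  let Pd : Finset (Fin n) → Prop := fun J => ∃ (g : Fin n → (Fin n → ℝ) → ℝ) (h : (Fin n → ℝ) → ℝ),
    (∀ k, ∀ x ∈ O, DCAt M (g k) x) ∧ (∀ x ∈ O, DCAt M h x) ∧ (∀ k ∉ J, g k = fun x => x k) ∧
    (∀ k ∈ J, ∀ y ∈ Y, h y ≠ 0 → g k y = 0) ∧ ∃ y ∈ Y, h y * (jac g y).det ≠ 0
  have h0 : Pd ∅ := by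
    obtain ⟨y, hy⟩ := hne
    refine ⟨fun k x => x k, fun _ => 1, fun k x _ => DCAt.apply hM (DCAt.id hM x) k,
      fun x _ => DCAt.const hM _ _, fun _ _ => rfl, by simp, y, hy, ?_⟩
    have : jac (fun k (x : Fin n → ℝ) => x k) y = 1 := by
      ext k l
      have : fderiv ℝ (fun x : Fin n → ℝ => x k) y = ContinuousLinearMap.proj k :=
        (ContinuousLinearMap.proj k : (Fin n → ℝ) →L[ℝ] ℝ).fderiv
      simp [jac, dv, this, Matrix.one_apply, Pi.single_apply]
    simp [this]
  obtain ⟨J, hJ, hmax⟩ := Finset.exists_max_image (Finset.univ.filter Pd) Finset.card ⟨∅, by simpa using h0⟩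
  obtain ⟨g, h, hg, hh, hgJ, hgY, y0, hy0, hne0⟩ := (Finset.mem_filter.1 hJ).2
  set H : (Fin n → ℝ) → ℝ := fun x => h x * (jac g x).det with hH
  have hHdc : ∀ x ∈ O, DCAt M H x := fun x hx => (hh x hx).mul hM (jac_dc hM fun k => hg k x hx)
  have hHh : ∀ y, H y ≠ 0 → h y ≠ 0 := fun y hy => left_ne_zero_of_mul hy
  refine ⟨H, hHdc, ⟨y0, hy0, hne0⟩, fun b hb hHb => ?_⟩
  refine smooth_at hM hO hVO hV hY hg hHdc hgJ (fun k hk y hy hHy => hgY k hk y hy (hHh y hHy))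
    (fun y hy => right_ne_zero_of_mul hy) ?_ hb hHb
  intro i hi f hf hf0 y hy hHy
  by_contra hcon
  have hP : Pd (insert i J) := by
    refine ⟨Function.update g i f, H, fun k x hx => ?_, hHdc, fun k hk => ?_, fun k hk y hy hHy => ?_,
      y, hy, mul_ne_zero hHy hcon⟩
    · by_cases hk : k = i
      · subst hk; simpa using hf x hx
      · simpa [hk] using hg k x hx
    · rw [Finset.mem_insert, not_or] at hk
      rw [Function.update_of_ne hk.1, hgJ k hk.2]
    · by_cases hki : k = i
      · subst hki; simpa using hf0 y hy hHy
      · rw [Function.update_of_ne hki]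
        exact hgY k (Finset.mem_of_mem_insert_of_ne hk hki) y hy (hHh y hHy)
  have := hmax (insert i J) (by simpa using hP)
  rw [Finset.card_insert_of_notMem hi] at this
  omega

lemma filtr (hM : IsDCSeq M) {O K V : Set (Fin n → ℝ)} (hO : IsOpen O) (hK : IsCompact K) (hKO : K ⊆ O)
    (hVK : V ⊆ K) (hV : IsOpen V) (Z : {Y // ZC M O V Y}) :
    ∃ (t : ℕ) (Y : ℕ → Set (Fin n → ℝ)), Y 0 = Z.1 ∧ (∀ k ≤ t, Y (k+1) ⊆ Y k) ∧ Y (t+1) = ∅ ∧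
      (∀ k ≤ t, IsQMClosed M V (Y k)) ∧ (∀ k ≤ t, ∀ b ∈ Y k \ Y (k + 1), QMSmoothPt M (Y k) b) := by
  induction Z using (ZC.wf hM hO hK hKO hVK).induction with
  | _ Z ih =>
    rcases Z.1.eq_empty_or_nonempty with he | hne
    · have hc := Z.2.closed hM hO hK hKO hVK hV
      rw [he] at hc
      exact ⟨0, fun _ => ∅, he.symm, fun _ _ => subset_rfl, rfl, fun _ _ => hc, fun _ _ b hb => by simp at hb⟩
    · obtain ⟨H, hH, ⟨y, hy, hHy⟩, hs⟩ := smooth_step hM hO (hVK.trans hKO) hV Z.2 hne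
      obtain ⟨t, Y, hY0, hY1, hY2, hY3, hY4⟩ := ih ⟨_, Z.2.inter hH⟩
        ⟨fun x hx => hx.1, fun hsub => hHy (hsub hy).2⟩
      refine ⟨t+1, fun k => Nat.casesOn k Z.1 Y, rfl, ?_, hY2, ?_, ?_⟩
      · rintro (_ | k) hk
        · show Y 0 ⊆ Z.1
          rw [hY0]; exact fun x hx => hx.1
        · exact hY1 k (by omega)
      · rintro (_ | k) hk
        · exact Z.2.closed hM hO hK hKO hVK hV
        · exact hY3 k (by omega)
      · rintro (_ | k) hk b hb
        · have hb' : b ∈ Z.1 \ Y 0 := hb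
          rw [hY0] at hb'
          exact hs b hb'.1 fun h => hb'.2 ⟨hb'.1, h⟩
        · exact hY4 k (by omega) b hb

end Step

theorem main_aux
    {n : ℕ} (M : ℕ → ℝ) (hM : IsDCSeq M)
    (U : Set (Fin n → ℝ)) (hU : IsOpen U)
    (X : Set (Fin n → ℝ)) (hX : IsQMClosed M U X)
    (a : Fin n → ℝ) (ha : a ∈ X) :
    ∃ (V : Set (Fin n → ℝ)) (t : ℕ) (Y : ℕ → Set (Fin n → ℝ)),
      IsOpen V ∧ a ∈ V ∧ V ⊆ U ∧
      Y 0 = X ∩ V ∧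
      (∀ k ≤ t, Y (k + 1) ⊆ Y k) ∧
      Y (t + 1) = ∅ ∧
      (∀ k ≤ t, IsQMClosed M V (Y k)) ∧
      (∀ k ≤ t, ∀ b ∈ Y k \ Y (k + 1), QMSmoothPt M (Y k) b) := by
  obtain ⟨-, -, hloc⟩ := hX
  obtain ⟨O, hO, haO, hOU, k, g, hg, hgX⟩ := hloc a ha
  obtain ⟨r, hr, hrO⟩ := Metric.nhds_basis_closedBall.mem_iff.1 (hO.mem_nhds haO)
  have hZ : ZC M O (Metric.ball a r) (X ∩ Metric.ball a r) := by
    have e : X ∩ Metric.ball a r = {x ∈ Metric.ball a r | ∀ f ∈ Set.range g, f x = 0} := by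
      ext x
      simp only [mem_inter_iff, mem_ofPred_eq, forall_mem_range]
      rw [and_comm]
      refine and_congr_right fun hx => ?_
      have hxO : x ∈ O := hrO (Metric.ball_subset_closedBall hx)
      have := Set.ext_iff.1 hgX x
      simpa [hxO] using this
    rw [e]
    refine ZC.zeros _ ?_
    rintro _ ⟨i, rfl⟩ z hz
    exact (hg i).dcAt hM hO hz
  obtain ⟨t, Y, h⟩ := filtr hM hO (isCompact_closedBall a r) hrO Metric.ball_subset_closedBall
    Metric.isOpen_ball ⟨_, hZ⟩
  exact ⟨_, t, Y, Metric.isOpen_ball, Metric.mem_ball_self hr,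
    (Metric.ball_subset_closedBall.trans hrO).trans hOU, h⟩

end QDC

namespace QDC

/-- Local filtration of a closed `Q_M`-set by closed `Q_M`-subsets with smooth
differences (Lemma 3.7). -/
theorem filtration_with_smooth_differences
    {n : ℕ} (M : ℕ → ℝ) (hM : IsDCSeq M)
    (U : Set (Fin n → ℝ)) (hU : IsOpen U)
    (X : Set (Fin n → ℝ)) (hX : IsQMClosed M U X)
    (a : Fin n → ℝ) (ha : a ∈ X) :
    ∃ (V : Set (Fin n → ℝ)) (t : ℕ) (Y : ℕ → Set (Fin n → ℝ)),
      IsOpen V ∧ a ∈ V ∧ V ⊆ U ∧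
      Y 0 = X ∩ V ∧
      (∀ k ≤ t, Y (k + 1) ⊆ Y k) ∧
      Y (t + 1) = ∅ ∧
      (∀ k ≤ t, IsQMClosed M V (Y k)) ∧
      (∀ k ≤ t, ∀ b ∈ Y k \ Y (k + 1), QMSmoothPt M (Y k) b) := by
  exact main_aux M hM U hU X hX a ha

end QDC
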